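/- arXiv:1311.7475 — 2 statements merged into one kernel-verified Lean document; each statement's English description precedes it below -/
import Mathlib

section
/- Let q = (−u, 0) ∈ M̃ with 0 < u < t₀. Then the cut locus of q is exactly the set C_q = {(t, θ) : t = u and |θ| ≥ φ(m(u))}. -/
open Real Set

noncomputable section

/-- Length of a C¹ curve `c` on `[a,b]` in the warped product metric
`ds² = dt² + m(t)² dθ²` on `M̃ = ℝ²` (coordinates `(t,θ)`). -/
def wLength (m : ℝ → ℝ) (c : ℝ → ℝ × ℝ) (a b : ℝ) : ℝ :=
  ∫ s in a..b,
    Real.sqrt ((deriv (fun u => (c u).1) s) ^ 2 +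
      (m (c s).1) ^ 2 * (deriv (fun u => (c u).2) s) ^ 2)

/-- The Riemannian distance on `M̃`: the infimum of lengths of C¹ curves joining `p` to `q`. -/
def wDist (m : ℝ → ℝ) (p q : ℝ × ℝ) : ℝ :=
  sInf {L : ℝ | ∃ c : ℝ → ℝ × ℝ, ∃ b : ℝ, 0 ≤ b ∧ ContDiff ℝ 1 c ∧
    c 0 = p ∧ c b = q ∧ L = wLength m c 0 b}

/-- `γ = (t(s), θ(s))` is a unit-speed geodesic of the warped product metric:
`t'' = m(t) m'(t) θ'²`, `m(t)² θ'` is constant, and `t'² + m(t)² θ'² = 1`. -/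
def IsUnitGeodesic (m : ℝ → ℝ) (γ : ℝ → ℝ × ℝ) : Prop :=
  ContDiff ℝ 2 γ ∧
  (∀ s, deriv (deriv fun u => (γ u).1) s =
      m (γ s).1 * deriv m (γ s).1 * (deriv (fun u => (γ u).2) s) ^ 2) ∧
  (∃ ν : ℝ, ∀ s, m (γ s).1 ^ 2 * deriv (fun u => (γ u).2) s = ν) ∧
  (∀ s, (deriv (fun u => (γ u).1) s) ^ 2 +
      m (γ s).1 ^ 2 * (deriv (fun u => (γ u).2) s) ^ 2 = 1)

/-- `ν` is the Clairaut constant of the geodesic `γ`: `m(t(s))² θ'(s) = ν` for all `s`. -/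
def HasClairaut (m : ℝ → ℝ) (γ : ℝ → ℝ × ℝ) (ν : ℝ) : Prop :=
  ∀ s, m (γ s).1 ^ 2 * deriv (fun u => (γ u).2) s = ν

/-- The (unit-speed) geodesic segment `γ|[0,a]` is minimal: its length `a` equals
the distance between its endpoints. -/
def IsMinimalSeg (m : ℝ → ℝ) (γ : ℝ → ℝ × ℝ) (a : ℝ) : Prop :=
  wDist m (γ 0) (γ a) = a

/-- `x` is a cut point of `p`: the endpoint of some minimal geodesic segment from `p`
no extension of which is minimal. -/
def IsCutPoint (m : ℝ → ℝ) (p x : ℝ × ℝ) : Prop :=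
  ∃ γ : ℝ → ℝ × ℝ, ∃ a : ℝ, IsUnitGeodesic m γ ∧ γ 0 = p ∧ 0 < a ∧ γ a = x ∧
    IsMinimalSeg m γ a ∧ ∀ ε > 0, ¬ IsMinimalSeg m γ (a + ε)

/-- The cut locus of `p` in `M̃`. -/
def cutLocus (m : ℝ → ℝ) (p : ℝ × ℝ) : Set (ℝ × ℝ) := {x | IsCutPoint m p x}

/-- The Gaussian curvature `K(t) = -m''(t)/m(t)` of the warped product metric. -/
def gaussK (m : ℝ → ℝ) (t : ℝ) : ℝ := -(deriv (deriv m) t) / m t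

/-- `ξ(ν) := min {t > 0 | m t = ν}`. -/
def xi (m : ℝ → ℝ) (ν : ℝ) : ℝ := sInf {t : ℝ | 0 < t ∧ m t = ν}

/-- `φ(ν) := 2∫₀^{ξ(ν)} ν / (m(t) √(m(t)² - ν²)) dt`. -/
def phi (m : ℝ → ℝ) (ν : ℝ) : ℝ :=
  2 * ∫ t in (0:ℝ)..(xi m ν), ν / (m t * Real.sqrt ((m t) ^ 2 - ν ^ 2))

/-- `l(ν) := 2∫_{-ξ(ν)}^{0} m(t) / √(m(t)² - ν²) dt`. -/
def ell (m : ℝ → ℝ) (ν : ℝ) : ℝ :=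
  2 * ∫ t in (-(xi m ν))..(0:ℝ), m t / Real.sqrt ((m t) ^ 2 - ν ^ 2)

/-- `inf m`. -/
def infm (m : ℝ → ℝ) : ℝ := ⨅ t : ℝ, m t

/-- `t₀ := sup {t > 0 | m'(t) < 0}`. -/
def tZero (m : ℝ → ℝ) : ℝ := sSup {t : ℝ | 0 < t ∧ deriv m t < 0}


/-- A function with continuous derivative bounded below by `c > 0` has a global inverse. -/
lemma exists_inv (g : ℝ → ℝ) (hg : Continuous g) (c : ℝ) (hc : 0 < c) (hgc : ∀ x, c ≤ g x) :
    ∃ P : ℝ → ℝ, (∀ x, P (∫ y in (0:ℝ)..x, g y) = x) ∧ (∀ y, ∫ z in (0:ℝ)..(P y), g z = y) ∧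
      ∀ y, HasDerivAt P (g (P y))⁻¹ y := by
  set S : ℝ → ℝ := fun x => ∫ y in (0:ℝ)..x, g y with hS
  have hd : ∀ x, HasDerivAt S (g x) x := fun x =>
    intervalIntegral.integral_hasDerivAt_right (hg.intervalIntegrable _ _)
      (hg.stronglyMeasurableAtFilter _ _) hg.continuousAt
  have hpos : ∀ x, 0 < g x := fun x => hc.trans_le (hgc x)
  have hmono : StrictMono S := strictMono_of_deriv_pos (fun x => by rw [(hd x).deriv]; exact hpos x)
  have hcont : Continuous S := continuous_iff_continuousAt.2 fun x => (hd x).continuousAt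
  have hS0 : S 0 = 0 := by simp [hS]
  have hmono2 : Monotone (fun x => S x - c * x) := by
    apply monotone_of_deriv_nonneg
    · intro x
      exact ((hd x).sub ((hasDerivAt_id x).const_mul c)).differentiableAt
    · intro x
      have := ((hd x).sub ((hasDerivAt_id x).const_mul c)).deriv
      simp only [id] at this
      have h2 : deriv (fun x => S x - c * x) x = g x - c * 1 := this
      rw [h2]; linarith [hgc x]
  have hsurj : Function.Surjective S := by
    apply hcont.surjective
    · apply Filter.tendsto_atTop_mono' _ _ (Filter.tendsto_id.const_mul_atTop hc)
      filter_upwards [Filter.eventually_ge_atTop 0] with x hx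
      have := hmono2 hx
      simp only [hS0] at this
      simp only [id]; linarith
    · apply Filter.tendsto_atBot_mono' _ _ (Filter.tendsto_id.const_mul_atBot hc)
      filter_upwards [Filter.eventually_le_atBot 0] with x hx
      have := hmono2 hx
      simp only [hS0] at this
      simp only [id]; linarith
  let e := StrictMono.orderIsoOfSurjective S hmono hsurj
  have he : ∀ x, e x = S x := fun x => rfl
  refine ⟨e.symm, fun x => ?_, fun y => ?_, fun y => ?_⟩
  · exact e.symm_apply_apply x
  · exact e.apply_symm_apply y
  · exact HasDerivAt.of_local_left_inverse e.symm.continuous.continuousAt (hd _) (hpos _).ne'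
      (Filter.Eventually.of_forall fun z => e.apply_symm_apply z)

/-- Uniqueness for autonomous second order ODEs `x'' = F(x)`. -/
lemma ode2_unique (F : ℝ → ℝ) (hF : ContDiff ℝ 1 F) (x x' y y' : ℝ → ℝ)
    (hx : ∀ s, HasDerivAt x (x' s) s) (hx' : ∀ s, HasDerivAt x' (F (x s)) s)
    (hy : ∀ s, HasDerivAt y (y' s) s) (hy' : ∀ s, HasDerivAt y' (F (y s)) s)
    (h0 : x 0 = y 0) (h0' : x' 0 = y' 0) : ∀ s, 0 ≤ s → x s = y s ∧ x' s = y' s := by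
  intro A hA
  have cx : Continuous x := continuous_iff_continuousAt.2 fun s => (hx s).continuousAt
  have cx' : Continuous x' := continuous_iff_continuousAt.2 fun s => (hx' s).continuousAt
  have cy : Continuous y := continuous_iff_continuousAt.2 fun s => (hy s).continuousAt
  have cy' : Continuous y' := continuous_iff_continuousAt.2 fun s => (hy' s).continuousAt
  obtain ⟨R, hR⟩ := (isCompact_Icc (a := (0:ℝ)) (b := A)).exists_bound_of_continuousOn
    ((cx.prodMk cy).continuousOn)
  set v : ℝ × ℝ → ℝ × ℝ := fun p => (p.2, F p.1) with hv
  have hvC : ContDiff ℝ 1 v := by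
    apply ContDiff.prodMk contDiff_snd (hF.comp contDiff_fst)
  obtain ⟨R2, hR2⟩ := (isCompact_Icc (a := (0:ℝ)) (b := A)).exists_bound_of_continuousOn
    (((cx.prodMk cx').prodMk (cy.prodMk cy')).continuousOn)
  have hconv : Convex ℝ (Metric.closedBall (0:ℝ×ℝ) R2) := convex_closedBall _ _
  obtain ⟨K, hK⟩ : ∃ K, LipschitzOnWith K v (Metric.closedBall (0:ℝ×ℝ) R2) := by
    exact (hvC.contDiffOn).exists_lipschitzOnWith one_ne_zero hconv (isCompact_closedBall _ _)
  have key := ODE_solution_unique_of_mem_Icc_right (v := fun _ => v) (a := 0) (b := A)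
    (s := fun _ => Metric.closedBall (0:ℝ×ℝ) R2) (K := K)
    (f := fun s => (x s, x' s)) (g := fun s => (y s, y' s)) (fun _ _ => hK)
    (cx.prodMk cx').continuousOn
    (fun t _ => ((hx t).prodMk (hx' t)).hasDerivWithinAt)
    (fun t ht => by
      have := hR2 t ⟨ht.1, ht.2.le⟩
      rw [mem_closedBall_zero_iff]
      exact (norm_fst_le _).trans this)
    (cy.prodMk cy').continuousOn
    (fun t _ => ((hy t).prodMk (hy' t)).hasDerivWithinAt)
    (fun t ht => by
      have := hR2 t ⟨ht.1, ht.2.le⟩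
      rw [mem_closedBall_zero_iff]
      exact (norm_snd_le _).trans this)
    (by simp [h0, h0'])
  have := key ⟨hA, le_rfl⟩
  simpa using this


/-- Integrand of the length functional. -/
def spd (m : ℝ → ℝ) (c : ℝ → ℝ × ℝ) (s : ℝ) : ℝ :=
    Real.sqrt ((deriv (fun u => (c u).1) s) ^ 2 +
      (m (c s).1) ^ 2 * (deriv (fun u => (c u).2) s) ^ 2)

lemma wLength_eq (m : ℝ → ℝ) (c : ℝ → ℝ × ℝ) (a b : ℝ) :
    wLength m c a b = ∫ s in a..b, spd m c s := rfl

lemma spd_nonneg (m : ℝ → ℝ) (c : ℝ → ℝ × ℝ) (s : ℝ) : 0 ≤ spd m c s := Real.sqrt_nonneg _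

lemma fst_hasDeriv {c : ℝ → ℝ × ℝ} (hc : ContDiff ℝ 1 c) (s : ℝ) :
    HasDerivAt (fun u => (c u).1) (deriv (fun u => (c u).1) s) s :=
  ((contDiff_fst.comp hc).differentiable one_ne_zero s).hasDerivAt

lemma snd_hasDeriv {c : ℝ → ℝ × ℝ} (hc : ContDiff ℝ 1 c) (s : ℝ) :
    HasDerivAt (fun u => (c u).2) (deriv (fun u => (c u).2) s) s :=
  ((contDiff_snd.comp hc).differentiable one_ne_zero s).hasDerivAt

lemma fst_deriv_cont {c : ℝ → ℝ × ℝ} (hc : ContDiff ℝ 1 c) :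
    Continuous (deriv (fun u => (c u).1)) :=
  (contDiff_fst.comp hc).continuous_deriv le_rfl

lemma snd_deriv_cont {c : ℝ → ℝ × ℝ} (hc : ContDiff ℝ 1 c) :
    Continuous (deriv (fun u => (c u).2)) :=
  (contDiff_snd.comp hc).continuous_deriv le_rfl

lemma spd_cont {m : ℝ → ℝ} (hm : Continuous m) {c : ℝ → ℝ × ℝ} (hc : ContDiff ℝ 1 c) :
    Continuous (spd m c) := by
  have h1 := fst_deriv_cont hc
  have h2 := snd_deriv_cont hc
  have h3 : Continuous fun s => m (c s).1 := hm.comp (continuous_fst.comp hc.continuous)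
  unfold spd
  fun_prop

lemma wLength_nonneg (m : ℝ → ℝ) (c : ℝ → ℝ × ℝ) {b : ℝ} (hb : 0 ≤ b) : 0 ≤ wLength m c 0 b :=
  intervalIntegral.integral_nonneg hb fun _ _ => spd_nonneg _ _ _

lemma wDist_bdd (m : ℝ → ℝ) (p q : ℝ × ℝ) :
    BddBelow {L : ℝ | ∃ c : ℝ → ℝ × ℝ, ∃ b : ℝ, 0 ≤ b ∧ ContDiff ℝ 1 c ∧
    c 0 = p ∧ c b = q ∧ L = wLength m c 0 b} :=
  ⟨0, by rintro L ⟨c, b, hb, -, -, -, rfl⟩; exact wLength_nonneg m c hb⟩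

lemma wDist_nonempty (m : ℝ → ℝ) (p q : ℝ × ℝ) :
    {L : ℝ | ∃ c : ℝ → ℝ × ℝ, ∃ b : ℝ, 0 ≤ b ∧ ContDiff ℝ 1 c ∧
    c 0 = p ∧ c b = q ∧ L = wLength m c 0 b}.Nonempty :=
  ⟨_, fun s => p + s • (q - p), 1, zero_le_one, by fun_prop, by simp, by simp, rfl⟩

lemma wDist_le {m : ℝ → ℝ} {c : ℝ → ℝ × ℝ} (hc : ContDiff ℝ 1 c) {b : ℝ} (hb : 0 ≤ b) :
    wDist m (c 0) (c b) ≤ wLength m c 0 b :=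
  csInf_le (wDist_bdd m _ _) ⟨c, b, hb, hc, rfl, rfl, rfl⟩

lemma wDist_le_ab {m : ℝ → ℝ} {c : ℝ → ℝ × ℝ} (hc : ContDiff ℝ 1 c) {a b : ℝ} (hab : a ≤ b) :
    wDist m (c a) (c b) ≤ ∫ s in a..b, spd m c s := by
  have h := wDist_le (m := m) (c := fun s => c (s + a)) (by fun_prop) (sub_nonneg.2 hab)
  simp only [zero_add, sub_add_cancel] at h
  refine h.trans_eq ?_
  rw [wLength_eq]
  have : spd m (fun s => c (s + a)) = fun s => spd m c (s + a) := by
    funext s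
    unfold spd
    rw [deriv_comp_add_const (f := fun u => (c u).1), deriv_comp_add_const (f := fun u => (c u).2)]
  rw [this, intervalIntegral.integral_comp_add_right (f := spd m c)]
  simp

lemma le_wDist {m : ℝ → ℝ} {p q : ℝ × ℝ} {L : ℝ}
    (h : ∀ (c : ℝ → ℝ × ℝ) (b : ℝ), 0 ≤ b → ContDiff ℝ 1 c → c 0 = p → c b = q →
      L ≤ wLength m c 0 b) : L ≤ wDist m p q := by
  apply le_csInf (wDist_nonempty m p q)
  rintro _ ⟨c, b, hb, hc, h0, h1, rfl⟩
  exact h c b hb hc h0 h1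

lemma spd_congr {m : ℝ → ℝ} {c d : ℝ → ℝ × ℝ} {s : ℝ} (h : c =ᶠ[nhds s] d) :
    spd m c s = spd m d s := by
  have h1 : (fun u => (c u).1) =ᶠ[nhds s] fun u => (d u).1 := h.mono fun x hx => by simp [hx]
  have h2 : (fun u => (c u).2) =ᶠ[nhds s] fun u => (d u).2 := h.mono fun x hx => by simp [hx]
  unfold spd
  rw [h1.deriv_eq, h2.deriv_eq, h.eq_of_nhds]

lemma spd_comp {m : ℝ → ℝ} {c : ℝ → ℝ × ℝ} (hc : ContDiff ℝ 1 c) {f : ℝ → ℝ} {f' s : ℝ}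
    (hf : HasDerivAt f f' s) (h0 : 0 ≤ f') :
    spd m (fun x => c (f x)) s = spd m c (f s) * f' := by
  have h1 : deriv (fun u => (c (f u)).1) s = deriv (fun u => (c u).1) (f s) * f' :=
    (HasDerivAt.comp s (fst_hasDeriv hc (f s)) hf).deriv
  have h2 : deriv (fun u => (c (f u)).2) s = deriv (fun u => (c u).2) (f s) * f' :=
    (HasDerivAt.comp s (snd_hasDeriv hc (f s)) hf).deriv
  unfold spd
  rw [h1, h2, mul_pow, mul_pow]
  rw [show (deriv (fun u => (c u).1) (f s) ^ 2 * f' ^ 2 +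
    m (c (f s)).1 ^ 2 * (deriv (fun u => (c u).2) (f s) ^ 2 * f' ^ 2)) =
    (deriv (fun u => (c u).1) (f s) ^ 2 +
    m (c (f s)).1 ^ 2 * deriv (fun u => (c u).2) (f s) ^ 2) * f' ^ 2 by ring,
    Real.sqrt_mul' _ (sq_nonneg _), Real.sqrt_sq h0]

lemma spd_reparam {m : ℝ → ℝ} (hm : Continuous m) {c : ℝ → ℝ × ℝ} (hc : ContDiff ℝ 1 c)
    {f : ℝ → ℝ} (hf : ContDiff ℝ 1 f) (hmono : Monotone f) (a b : ℝ) :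
    ∫ s in a..b, spd m (fun x => c (f x)) s = ∫ s in (f a)..(f b), spd m c s := by
  rw [← intervalIntegral.integral_comp_mul_deriv (f := f) (f' := deriv f)
    (fun x _ => (hf.differentiable one_ne_zero x).hasDerivAt) (hf.continuous_deriv le_rfl).continuousOn
    (spd_cont hm hc)]
  congr 1
  funext s
  exact spd_comp hc (hf.differentiable one_ne_zero s).hasDerivAt (hmono.deriv_nonneg)

lemma wDist_triangle {m : ℝ → ℝ} (hm : Continuous m) (p q r : ℝ × ℝ) :
    wDist m p r ≤ wDist m p q + wDist m q r := by
  have key : ∀ (c : ℝ → ℝ × ℝ) (b : ℝ), 0 ≤ b → ContDiff ℝ 1 c → c 0 = p → c b = q →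
      ∀ (d : ℝ → ℝ × ℝ) (e : ℝ), 0 ≤ e → ContDiff ℝ 1 d → d 0 = q → d e = r →
      wDist m p r ≤ wLength m c 0 b + wLength m d 0 e := by
    intro c b hb hc c0 cb d e he hd d0 de
    set f : ℝ → ℝ := fun s => b * Real.smoothTransition s with hf
    set g : ℝ → ℝ := fun s => e * Real.smoothTransition (s - 1) with hg
    have hst : ContDiff ℝ 1 Real.smoothTransition := Real.smoothTransition.contDiff (n := 1)
    have hfC : ContDiff ℝ 1 f := contDiff_const.mul hst
    have hgC : ContDiff ℝ 1 g := contDiff_const.mul (hst.comp (contDiff_id.sub contDiff_const))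
    have hfm : Monotone f := fun x y h =>
      mul_le_mul_of_nonneg_left (Real.smoothTransition.monotone h) hb
    have hgm : Monotone g := fun x y h =>
      mul_le_mul_of_nonneg_left (Real.smoothTransition.monotone (by linarith)) he
    set k : ℝ → ℝ × ℝ := fun s => c (f s) + d (g s) - q with hk
    have hkC : ContDiff ℝ 1 k := ((hc.comp hfC).add (hd.comp hgC)).sub contDiff_const
    have k1 : ∀ s ≤ 1, k s = c (f s) := by
      intro s hs
      have : g s = 0 := by
        simp only [hg]; rw [Real.smoothTransition.zero_of_nonpos (by linarith)]; simp
      simp only [hk, this, d0]; simp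
    have k2 : ∀ s, 1 ≤ s → k s = d (g s) := by
      intro s hs
      have : f s = b := by
        simp only [hf]; rw [Real.smoothTransition.one_of_one_le hs]; simp
      simp only [hk, this, cb]; simp
    have f0 : f 0 = 0 := by simp [hf]
    have f1 : f 1 = b := by simp [hf]
    have g1 : g 1 = 0 := by simp [hg]
    have g2 : g 2 = e := by simp only [hg]; norm_num
    have h := wDist_le (m := m) hkC (b := 2) (by norm_num)
    rw [k1 0 (by norm_num), k2 2 (by norm_num), f0, g2, c0, de] at h
    refine h.trans_eq ?_
    rw [wLength_eq, wLength_eq, wLength_eq]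
    have hi := spd_cont hm hkC
    rw [← intervalIntegral.integral_add_adjacent_intervals (hi.intervalIntegrable 0 1)
      (hi.intervalIntegrable 1 2)]
    congr 1
    · have e1 := spd_reparam hm hc hfC hfm 0 1
      rw [f0, f1] at e1
      rw [← e1]
      apply intervalIntegral.integral_congr_Ioo_of_le zero_le_one
      intro s hs
      apply spd_congr
      filter_upwards [Iio_mem_nhds hs.2] with x hx
      exact k1 x hx.le
    · have e1 := spd_reparam hm hd hgC hgm 1 2
      rw [g1, g2] at e1
      rw [← e1]
      apply intervalIntegral.integral_congr_Ioo_of_le one_le_two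
      intro s hs
      apply spd_congr
      filter_upwards [Ioi_mem_nhds hs.1] with x hx
      exact k2 x hx.le
  have h1 : wDist m p r - wDist m q r ≤ wDist m p q := by
    apply le_wDist
    intro c b hb hc c0 cb
    have : wDist m p r - wLength m c 0 b ≤ wDist m q r := by
      apply le_wDist
      intro d e he hd d0 de
      linarith [key c b hb hc c0 cb d e he hd d0 de]
    linarith
  linarith

lemma wDist_chord {m : ℝ → ℝ} (hmpos : ∀ t, 0 < m t) (p q : ℝ × ℝ) (C : ℝ)
    (hC : ∀ t ∈ uIcc p.1 q.1, m t ≤ C) :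
    wDist m p q ≤ |q.1 - p.1| + C * |q.2 - p.2| := by
  have h := wDist_le (m := m) (c := fun s => p + s • (q - p)) (by fun_prop) zero_le_one
  simp only [zero_smul, add_zero, one_smul, add_sub_cancel] at h
  refine h.trans ?_
  rw [wLength_eq]
  have hb : ∀ s ∈ uIoc (0:ℝ) 1, ‖spd m (fun s => p + s • (q - p)) s‖ ≤
      |q.1 - p.1| + C * |q.2 - p.2| := by
    intro s hs
    rw [uIoc_of_le zero_le_one] at hs
    rw [Real.norm_of_nonneg (spd_nonneg _ _ _)]
    have d1 : deriv (fun u : ℝ => (p + u • (q - p)).1) s = q.1 - p.1 := by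
      have : HasDerivAt (fun u : ℝ => p.1 + u * (q.1 - p.1)) (1 * (q.1 - p.1)) s :=
        ((hasDerivAt_id s).mul_const _).const_add _
      simpa using this.deriv
    have d2 : deriv (fun u : ℝ => (p + u • (q - p)).2) s = q.2 - p.2 := by
      have : HasDerivAt (fun u : ℝ => p.2 + u * (q.2 - p.2)) (1 * (q.2 - p.2)) s :=
        ((hasDerivAt_id s).mul_const _).const_add _
      simpa using this.deriv
    have hmC : m (p + s • (q - p)).1 ≤ C := by
      apply hC
      have : (p + s • (q - p)).1 = p.1 + s * (q.1 - p.1) := by simp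
      rw [this, mem_uIcc]
      rcases le_total p.1 q.1 with h | h
      · left; constructor <;> nlinarith [hs.1, hs.2]
      · right; constructor <;> nlinarith [hs.1, hs.2]
    have hm0 := hmpos (p + s • (q - p)).1
    have hC0 : 0 < C := hm0.trans_le hmC
    unfold spd
    rw [d1, d2]
    apply Real.sqrt_le_iff.2
    constructor
    · positivity
    · have : (m (p + s • (q - p)).1) ^ 2 ≤ C ^ 2 := by gcongr
      rw [← sq_abs (q.1 - p.1), ← sq_abs (q.2 - p.2)]
      have h3 : (m (p + s • (q - p)).1) ^ 2 * |q.2 - p.2| ^ 2 ≤ C ^ 2 * |q.2 - p.2| ^ 2 := by gcongr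
      have h4 : 0 ≤ |q.1 - p.1| * (C * |q.2 - p.2|) := by positivity
      nlinarith
  have := intervalIntegral.norm_integral_le_of_norm_le_const hb
  rw [sub_zero, abs_one, mul_one] at this
  exact (le_abs_self _).trans this


/-- Bundled facts on the warping function. -/
structure Warp (m : ℝ → ℝ) (t₀ : ℝ) : Prop where
  smooth : ContDiff ℝ (⊤:ℕ∞) m
  pos : ∀ t, 0 < m t
  even : ∀ t, m (-t) = m t
  K0 : 0 < gaussK m 0
  Kdec : AntitoneOn (gaussK m) (Ici 0)
  t0pos : 0 < t₀
  dneg : ∀ t, 0 < t → t < t₀ → deriv m t < 0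
  d0 : deriv m t₀ = 0
  isMin : ∀ t, m t₀ ≤ m t

lemma sq_hasDeriv {f : ℝ → ℝ} {f' x : ℝ} (h : HasDerivAt f f' x) :
    HasDerivAt (fun t => f t ^ 2) (2 * f x * f') x := by
  have := h.pow 2
  simp only [Nat.cast_ofNat, Nat.add_one_sub_one, pow_one] at this
  exact this

lemma m_d1 {m : ℝ → ℝ} (hm : ContDiff ℝ (⊤:ℕ∞) m) (t : ℝ) : HasDerivAt m (deriv m t) t :=
  (hm.differentiable (by simp) t).hasDerivAt

lemma m_dC {m : ℝ → ℝ} (hm : ContDiff ℝ (⊤:ℕ∞) m) : ContDiff ℝ 1 (deriv m) := by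
  have h2 : ContDiff ℝ (1 + 1) m := by
    have := contDiff_infty.1 hm 2
    rw [one_add_one_eq_two]; exact_mod_cast this
  exact (contDiff_succ_iff_deriv.1 h2).2.2

lemma m_d2 {m : ℝ → ℝ} (hm : ContDiff ℝ (⊤:ℕ∞) m) (t : ℝ) :
    HasDerivAt (deriv m) (deriv (deriv m) t) t :=
  ((m_dC hm).differentiable one_ne_zero t).hasDerivAt

lemma m_d2c {m : ℝ → ℝ} (hm : ContDiff ℝ (⊤:ℕ∞) m) : Continuous (deriv (deriv m)) :=
  (m_dC hm).continuous_deriv le_rfl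

lemma m_d1odd {m : ℝ → ℝ} (heven : ∀ t, m (-t) = m t) (t : ℝ) :
    deriv m (-t) = - deriv m t := by
  have h : (fun x => m (-x)) = m := funext heven
  have := deriv_comp_neg m t
  rw [h] at this
  linarith

lemma m_d1zero {m : ℝ → ℝ} (heven : ∀ t, m (-t) = m t) : deriv m 0 = 0 := by
  have := m_d1odd heven 0
  simp at this
  linarith

lemma warp_of {m : ℝ → ℝ} (hm : ContDiff ℝ (⊤:ℕ∞) m) (hmpos : ∀ t, 0 < m t)
    (hmeven : ∀ t, m (-t) = m t)
    (hK0 : 0 < gaussK m 0) (hKdec : AntitoneOn (gaussK m) (Ici 0))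
    (ht : 0 < tZero m) : Warp m (tZero m) := by
  set t₀ := tZero m with ht₀
  set S := {t : ℝ | 0 < t ∧ deriv m t < 0} with hS
  have hbdd : BddAbove S := by
    by_contra h
    have : t₀ = 0 := Real.sSup_of_not_bddAbove h
    linarith
  have hne : S.Nonempty := by
    by_contra h
    rw [not_nonempty_iff_eq_empty] at h
    have : t₀ = 0 := by rw [ht₀, tZero, ← hS, h]; exact Real.sSup_empty
    linarith
  have hd10 := m_d1zero hmeven
  have hd20 : deriv (deriv m) 0 < 0 := by
    unfold gaussK at hK0
    by_contra h
    push Not at h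
    have : -deriv (deriv m) 0 / m 0 ≤ 0 := div_nonpos_of_nonpos_of_nonneg (by linarith) (hmpos 0).le
    linarith
  have hsmall : ∀ t, 0 < t → ∃ ε, 0 < ε ∧ ε < t ∧ deriv m ε < 0 := by
    intro t ht
    have h1 := (hasDerivAt_iff_tendsto_slope.1 (m_d2 hm 0)).eventually (Iio_mem_nhds hd20)
    have h2 : ∀ᶠ x in nhdsWithin (0:ℝ) (Ioi 0), slope (deriv m) 0 x < 0 :=
      h1.filter_mono (nhdsWithin_mono _ (fun x hx => ne_of_gt hx))
    have h3 : ∀ᶠ x in nhdsWithin (0:ℝ) (Ioi 0), x ∈ Ioo 0 t := Ioo_mem_nhdsGT ht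
    obtain ⟨x, hx1, hx2⟩ := (h2.and h3).exists
    refine ⟨x, hx2.1, hx2.2, ?_⟩
    rw [slope_def_field, hd10, sub_zero, sub_zero] at hx1
    by_contra h
    push Not at h
    have := div_nonneg h hx2.1.le
    linarith
  have hneg : ∀ t, 0 < t → t < t₀ → deriv m t < 0 := by
    intro t ht htt
    obtain ⟨t2, ht2, htt2⟩ := exists_lt_of_lt_csSup hne htt
    by_contra hcon
    push Not at hcon
    obtain ⟨ε, hε, hεt, hmε⟩ := hsmall t ht
    obtain ⟨t3, ht3, h3⟩ := exists_hasDerivAt_eq_slope (deriv m) (deriv (deriv m)) hεt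
      (m_dC hm).continuous.continuousOn (fun x _ => m_d2 hm x)
    have hpos3 : 0 < deriv (deriv m) t3 := by
      rw [h3]; apply div_pos <;> linarith
    have hK3 : gaussK m t3 < 0 := by
      unfold gaussK; exact div_neg_of_neg_of_pos (by linarith) (hmpos _)
    have hm2 : ∀ x, t3 ≤ x → 0 < deriv (deriv m) x := by
      intro x hx
      have h30 : 0 ≤ t3 := by linarith [ht3.1]
      have := hKdec (show t3 ∈ Ici (0:ℝ) from h30) (show x ∈ Ici (0:ℝ) from h30.trans hx) hx
      have h4 : gaussK m x < 0 := by linarith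
      unfold gaussK at h4
      by_contra h
      push Not at h
      have := div_nonneg (by linarith : 0 ≤ -deriv (deriv m) x) (hmpos x).le
      linarith
    have hsm : StrictMonoOn (deriv m) (Ici t3) := by
      apply strictMonoOn_of_deriv_pos (convex_Ici _) (m_dC hm).continuous.continuousOn
      intro x hx
      rw [interior_Ici] at hx
      exact hm2 x (le_of_lt hx)
    have := hsm (show t ∈ Ici t3 from ht3.2.le) (show t2 ∈ Ici t3 from (ht3.2.trans htt2).le) htt2
    linarith [ht2.2]
  have hge : ∀ t, t₀ < t → 0 ≤ deriv m t := by
    intro t htt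
    by_contra h
    push Not at h
    have : t ≤ t₀ := le_csSup hbdd ⟨ht.trans htt, h⟩
    linarith
  have hd1c : Continuous (deriv m) := (m_dC hm).continuous
  have hz : deriv m t₀ = 0 := by
    apply le_antisymm
    · have : Filter.Tendsto (deriv m) (nhdsWithin t₀ (Iio t₀)) (nhds (deriv m t₀)) :=
        hd1c.continuousAt.tendsto.mono_left nhdsWithin_le_nhds
      apply le_of_tendsto this
      filter_upwards [Ioo_mem_nhdsLT ht] with x hx
      exact (hneg x hx.1 hx.2).le
    · have : Filter.Tendsto (deriv m) (nhdsWithin t₀ (Ioi t₀)) (nhds (deriv m t₀)) :=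
        hd1c.continuousAt.tendsto.mono_left nhdsWithin_le_nhds
      apply ge_of_tendsto this
      filter_upwards [self_mem_nhdsWithin] with x hx
      exact hge x hx
  have hmc : Continuous m := hm.continuous
  have hanti : AntitoneOn m (Icc 0 t₀) := by
    apply antitoneOn_of_deriv_nonpos (convex_Icc _ _) hmc.continuousOn
      (hm.differentiable (by simp)).differentiableOn
    intro x hx
    rw [interior_Icc] at hx
    exact (hneg x hx.1 hx.2).le
  have hmono : MonotoneOn m (Ici t₀) := by
    apply monotoneOn_of_deriv_nonneg (convex_Ici _) hmc.continuousOn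
      (hm.differentiable (by simp)).differentiableOn
    intro x hx
    rw [interior_Ici] at hx
    exact hge x hx
  have hmin : ∀ t, 0 ≤ t → m t₀ ≤ m t := by
    intro t h0
    rcases le_total t t₀ with h | h
    · exact hanti ⟨h0, h⟩ ⟨ht.le, le_rfl⟩ h
    · exact hmono (self_mem_Ici) h h
  exact ⟨hm, hmpos, hmeven, hK0, hKdec, ht, hneg, hz, fun t => by
    rcases le_total 0 t with h | h
    · exact hmin t h
    · rw [← hmeven t]; exact hmin (-t) (by linarith)⟩

namespace Warp
variable {m : ℝ → ℝ} {t₀ : ℝ}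

lemma cont (W : Warp m t₀) : Continuous m := W.smooth.continuous

lemma strictAnti (W : Warp m t₀) : StrictAntiOn m (Icc 0 t₀) := by
  apply strictAntiOn_of_deriv_neg (convex_Icc _ _) W.cont.continuousOn
  intro x hx
  rw [interior_Icc] at hx
  exact W.dneg x hx.1 hx.2

lemma m_abs (W : Warp m t₀) (t : ℝ) : m |t| = m t := by
  rcases abs_choice t with h | h <;> rw [h]
  exact W.even t

lemma m_le_of_abs (W : Warp m t₀) {a b : ℝ} (hab : |a| ≤ |b|) (hb : |b| ≤ t₀) : m b ≤ m a := by
  rw [← W.m_abs a, ← W.m_abs b]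
  exact W.strictAnti.antitoneOn ⟨abs_nonneg _, hab.trans hb⟩ ⟨abs_nonneg _, hb⟩ hab

lemma xi_eq (W : Warp m t₀) {b : ℝ} (hb : 0 < b) (hbt : b < t₀) : xi m (m b) = b := by
  unfold xi
  apply le_antisymm
  · exact csInf_le (s := {t : ℝ | 0 < t ∧ m t = m b}) ⟨0, fun x hx => hx.1.le⟩ ⟨hb, rfl⟩
  · apply le_csInf (s := {t : ℝ | 0 < t ∧ m t = m b}) ⟨b, hb, rfl⟩
    rintro x ⟨hx, hxb⟩
    by_contra h
    push Not at h
    have := W.strictAnti (show x ∈ Icc 0 t₀ from ⟨hx.le, by linarith⟩)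
      (show b ∈ Icc 0 t₀ from ⟨hb.le, hbt.le⟩) h
    linarith

/-- `k = m'^2 / (m(0)^2 - m^2)`, extended continuously by `K(0)` at `0`. -/
def kk (m : ℝ → ℝ) (t : ℝ) : ℝ :=
  if t = 0 then gaussK m 0 else (deriv m t) ^ 2 / (m 0 ^ 2 - m t ^ 2)

lemma m_lt (W : Warp m t₀) {t : ℝ} (ht : t ≠ 0) (htt : |t| < t₀) : m t < m 0 := by
  rw [← W.m_abs t]
  exact W.strictAnti (show (0:ℝ) ∈ Icc 0 t₀ from ⟨le_rfl, W.t0pos.le⟩) ⟨abs_nonneg _, htt.le⟩ (abs_pos.2 ht)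

lemma m_sq_lt (W : Warp m t₀) {t : ℝ} (ht : t ≠ 0) (htt : |t| < t₀) : 0 < m 0 ^ 2 - m t ^ 2 := by
  have := W.m_lt ht htt
  have := W.pos t
  nlinarith

lemma d_ne (W : Warp m t₀) {t : ℝ} (ht : t ≠ 0) (htt : |t| < t₀) : deriv m t ≠ 0 := by
  rcases lt_or_gt_of_ne ht with h | h
  · have := W.dneg (-t) (by linarith) (by rwa [abs_of_neg h] at htt)
    rw [m_d1odd W.even] at this
    intro h0; rw [h0] at this; simp at this
  · exact (W.dneg t h (by rwa [abs_of_pos h] at htt)).ne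

lemma kk_even (W : Warp m t₀) (t : ℝ) : kk m (-t) = kk m t := by
  unfold kk
  simp [m_d1odd W.even, W.even]

lemma kk_pos (W : Warp m t₀) {t : ℝ} (htt : |t| < t₀) : 0 < kk m t := by
  unfold kk
  split_ifs with h
  · exact W.K0
  · exact div_pos (pow_pos (abs_pos.2 (W.d_ne h htt)) 2 |>.trans_eq (sq_abs _)) (W.m_sq_lt h htt)

lemma d2zero (W : Warp m t₀) : deriv (deriv m) 0 ≠ 0 := by
  intro h
  have := W.K0
  unfold gaussK at this
  rw [h] at this; simp at this

lemma kk_cont (W : Warp m t₀) : ContinuousOn (kk m) (Ioo (-t₀) t₀) := by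
  intro t ht
  apply ContinuousAt.continuousWithinAt
  have htt : |t| < t₀ := abs_lt.2 ht
  by_cases h : t = 0
  · subst h
    rw [continuousAt_iff_punctured_nhds]
    have e : kk m 0 = gaussK m 0 := by simp [kk]
    rw [e]
    have hdd : Filter.Tendsto (fun t => (2 * deriv m t * deriv (deriv m) t) /
        (-(2 * m t * deriv m t))) (nhdsWithin 0 {0}ᶜ) (nhds (gaussK m 0)) := by
      have h1 : Filter.Tendsto (fun t => -(deriv (deriv m) t) / m t) (nhdsWithin 0 {0}ᶜ)
          (nhds (gaussK m 0)) := by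
        have : ContinuousAt (fun t => -(deriv (deriv m) t) / m t) 0 :=
          ((m_d2c W.smooth).neg.continuousAt).div W.cont.continuousAt (W.pos 0).ne'
        exact this.tendsto.mono_left nhdsWithin_le_nhds
      apply h1.congr'
      have h3 : ∀ᶠ t in nhdsWithin (0:ℝ) {0}ᶜ, t ∈ Ioo (-t₀) t₀ :=
        mem_nhdsWithin_of_mem_nhds (Ioo_mem_nhds ht.1 ht.2)
      filter_upwards [self_mem_nhdsWithin, h3] with t h0 ht'
      have := W.d_ne h0 (abs_lt.2 ht')
      have := (W.pos t).ne'
      field_simp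
    have := HasDerivAt.lhopital_zero_nhdsNE (a := (0:ℝ)) (f := fun t => (deriv m t) ^ 2)
      (g := fun t => m 0 ^ 2 - m t ^ 2)
      (f' := fun t => 2 * deriv m t * deriv (deriv m) t) (g' := fun t => -(2 * m t * deriv m t))
      (l := nhds (gaussK m 0)) ?_ ?_ ?_ ?_ ?_ hdd
    · apply this.congr'
      filter_upwards [self_mem_nhdsWithin] with t h0
      have h0' : t ≠ 0 := h0
      simp [kk, h0']
    · filter_upwards with t
      exact sq_hasDeriv (m_d2 W.smooth t)
    · filter_upwards with t
      exact (sq_hasDeriv (m_d1 W.smooth t)).const_sub (m 0 ^ 2)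
    · have h3 : ∀ᶠ t in nhdsWithin (0:ℝ) {0}ᶜ, t ∈ Ioo (-t₀) t₀ :=
        mem_nhdsWithin_of_mem_nhds (Ioo_mem_nhds ht.1 ht.2)
      filter_upwards [self_mem_nhdsWithin, h3] with t h0 ht'
      have := W.d_ne h0 (abs_lt.2 ht')
      have := (W.pos t).ne'
      simp only [ne_eq, neg_eq_zero, mul_eq_zero, not_or]
      exact ⟨⟨two_ne_zero, by assumption⟩, by assumption⟩
    · have : ContinuousAt (fun t => (deriv m t) ^ 2) 0 := ((m_dC W.smooth).continuous.pow 2).continuousAt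
      have h := this.tendsto.mono_left (nhdsWithin_le_nhds (s := {0}ᶜ))
      simpa [m_d1zero W.even] using h
    · have : ContinuousAt (fun t => m 0 ^ 2 - m t ^ 2) 0 :=
        (continuous_const.sub (W.cont.pow 2)).continuousAt
      have h := this.tendsto.mono_left (nhdsWithin_le_nhds (s := {0}ᶜ))
      simpa using h
  · have h1 : ContinuousAt (fun t => (deriv m t) ^ 2 / (m 0 ^ 2 - m t ^ 2)) t :=
      ((m_dC W.smooth).continuous.pow 2).continuousAt.div
        (continuous_const.sub (W.cont.pow 2)).continuousAt (W.m_sq_lt h htt).ne'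
    apply h1.congr
    filter_upwards [isOpen_ne.mem_nhds h] with x hx
    have hx' : x ≠ 0 := hx
    simp [kk, hx']

lemma kk_anti (W : Warp m t₀) : AntitoneOn (kk m) (Ico 0 t₀) := by
  have hsub : Ico 0 t₀ ⊆ Ioo (-t₀) t₀ := fun x hx => ⟨by linarith [hx.1, W.t0pos], hx.2⟩
  have hder : ∀ t ∈ Ioo 0 t₀, HasDerivAt (kk m)
      ((2 * deriv m t * deriv (deriv m) t * (m 0 ^ 2 - m t ^ 2) -
        (deriv m t) ^ 2 * (-(2 * m t * deriv m t))) / (m 0 ^ 2 - m t ^ 2) ^ 2) t := by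
    intro t ht
    have htt : |t| < t₀ := by rw [abs_of_pos ht.1]; exact ht.2
    have h1 : HasDerivAt (fun t => (deriv m t) ^ 2) (2 * deriv m t * deriv (deriv m) t) t := by
      exact sq_hasDeriv (m_d2 W.smooth t)
    have h2 : HasDerivAt (fun t => m 0 ^ 2 - m t ^ 2) (-(2 * m t * deriv m t)) t := by
      exact (sq_hasDeriv (m_d1 W.smooth t)).const_sub (m 0 ^ 2)
    apply (h1.div h2 (W.m_sq_lt ht.1.ne' htt).ne').congr_of_eventuallyEq
    filter_upwards [isOpen_ne.mem_nhds ht.1.ne'] with x hx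
    have hx' : x ≠ 0 := hx
    simp [kk, hx']
  apply antitoneOn_of_deriv_nonpos (convex_Ico _ _) (W.kk_cont.mono hsub)
  · rw [interior_Ico]
    exact fun t ht => (hder t ht).differentiableAt.differentiableWithinAt
  · rw [interior_Ico]
    intro t ht
    rw [(hder t ht).deriv]
    apply div_nonpos_of_nonpos_of_nonneg _ (sq_nonneg _)
    -- m'^2 ≥ K(t) (M^2 - m^2)
    have hm2 : deriv (deriv m) t = - gaussK m t * m t := by
      unfold gaussK; field_simp [(W.pos t).ne']
    have key : gaussK m t * (m 0 ^ 2 - m t ^ 2) ≤ (deriv m t) ^ 2 := by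
      have hj : MonotoneOn (fun s => (deriv m s) ^ 2 - gaussK m t * (m 0 ^ 2 - m s ^ 2)) (Icc 0 t) := by
        have hjd : ∀ s, HasDerivAt (fun s => (deriv m s) ^ 2 - gaussK m t * (m 0 ^ 2 - m s ^ 2))
            (2 * deriv m s * deriv (deriv m) s - gaussK m t * (-(2 * m s * deriv m s))) s := by
          intro s
          have h1 : HasDerivAt (fun t => (deriv m t) ^ 2) (2 * deriv m s * deriv (deriv m) s) s := by
            exact sq_hasDeriv (m_d2 W.smooth s)
          have h2 : HasDerivAt (fun t => m 0 ^ 2 - m t ^ 2) (-(2 * m s * deriv m s)) s := by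
            exact (sq_hasDeriv (m_d1 W.smooth s)).const_sub (m 0 ^ 2)
          exact h1.sub (h2.const_mul _)
        apply monotoneOn_of_deriv_nonneg (convex_Icc _ _)
          (fun s _ => (hjd s).continuousAt.continuousWithinAt)
          (fun s _ => (hjd s).differentiableAt.differentiableWithinAt)
        rw [interior_Icc]
        intro s hs
        rw [(hjd s).deriv]
        have hKs := W.Kdec (show s ∈ Ici (0:ℝ) from hs.1.le) (show t ∈ Ici (0:ℝ) from ht.1.le) hs.2.le
        have hms : deriv (deriv m) s = - gaussK m s * m s := by
          unfold gaussK; field_simp [(W.pos s).ne']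
        rw [hms]
        have hd := W.dneg s hs.1 (hs.2.trans ht.2)
        have hp := W.pos s
        have : 0 ≤ (gaussK m s - gaussK m t) * (m s * (-deriv m s)) := by
          apply mul_nonneg (by linarith)
          apply mul_nonneg hp.le (by linarith)
        nlinarith
      have := hj ⟨le_rfl, ht.1.le⟩ ⟨ht.1.le, le_rfl⟩ ht.1.le
      simp only [m_d1zero W.even] at this
      nlinarith
    rw [hm2]
    have hd := W.dneg t ht.1 ht.2
    have hp := W.pos t
    have : 0 ≤ ((deriv m t) ^ 2 - gaussK m t * (m 0 ^ 2 - m t ^ 2)) * (m t * (-deriv m t)) := by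
      apply mul_nonneg (by linarith)
      apply mul_nonneg hp.le (by linarith)
    nlinarith

end Warp


/-- A coordinate `r` with `m (T r) = m 0 / √(1 + r²)` on `|r| ≤ r1`. -/
structure Chart (m : ℝ → ℝ) (b1 : ℝ) (D T : ℝ → ℝ) (r1 : ℝ) : Prop where
  r1pos : 0 < r1
  Dcont : Continuous D
  Dpos : ∀ r, 0 < D r
  Deven : ∀ r, D (-r) = D r
  Tder : ∀ r, HasDerivAt T (D r) r
  T0 : T 0 = 0
  Todd : ∀ r, T (-r) = - T r
  Tr1 : T r1 = b1
  mT : ∀ r, |r| ≤ r1 → m (T r) ^ 2 * (1 + r ^ 2) = m 0 ^ 2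
  mono : MonotoneOn (fun r => (1 + r ^ 2) * D r) (Icc 0 r1)

lemma exists_chart {m : ℝ → ℝ} {t₀ : ℝ} (W : Warp m t₀) {b1 : ℝ} (hb1 : 0 < b1) (hb1t : b1 < t₀) :
    ∃ D T r1, Chart m b1 D T r1 := by
  set G : ℝ → ℝ := fun x => m 0 ^ 2 / m x ^ 2 * √(Warp.kk m x) with hG
  have hGc : ContinuousOn G (Icc 0 b1) := by
    apply ContinuousOn.mul
    · exact continuousOn_const.div (W.cont.pow 2).continuousOn (fun x _ => (pow_pos (W.pos x) 2).ne')
    · apply ContinuousOn.sqrt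
      exact W.kk_cont.mono (fun x hx => ⟨by linarith [hx.1, W.t0pos], by linarith [hx.2]⟩)
  have hGpos : ∀ x ∈ Icc 0 b1, 0 < G x := by
    intro x hx
    apply mul_pos (div_pos (pow_pos (W.pos _) 2) (pow_pos (W.pos _) 2))
    apply Real.sqrt_pos.2
    apply W.kk_pos
    rw [abs_of_nonneg hx.1]; linarith [hx.2]
  obtain ⟨x0, hx0, hmin⟩ := isCompact_Icc.exists_isMinOn (nonempty_Icc.2 hb1.le) hGc
  set g : ℝ → ℝ := fun t => G (min |t| b1) with hg
  have hmem : ∀ t, min |t| b1 ∈ Icc 0 b1 := fun t => ⟨le_min (abs_nonneg _) hb1.le, min_le_right _ _⟩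
  have hgc : Continuous g := hGc.comp_continuous (by fun_prop) hmem
  have hgG : ∀ t ∈ Icc 0 b1, g t = G t := by
    intro t ht
    simp only [hg]
    rw [abs_of_nonneg ht.1, min_eq_left ht.2]
  have hgpos : ∀ t, 0 < g t := fun t => hGpos _ (hmem t)
  obtain ⟨T, hT1, hT2, hT3⟩ := exists_inv g hgc (G x0) (hGpos x0 hx0) (fun t => hmin (hmem t))
  have hgeven : ∀ t, g (-t) = g t := fun t => by simp [hg]
  have hSodd : ∀ x, ∫ y in (0:ℝ)..(-x), g y = - ∫ y in (0:ℝ)..x, g y := by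
    intro x
    have := intervalIntegral.integral_comp_neg (a := 0) (b := x) g
    simp only [hgeven, neg_zero] at this
    rw [this, intervalIntegral.integral_symm]
  have hTodd : ∀ r, T (-r) = - T r := by
    intro r
    have h := hSodd (T r)
    rw [hT2] at h
    rw [← h, hT1]
  have hTmono : StrictMono T := strictMono_of_deriv_pos fun r => by
    rw [(hT3 r).deriv]; exact inv_pos.2 (hgpos _)
  have hT0 : T 0 = 0 := by simpa using hT1 0
  have hTc : Continuous T := continuous_iff_continuousAt.2 fun r => (hT3 r).continuousAt
  set r1 := ∫ y in (0:ℝ)..b1, g y with hr1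
  have hTr1 : T r1 = b1 := hT1 b1
  have hr1pos : 0 < r1 := by
    rw [← hTmono.lt_iff_lt, hT0, hTr1]; exact hb1
  have hTmem : ∀ r ∈ Icc 0 r1, T r ∈ Icc 0 b1 := fun r hr =>
    ⟨by rw [← hT0]; exact hTmono.monotone hr.1, by rw [← hTr1]; exact hTmono.monotone hr.2⟩
  -- formula for the primitive
  have hS : ∀ t ∈ Icc 0 b1, ∫ y in (0:ℝ)..t, g y = √(m 0 ^ 2 - m t ^ 2) / m t := by
    intro t ht
    have h := intervalIntegral.integral_eq_sub_of_hasDerivAt_of_le (a := 0) (b := t)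
      (f := fun x => √(m 0 ^ 2 - m x ^ 2) / m x) (f' := g) ht.1 ?_ ?_ (hgc.intervalIntegrable _ _)
    · rw [h]; simp
    · apply ContinuousOn.div _ W.cont.continuousOn (fun x _ => (W.pos x).ne')
      exact ((continuous_const.sub (W.cont.pow 2)).sqrt).continuousOn
    · intro x hx
      have hx1 : x ∈ Icc 0 b1 := ⟨hx.1.le, hx.2.le.trans ht.2⟩
      have hxt : |x| < t₀ := by rw [abs_of_pos hx.1]; linarith [hx1.2]
      have hq := W.m_sq_lt hx.1.ne' hxt
      have hd := W.dneg x hx.1 (by linarith [hx1.2])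
      have hp := W.pos x
      have h2 := (sq_hasDeriv (m_d1 W.smooth x)).const_sub (m 0 ^ 2)
      have h3 := (h2.sqrt hq.ne').div (m_d1 W.smooth x) hp.ne'
      refine HasDerivAt.congr_deriv h3 ?_
      symm
      rw [hgG x hx1]
      simp only [hG]
      have hkk : √(Warp.kk m x) = - deriv m x / √(m 0 ^ 2 - m x ^ 2) := by
        unfold Warp.kk
        rw [if_neg hx.1.ne', Real.sqrt_div' _ hq.le, Real.sqrt_sq_eq_abs, abs_of_neg hd]
      rw [hkk]
      have hsq := Real.sq_sqrt hq.le
      have hs : 0 < √(m 0 ^ 2 - m x ^ 2) := Real.sqrt_pos.2 hq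
      set q := √(m 0 ^ 2 - m x ^ 2) with hqq
      have hM : m 0 ^ 2 = q ^ 2 + m x ^ 2 := by linarith
      rw [hM]
      field_simp
      ring
  have hmT : ∀ r ∈ Icc 0 r1, m (T r) ^ 2 * (1 + r ^ 2) = m 0 ^ 2 := by
    intro r hr
    have h := hS (T r) (hTmem r hr)
    rw [hT2] at h
    have hp := W.pos (T r)
    have hle : m (T r) ≤ m 0 := W.m_le_of_abs (by simp) (by
      rw [abs_of_nonneg (hTmem r hr).1]; linarith [(hTmem r hr).2])
    have h0 : 0 ≤ m 0 ^ 2 - m (T r) ^ 2 := by nlinarith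
    have h5 : r ^ 2 = (m 0 ^ 2 - m (T r) ^ 2) / m (T r) ^ 2 := by
      conv_lhs => rw [h]
      rw [div_pow, Real.sq_sqrt h0]
    rw [h5]
    field_simp
    ring
  refine ⟨fun r => (g (T r))⁻¹, T, r1, ?_⟩
  constructor
  · exact hr1pos
  · exact (hgc.comp hTc).inv₀ (fun r => (hgpos _).ne')
  · exact fun r => inv_pos.2 (hgpos _)
  · intro r; simp only [hTodd, hgeven]
  · exact hT3
  · exact hT0
  · exact hTodd
  · exact hTr1
  · intro r hr
    have h := hmT |r| ⟨abs_nonneg _, hr⟩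
    rw [sq_abs] at h
    rcases abs_choice r with h1 | h1 <;> rw [h1] at h
    · exact h
    · rwa [hTodd, W.even] at h
  · have hform : ∀ r ∈ Icc 0 r1, (1 + r ^ 2) * (g (T r))⁻¹ = (√(Warp.kk m (T r)))⁻¹ := by
      intro r hr
      have h := hmT r hr
      rw [hgG _ (hTmem r hr)]
      simp only [hG]
      have hp := W.pos (T r)
      have hp0 := W.pos 0
      have : 1 + r ^ 2 = m 0 ^ 2 / m (T r) ^ 2 := by field_simp; linarith
      rw [this, mul_inv, ← mul_assoc, mul_inv_cancel₀ (by positivity), one_mul]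
    intro x hx y hy hxy
    simp only
    rw [hform x hx, hform y hy]
    have hy' := hTmem y hy
    have hx' := hTmem x hx
    apply inv_anti₀
    · apply Real.sqrt_pos.2
      apply W.kk_pos
      rw [abs_of_nonneg hy'.1]; linarith [hy'.2]
    · apply Real.sqrt_le_sqrt
      exact W.kk_anti ⟨hx'.1, by linarith [hx'.2]⟩ ⟨hy'.1, by linarith [hy'.2]⟩ (hTmono.monotone hxy)


lemma sinsub {G : ℝ → ℝ} (hG : Continuous G) {τ : ℝ} (hτ : 0 < τ) :
    IntervalIntegrable (fun r => G r * (√(τ ^ 2 - r ^ 2))⁻¹) MeasureTheory.volume 0 τ ∧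
    ∫ r in (0:ℝ)..τ, G r * (√(τ ^ 2 - r ^ 2))⁻¹ = ∫ ψ in (0:ℝ)..(π / 2), G (τ * sin ψ) := by
  have hpi : (0:ℝ) < π / 2 := by positivity
  have hd : ∀ x, HasDerivAt (fun ψ => τ * sin ψ) (τ * cos x) x := fun x =>
    (Real.hasDerivAt_sin x).const_mul τ
  have hcos : ∀ x ∈ Ioo (min 0 (π / 2)) (max 0 (π / 2)), 0 < cos x := by
    intro x hx
    rw [min_eq_left hpi.le, max_eq_right hpi.le] at hx
    exact Real.cos_pos_of_mem_Ioo ⟨by linarith [hx.1], hx.2⟩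
  have hcont : ContinuousOn (fun ψ => τ * sin ψ) (uIcc 0 (π / 2)) := by fun_prop
  have hnn : ∀ x ∈ Ioo (min 0 (π / 2)) (max 0 (π / 2)), 0 ≤ τ * cos x := fun x hx =>
    mul_nonneg hτ.le (hcos x hx).le
  have heq : ∀ x ∈ Ioo (min 0 (π / 2)) (max 0 (π / 2)),
      ((fun r => G r * (√(τ ^ 2 - r ^ 2))⁻¹) ∘ (fun ψ => τ * sin ψ)) x * (τ * cos x)
        = G (τ * sin x) := by
    intro x hx
    have hc := hcos x hx
    have h1 : τ ^ 2 - (τ * sin x) ^ 2 = (τ * cos x) ^ 2 := by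
      have := Real.sin_sq_add_cos_sq x
      linear_combination (-τ ^ 2) * this
    simp only [Function.comp]
    rw [h1, Real.sqrt_sq (by positivity)]
    field_simp
  have haeq : ∀ᵐ x, x ∈ Set.uIoc (0:ℝ) (π / 2) →
      ((fun r => G r * (√(τ ^ 2 - r ^ 2))⁻¹) ∘ (fun ψ => τ * sin ψ)) x * (τ * cos x)
        = G (τ * sin x) := by
    have h0 : ∀ᵐ x : ℝ, x ≠ π / 2 := by simp [MeasureTheory.ae_iff, MeasureTheory.measure_singleton]
    filter_upwards [h0] with x hx hx2
    rw [uIoc_of_le hpi.le] at hx2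
    apply heq
    rw [min_eq_left hpi.le, max_eq_right hpi.le]
    exact ⟨hx2.1, lt_of_le_of_ne hx2.2 hx⟩
  have hGi : IntervalIntegrable (fun ψ => G (τ * sin ψ)) MeasureTheory.volume 0 (π / 2) :=
    (by fun_prop : Continuous fun ψ => G (τ * sin ψ)).intervalIntegrable _ _
  constructor
  · have := intervalIntegral.integrable_comp_mul_deriv_iff_of_deriv_nonneg
      (g := fun r => G r * (√(τ ^ 2 - r ^ 2))⁻¹) hcont (fun x _ => hd x) hnn
    simp only [Real.sin_zero, mul_zero, Real.sin_pi_div_two, mul_one] at this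
    rw [← this]
    refine (intervalIntegrable_congr_ae ?_).2 hGi
    exact (MeasureTheory.ae_restrict_iff' measurableSet_uIoc).2 haeq
  · have := intervalIntegral.integral_comp_mul_deriv_of_deriv_nonneg
      (g := fun r => G r * (√(τ ^ 2 - r ^ 2))⁻¹) hcont (fun x _ => hd x) hnn
    simp only [Real.sin_zero, mul_zero, Real.sin_pi_div_two, mul_one] at this
    rw [← this]
    exact intervalIntegral.integral_congr_ae haeq

/-- kernel of the `t`-part of the length -/
def pker (τ r : ℝ) : ℝ := √(τ ^ 2 - r ^ 2) / (√(1 + τ ^ 2) * (1 + r ^ 2))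

lemma pker_cont (τ : ℝ) : Continuous (pker τ) := by
  unfold pker
  apply Continuous.div (by fun_prop) (by fun_prop)
  intro r; positivity

lemma pker_nonneg (τ r : ℝ) : 0 ≤ pker τ r := by unfold pker; positivity

lemma pker_zero {τ r : ℝ} (h0 : 0 < τ) (h : τ ≤ r) : pker τ r = 0 := by
  unfold pker
  rw [Real.sqrt_eq_zero_of_nonpos (by nlinarith), zero_div]

lemma pker_sin {τ : ℝ} (h0 : 0 < τ) {κ : ℝ → ℝ} (hκ : Continuous κ) :
    ∫ r in (0:ℝ)..τ, pker τ r * κ r = ∫ ψ in (0:ℝ)..(π / 2),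
      τ ^ 2 * cos ψ ^ 2 / (√(1 + τ ^ 2) * (1 + (τ * sin ψ) ^ 2)) * κ (τ * sin ψ) := by
  have h := (sinsub (G := fun r => (τ ^ 2 - r ^ 2) / (√(1 + τ ^ 2) * (1 + r ^ 2)) * κ r) (by
    apply Continuous.mul _ hκ
    apply Continuous.div (by fun_prop) (by fun_prop)
    intro r; positivity) h0).2
  have h1 : ∫ r in (0:ℝ)..τ, pker τ r * κ r = ∫ r in (0:ℝ)..τ,
      (τ ^ 2 - r ^ 2) / (√(1 + τ ^ 2) * (1 + r ^ 2)) * κ r * (√(τ ^ 2 - r ^ 2))⁻¹ := by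
    apply intervalIntegral.integral_congr
    intro r hr
    rw [uIcc_of_le h0.le] at hr
    have h2 : 0 ≤ τ ^ 2 - r ^ 2 := by nlinarith [hr.1, hr.2]
    have h3 : √(τ ^ 2 - r ^ 2) = (τ ^ 2 - r ^ 2) * (√(τ ^ 2 - r ^ 2))⁻¹ := by
      rw [← div_eq_mul_inv, Real.div_sqrt]
    simp only [pker]
    conv_lhs => rw [h3]
    ring
  rw [h1, h]
  apply intervalIntegral.integral_congr
  intro ψ _
  simp only
  have h1 : τ ^ 2 - (τ * sin ψ) ^ 2 = τ ^ 2 * cos ψ ^ 2 := by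
    have := Real.sin_sq_add_cos_sq ψ
    linear_combination (-τ ^ 2) * this
  rw [h1]

lemma int_pker {τ : ℝ} (h0 : 0 < τ) :
    ∫ r in (0:ℝ)..τ, pker τ r = π / 2 * (1 - 1 / √(1 + τ ^ 2)) := by
  have h := pker_sin h0 (κ := fun _ => 1) continuous_const
  simp only [mul_one] at h
  rw [h]
  set s := √(1 + τ ^ 2) with hs
  have hs2 : s ^ 2 = 1 + τ ^ 2 := Real.sq_sqrt (by positivity)
  have hs0 : 0 < s := Real.sqrt_pos.2 (by positivity)
  have hden : ∀ ψ, 0 < cos ψ ^ 2 + s * sin ψ ^ 2 := by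
    intro ψ
    have h1 := Real.sin_sq_add_cos_sq ψ
    have hp : 0 ≤ cos ψ ^ 2 := sq_nonneg _
    have hq : 0 ≤ s * sin ψ ^ 2 := by positivity
    rcases hp.lt_or_eq with h2 | h2
    · linarith
    · have : sin ψ ^ 2 = 1 := by linarith
      rw [this]; linarith
  have hder : ∀ ψ, HasDerivAt (fun ψ => ((s - 1) * ψ + s * arctan ((s - 1) * (sin ψ * cos ψ) /
      (cos ψ ^ 2 + s * sin ψ ^ 2))) / s)
      (τ ^ 2 * cos ψ ^ 2 / (s * (1 + (τ * sin ψ) ^ 2))) ψ := by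
    intro ψ
    have hS := Real.hasDerivAt_sin ψ
    have hC := Real.hasDerivAt_cos ψ
    have hnum : HasDerivAt (fun ψ => (s - 1) * (sin ψ * cos ψ))
      ((s - 1) * (cos ψ * cos ψ + sin ψ * (-sin ψ))) ψ := (hS.mul hC).const_mul _
    have hdd : HasDerivAt (fun ψ => cos ψ ^ 2 + s * sin ψ ^ 2)
      (2 * cos ψ * (-sin ψ) + s * (2 * sin ψ * cos ψ)) ψ :=
      (sq_hasDeriv hC).add ((sq_hasDeriv hS).const_mul s)
    have h1 := (((hasDerivAt_id ψ).const_mul (s - 1)).add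
      (((hnum.div hdd (hden ψ).ne').arctan).const_mul s)).div_const s
    refine HasDerivAt.congr_deriv h1 ?_
    have h2 := Real.sin_sq_add_cos_sq ψ
    have hd := hden ψ
    simp only [Pi.div_apply]
    set S := sin ψ
    set C := cos ψ
    have e1 : (C ^ 2 + s * S ^ 2) ^ 2 + ((s - 1) * (S * C)) ^ 2 = C ^ 2 + s ^ 2 * S ^ 2 := by
      have hC2 : C ^ 2 = 1 - S ^ 2 := by linarith
      have : ((s - 1) * (S * C)) ^ 2 = (s - 1) ^ 2 * S ^ 2 * C ^ 2 := by ring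
      rw [this, hC2]; ring
    have e2 : 1 + (τ * S) ^ 2 = C ^ 2 + s ^ 2 * S ^ 2 := by
      rw [hs2]; linear_combination -h2
    have hpos : 0 < C ^ 2 + s ^ 2 * S ^ 2 := by rw [← e2]; positivity
    have e3 : 1 + ((s - 1) * (S * C) / (C ^ 2 + s * S ^ 2)) ^ 2 =
        (C ^ 2 + s ^ 2 * S ^ 2) / (C ^ 2 + s * S ^ 2) ^ 2 := by
      rw [← e1]; field_simp
    rw [e3, e2]
    have ht : τ ^ 2 = s ^ 2 - 1 := by linarith
    rw [ht]
    field_simp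
    have hC2 : C ^ 2 = 1 - S ^ 2 := by linarith
    have hC4 : C ^ 4 = (1 - S ^ 2) ^ 2 := by rw [← hC2]; ring
    ring_nf
    try rw [hC4]
    try rw [hC2]
    ring
  rw [intervalIntegral.integral_eq_sub_of_hasDerivAt (fun x _ => hder x)]
  · simp only [Real.sin_pi_div_two, Real.cos_pi_div_two, Real.sin_zero]
    simp
    field_simp
  · apply Continuous.intervalIntegrable
    apply Continuous.div (by fun_prop) (by fun_prop)
    intro r; positivity

set_option maxHeartbeats 1000000 in
/-- sign structure of the comparison kernel -/
lemma ker_sign {τ τ0 : ℝ} (h : 0 < τ) (h0 : 0 < τ0) :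
    ∃ c, 0 ≤ c ∧ c ≤ τ0 ∧ ∀ r, 0 ≤ r →
      (r < c → pker τ r - pker τ0 r -
        (1 / √(1 + τ0 ^ 2) - 1 / √(1 + τ ^ 2)) * (√(τ0 ^ 2 - r ^ 2))⁻¹ ≤ 0) ∧
      (c ≤ r → 0 ≤ pker τ r - pker τ0 r -
        (1 / √(1 + τ0 ^ 2) - 1 / √(1 + τ ^ 2)) * (√(τ0 ^ 2 - r ^ 2))⁻¹) := by
  set s := √(1 + τ ^ 2) with hs
  set s0 := √(1 + τ0 ^ 2) with hs0
  have hs2 : s ^ 2 = 1 + τ ^ 2 := Real.sq_sqrt (by positivity)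
  have hs02 : s0 ^ 2 = 1 + τ0 ^ 2 := Real.sq_sqrt (by positivity)
  have hsp : 1 < s := by rw [hs]; exact Real.lt_sqrt_of_sq_lt (by nlinarith)
  have hs0p : 1 < s0 := by rw [hs0]; exact Real.lt_sqrt_of_sq_lt (by nlinarith)
  have hmin : 1 < s0 * min s s0 := by
    have : 1 < min s s0 := lt_min hsp hs0p
    nlinarith
  set c := √(s0 * min s s0 - 1) with hc
  have hc2 : c ^ 2 = s0 * min s s0 - 1 := Real.sq_sqrt (by linarith)
  have hc0 : 0 ≤ c := Real.sqrt_nonneg _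
  have hcτ : c ≤ τ0 := by
    rw [hc]
    apply Real.sqrt_le_iff.2
    refine ⟨h0.le, ?_⟩
    have : min s s0 ≤ s0 := min_le_right _ _
    nlinarith
  refine ⟨c, hc0, hcτ, ?_⟩
  intro r hr
  rcases lt_or_ge r τ0 with hlt | hge
  · -- common formula
    set x := 1 + r ^ 2 with hx
    have hxp : 0 < x := by positivity
    have hQ : 0 < τ0 ^ 2 - r ^ 2 := by nlinarith
    set Q := √(τ0 ^ 2 - r ^ 2) with hQd
    have hQp : 0 < Q := Real.sqrt_pos.2 hQ
    have hQ2 : Q ^ 2 = s0 ^ 2 - x := by rw [hQd, Real.sq_sqrt hQ.le, hs02]; ring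
    set P := √(τ ^ 2 - r ^ 2) with hPd
    have hform : pker τ r - pker τ0 r - (1 / s0 - 1 / s) * Q⁻¹ = (P * Q - (s * s0 - x)) / (s * x * Q) := by
      simp only [pker]
      rw [← hs, ← hs0, ← hQd, ← hPd, ← hx]
      have hsne : s ≠ 0 := by linarith
      have hs0ne : s0 ≠ 0 := by linarith
      field_simp
      linear_combination (-s) * hQ2
    rw [hform]
    have hden : 0 < s * x * Q := by positivity
    constructor
    · intro hrc
      apply div_nonpos_of_nonpos_of_nonneg _ hden.le
      have hxc : x ≤ s0 * min s s0 := by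
        have : r ^ 2 ≤ c ^ 2 := by nlinarith
        linarith
      have hxs : x ≤ s * s0 := by
        have : min s s0 ≤ s := min_le_left _ _
        nlinarith
      rcases lt_or_ge x (s ^ 2) with h1 | h1
      · have hP2 : P ^ 2 = s ^ 2 - x := by
          rw [hPd, Real.sq_sqrt (by nlinarith), hs2]; ring
        have hPn : 0 ≤ P := Real.sqrt_nonneg _
        have : P * Q ≤ s * s0 - x := by
          apply abs_le_of_sq_le_sq' _ (by linarith) |>.2
          rw [mul_pow, hP2, hQ2]
          nlinarith [mul_nonneg hxp.le (sq_nonneg (s - s0))]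
        linarith
      · have hP0 : P = 0 := Real.sqrt_eq_zero_of_nonpos (by nlinarith)
        rw [hP0]; linarith
    · intro hcr
      apply div_nonneg _ hden.le
      have hxc : s0 * min s s0 ≤ x := by
        have : c ^ 2 ≤ r ^ 2 := by nlinarith
        linarith
      have hxs0 : x < s0 ^ 2 := by rw [hs02]; nlinarith
      have hss : s < s0 := by
        by_contra hcon
        push Not at hcon
        rw [min_eq_right hcon] at hxc
        nlinarith
      rw [min_eq_left hss.le] at hxc
      have hP0 : P = 0 := Real.sqrt_eq_zero_of_nonpos (by nlinarith)
      rw [hP0]; nlinarith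
  · have hQ0 : √(τ0 ^ 2 - r ^ 2) = 0 := Real.sqrt_eq_zero_of_nonpos (by nlinarith)
    rw [hQ0, pker_zero h0 hge, inv_zero, mul_zero, sub_zero, sub_zero]
    exact ⟨fun hrc => absurd (hrc.trans_le hcτ) (not_lt.2 hge), fun _ => pker_nonneg _ _⟩

lemma kern {κ : ℝ → ℝ} (hκ : Continuous κ) {r1 τ τ0 : ℝ} (hmono : MonotoneOn κ (Icc 0 r1))
    (h : 0 < τ) (h0 : 0 < τ0) (hr : τ ≤ r1) (h0r : τ0 ≤ r1) :
    (1 / √(1 + τ0 ^ 2) - 1 / √(1 + τ ^ 2)) * ∫ ψ in (0:ℝ)..(π / 2), κ (τ0 * sin ψ) ≤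
    (∫ r in (0:ℝ)..τ, pker τ r * κ r) - ∫ r in (0:ℝ)..τ0, pker τ0 r * κ r := by
  have hr1 : 0 ≤ r1 := h.le.trans hr
  -- extension of integrals to `[0,r1]`
  have ext : ∀ (f : ℝ → ℝ) (a : ℝ), 0 ≤ a → a ≤ r1 → (∀ r, a < r → f r = 0) →
      IntervalIntegrable f MeasureTheory.volume 0 a →
      IntervalIntegrable f MeasureTheory.volume 0 r1 ∧
      ∫ r in (0:ℝ)..r1, f r = ∫ r in (0:ℝ)..a, f r := by
    intro f a ha har hf hi
    have h2 : IntervalIntegrable f MeasureTheory.volume a r1 := by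
      refine (intervalIntegrable_congr (g := fun _ => (0:ℝ)) ?_).2 intervalIntegrable_const
      intro r hr
      rw [uIoc_of_le har] at hr
      exact hf r hr.1
    refine ⟨hi.trans h2, ?_⟩
    rw [← intervalIntegral.integral_add_adjacent_intervals hi h2]
    rw [intervalIntegral.integral_of_le har]
    rw [MeasureTheory.setIntegral_congr_fun (g := fun _ => (0:ℝ)) measurableSet_Ioc
      (fun r hr => hf r hr.1)]
    simp
  have zq : ∀ r, τ0 < r → (√(τ0 ^ 2 - r ^ 2))⁻¹ = 0 := by
    intro r hr
    rw [Real.sqrt_eq_zero_of_nonpos (by nlinarith), inv_zero]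
  have hsub := sinsub hκ h0
  have hsub1 := sinsub (G := fun _ => 1) continuous_const h0
  simp only [one_mul] at hsub1
  obtain ⟨i1, e1⟩ := ext (fun r => pker τ r * κ r) τ h.le hr
    (fun r hr => by simp [pker_zero h hr.le]) (((pker_cont τ).mul hκ).intervalIntegrable _ _)
  obtain ⟨i2, e2⟩ := ext (fun r => pker τ0 r * κ r) τ0 h0.le h0r
    (fun r hr => by simp [pker_zero h0 hr.le]) (((pker_cont τ0).mul hκ).intervalIntegrable _ _)
  obtain ⟨i3, e3⟩ := ext (fun r => κ r * (√(τ0 ^ 2 - r ^ 2))⁻¹) τ0 h0.le h0r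
    (fun r hr => by simp [zq r hr]) hsub.1
  obtain ⟨j1, f1⟩ := ext (fun r => pker τ r) τ h.le hr
    (fun r hr => by simp [pker_zero h hr.le]) ((pker_cont τ).intervalIntegrable _ _)
  obtain ⟨j2, f2⟩ := ext (fun r => pker τ0 r) τ0 h0.le h0r
    (fun r hr => by simp [pker_zero h0 hr.le]) ((pker_cont τ0).intervalIntegrable _ _)
  obtain ⟨j3, f3⟩ := ext (fun r => (√(τ0 ^ 2 - r ^ 2))⁻¹) τ0 h0.le h0r
    (fun r hr => by simp [zq r hr]) hsub1.1
  rw [hsub.2] at e3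
  rw [hsub1.2] at f3
  rw [int_pker h] at f1
  rw [int_pker h0] at f2
  rw [← e1, ← e2, ← e3]
  obtain ⟨c, hc0, hcτ, hsign⟩ := ker_sign h h0
  set lam := 1 / √(1 + τ0 ^ 2) - 1 / √(1 + τ ^ 2) with hlam
  have hN : IntervalIntegrable (fun r => pker τ r - pker τ0 r - lam * (√(τ0 ^ 2 - r ^ 2))⁻¹)
    MeasureTheory.volume 0 r1 := (j1.sub j2).sub (j3.const_mul lam)
  have hN' : IntervalIntegrable (fun r => pker τ r * κ r - pker τ0 r * κ r -
      lam * (κ r * (√(τ0 ^ 2 - r ^ 2))⁻¹))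
    MeasureTheory.volume 0 r1 := (i1.sub i2).sub (i3.const_mul lam)
  have hNint : ∫ r in (0:ℝ)..r1, (pker τ r - pker τ0 r - lam * (√(τ0 ^ 2 - r ^ 2))⁻¹) = 0 := by
    rw [intervalIntegral.integral_sub (j1.sub j2) (j3.const_mul lam),
      intervalIntegral.integral_sub j1 j2, intervalIntegral.integral_const_mul, f1, f2, f3, hlam]
    simp
    ring
  have hmain : ∫ r in (0:ℝ)..r1, κ c * (pker τ r - pker τ0 r - lam * (√(τ0 ^ 2 - r ^ 2))⁻¹) ≤
      ∫ r in (0:ℝ)..r1, (pker τ r * κ r - pker τ0 r * κ r -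
      lam * (κ r * (√(τ0 ^ 2 - r ^ 2))⁻¹)) := by
    apply intervalIntegral.integral_mono_on hr1 (hN.const_mul _) hN'
    intro r hrr
    have hcm : c ∈ Icc 0 r1 := ⟨hc0, hcτ.trans h0r⟩
    have : pker τ r * κ r - pker τ0 r * κ r - lam * (κ r * (√(τ0 ^ 2 - r ^ 2))⁻¹) =
      κ r * (pker τ r - pker τ0 r - lam * (√(τ0 ^ 2 - r ^ 2))⁻¹) := by ring
    rw [this]
    obtain ⟨s1, s2⟩ := hsign r hrr.1
    rcases lt_or_ge r c with hh | hh
    · exact mul_le_mul_of_nonpos_right (hmono hrr hcm hh.le) (s1 hh)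
    · exact mul_le_mul_of_nonneg_right (hmono hcm hrr hh) (s2 hh)
  rw [intervalIntegral.integral_const_mul, hNint, mul_zero,
    intervalIntegral.integral_sub (i1.sub i2) (i3.const_mul lam),
    intervalIntegral.integral_sub i1 i2, intervalIntegral.integral_const_mul] at hmain
  linarith


/-- primitive of the radial part of the calibration -/
def Wn (m : ℝ → ℝ) (ν b : ℝ) : ℝ := ∫ t in (0:ℝ)..b, √(m t ^ 2 - ν ^ 2) / m t

/-- `κ(r)` -/
def kap (D : ℝ → ℝ) (r : ℝ) : ℝ := (1 + r ^ 2) * D r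

namespace Chart
variable {m : ℝ → ℝ} {t₀ b1 : ℝ} {D T : ℝ → ℝ} {r1 : ℝ}

lemma kap_cont (C : Chart m b1 D T r1) : Continuous (kap D) := by
  have := C.Dcont
  unfold kap; fun_prop

lemma Tmono (C : Chart m b1 D T r1) : StrictMono T := strictMono_of_deriv_pos fun r => by
  rw [(C.Tder r).deriv]; exact C.Dpos r

lemma Tcont (C : Chart m b1 D T r1) : Continuous T :=
  continuous_iff_continuousAt.2 fun r => (C.Tder r).continuousAt

lemma exists_tau (C : Chart m b1 D T r1) {b : ℝ} (hb : 0 < b) (hb1 : b ≤ b1) :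
    ∃ τ, 0 < τ ∧ τ ≤ r1 ∧ T τ = b := by
  have := intermediate_value_Icc C.r1pos.le C.Tcont.continuousOn
  rw [C.T0, C.Tr1] at this
  obtain ⟨τ, hτ, h⟩ := this ⟨hb.le, hb1⟩
  refine ⟨τ, ?_, hτ.2, h⟩
  rw [← C.Tmono.lt_iff_lt, C.T0, h]; exact hb

lemma mTe (C : Chart m b1 D T r1) (W : Warp m t₀) {r : ℝ} (hr : |r| ≤ r1) :
    m (T r) = m 0 / √(1 + r ^ 2) := by
  have h := C.mT r hr
  have hp := W.pos (T r)
  have hs : 0 < √(1 + r ^ 2) := Real.sqrt_pos.2 (by positivity)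
  rw [eq_div_iff hs.ne']
  have h2 : (m (T r) * √(1 + r ^ 2)) ^ 2 = m 0 ^ 2 := by
    rw [mul_pow, Real.sq_sqrt (by positivity), h]
  exact (pow_left_inj₀ (by positivity) (W.pos 0).le two_ne_zero).1 h2

/-- the square root in chart coordinates -/
lemma sqrt_eq (C : Chart m b1 D T r1) (W : Warp m t₀) {r τ : ℝ} (hr : 0 ≤ r) (hrτ : r ≤ τ) (hτ : τ ≤ r1) :
    √(m (T r) ^ 2 - m (T τ) ^ 2) = m (T r) * √(τ ^ 2 - r ^ 2) / √(1 + τ ^ 2) := by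
  have h1 := C.mT r (by rw [abs_of_nonneg hr]; linarith)
  have h2 := C.mT τ (by rw [abs_of_nonneg (hr.trans hrτ)]; linarith)
  have hp := W.pos (T r)
  have h3 : 0 ≤ τ ^ 2 - r ^ 2 := by nlinarith
  have e : m (T r) ^ 2 - m (T τ) ^ 2 = (m (T r) * √(τ ^ 2 - r ^ 2) / √(1 + τ ^ 2)) ^ 2 := by
    rw [div_pow, mul_pow, Real.sq_sqrt h3, Real.sq_sqrt (by positivity)]
    rw [eq_div_iff (by positivity)]
    linear_combination h1 - h2
  rw [e, Real.sqrt_sq (by positivity)]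

lemma phi_int (C : Chart m b1 D T r1) (W : Warp m t₀) {τ : ℝ} (h0 : 0 < τ) (hτ : τ ≤ r1) :
    IntervalIntegrable (fun t => m (T τ) / (m t * √(m t ^ 2 - m (T τ) ^ 2)))
      MeasureTheory.volume 0 (T τ) ∧
    ∫ t in (0:ℝ)..(T τ), m (T τ) / (m t * √(m t ^ 2 - m (T τ) ^ 2)) =
      1 / m 0 * ∫ ψ in (0:ℝ)..(π / 2), kap D (τ * sin ψ) := by
  have hsub := sinsub C.kap_cont h0
  have hpt : ∀ r ∈ Icc 0 τ, ((fun t => m (T τ) / (m t * √(m t ^ 2 - m (T τ) ^ 2))) ∘ T) r * D r =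
      1 / m 0 * (kap D r * (√(τ ^ 2 - r ^ 2))⁻¹) := by
    intro r hr
    have hM := W.pos 0
    have hs : 0 < √(1 + τ ^ 2) := Real.sqrt_pos.2 (by positivity)
    have hxr := C.mT r (by rw [abs_of_nonneg hr.1]; linarith [hr.2])
    have hp := W.pos (T r)
    simp only [Function.comp]
    rw [C.sqrt_eq W hr.1 hr.2 hτ, C.mTe W (r := τ) (by rw [abs_of_pos h0]; exact hτ)]
    unfold kap
    by_cases hQ : √(τ ^ 2 - r ^ 2) = 0
    · rw [hQ]; simp
    · field_simp
      linear_combination (-D r) * hxr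
  have hc : ContinuousOn T (uIcc 0 τ) := C.Tcont.continuousOn
  have hi := intervalIntegral.integrable_comp_mul_deriv_iff_of_deriv_nonneg
      (g := fun t => m (T τ) / (m t * √(m t ^ 2 - m (T τ) ^ 2))) hc (fun x _ => C.Tder x)
      (fun x _ => (C.Dpos x).le)
  have he := intervalIntegral.integral_comp_mul_deriv_of_deriv_nonneg
      (g := fun t => m (T τ) / (m t * √(m t ^ 2 - m (T τ) ^ 2))) hc (fun x _ => C.Tder x)
      (fun x _ => (C.Dpos x).le)
  rw [C.T0] at hi he
  constructor
  · rw [← hi]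
    refine (intervalIntegrable_congr ?_).2 (hsub.1.const_mul (1 / m 0))
    intro r hr
    rw [uIoc_of_le h0.le] at hr
    exact hpt r ⟨hr.1.le, hr.2⟩
  · rw [← he, ← hsub.2, ← intervalIntegral.integral_const_mul]
    apply intervalIntegral.integral_congr
    intro r hr
    rw [uIcc_of_le h0.le] at hr
    exact hpt r hr

lemma Tlt (C : Chart m b1 D T r1) {τ : ℝ} (hτ : τ ≤ r1) : T τ ≤ b1 := by
  rw [← C.Tr1]; exact C.Tmono.monotone hτ

lemma Tpos (C : Chart m b1 D T r1) {τ : ℝ} (hτ : 0 < τ) : 0 < T τ := by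
  rw [← C.T0]; exact C.Tmono hτ

lemma phi_eq (C : Chart m b1 D T r1) (W : Warp m t₀) (hb1 : b1 < t₀) {τ : ℝ} (h0 : 0 < τ) (hτ : τ ≤ r1) :
    phi m (m (T τ)) = 2 / m 0 * ∫ ψ in (0:ℝ)..(π / 2), kap D (τ * sin ψ) := by
  unfold phi
  rw [W.xi_eq (C.Tpos h0) ((C.Tlt hτ).trans_lt hb1), (C.phi_int W h0 hτ).2]
  ring

lemma Wn_eq (C : Chart m b1 D T r1) (W : Warp m t₀) {τ : ℝ} (h0 : 0 < τ) (hτ : τ ≤ r1) :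
    Wn m (m (T τ)) (T τ) = ∫ r in (0:ℝ)..τ, pker τ r * kap D r := by
  have hc : ContinuousOn T (uIcc 0 τ) := C.Tcont.continuousOn
  have he := intervalIntegral.integral_comp_mul_deriv_of_deriv_nonneg
      (g := fun t => √(m t ^ 2 - m (T τ) ^ 2) / m t) hc (fun x _ => C.Tder x)
      (fun x _ => (C.Dpos x).le)
  rw [C.T0] at he
  unfold Wn
  rw [← he]
  apply intervalIntegral.integral_congr
  intro r hr
  rw [uIcc_of_le h0.le] at hr
  have hp := W.pos (T r)
  have hs : 0 < √(1 + τ ^ 2) := Real.sqrt_pos.2 (by positivity)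
  simp only [Function.comp]
  rw [C.sqrt_eq W hr.1 hr.2 hτ]
  unfold pker kap
  field_simp

end Chart

namespace Warp
variable {m : ℝ → ℝ} {t₀ : ℝ}

lemma f_ineq (W : Warp m t₀) {b β : ℝ} (hb : 0 < b) (hbt : b < t₀) (hβ : 0 < β) (hβt : β < t₀) :
    m b * phi m (m b) + 2 * Wn m (m b) b ≤ m β * phi m (m b) + 2 * Wn m (m β) β := by
  have h1 : 0 < max b β := lt_max_of_lt_left hb
  have h2 : max b β < t₀ := max_lt hbt hβt
  obtain ⟨D, T, r1, C⟩ := exists_chart W h1 h2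
  obtain ⟨τ0, h01, h02, rfl⟩ := C.exists_tau hb (le_max_left _ _)
  obtain ⟨τ, h11, h12, rfl⟩ := C.exists_tau hβ (le_max_right _ _)
  have hk := kern C.kap_cont C.mono h11 h01 h12 h02
  rw [C.Wn_eq W h01 h02, C.Wn_eq W h11 h12, C.phi_eq W h2 h01 h02]
  rw [C.mTe W (r := τ) (by rw [abs_of_pos h11]; exact h12), C.mTe W (r := τ0) (by rw [abs_of_pos h01]; exact h02)]
  have hM := W.pos 0
  set I := ∫ ψ in (0:ℝ)..(π / 2), kap D (τ0 * sin ψ)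
  have e1 : m 0 / √(1 + τ0 ^ 2) * (2 / m 0 * I) = 2 * (1 / √(1 + τ0 ^ 2) * I) := by field_simp
  have e2 : m 0 / √(1 + τ ^ 2) * (2 / m 0 * I) = 2 * (1 / √(1 + τ ^ 2) * I) := by field_simp
  rw [e1, e2]
  linarith

lemma phi_mono_chart (W : Warp m t₀) {b1 : ℝ} {D T : ℝ → ℝ} {r1 : ℝ} (C : Chart m b1 D T r1)
    (hb1 : b1 < t₀) {τ τ' : ℝ} (h0 : 0 < τ) (h : τ ≤ τ') (hr : τ' ≤ r1) :
    phi m (m (T τ)) ≤ phi m (m (T τ')) := by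
  rw [C.phi_eq W hb1 h0 (h.trans hr), C.phi_eq W hb1 (h0.trans_le h) hr]
  have hM := W.pos 0
  apply mul_le_mul_of_nonneg_left _ (by positivity)
  have hc := C.kap_cont
  apply intervalIntegral.integral_mono_on (by positivity)
    (by apply Continuous.intervalIntegrable; fun_prop) (by apply Continuous.intervalIntegrable; fun_prop)
  intro ψ hψ
  have hs : 0 ≤ sin ψ := Real.sin_nonneg_of_mem_Icc ⟨hψ.1, by linarith [hψ.2, Real.pi_pos]⟩
  have hs1 := Real.sin_le_one ψ
  have h1 : τ * sin ψ ≤ τ' * sin ψ := mul_le_mul_of_nonneg_right h hs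
  have h2 : τ' * sin ψ ≤ r1 := by nlinarith
  exact C.mono ⟨by positivity, h1.trans h2⟩ ⟨by nlinarith, h2⟩ h1

lemma phi_mono (W : Warp m t₀) {u b : ℝ} (hu : 0 < u) (hub : u ≤ b) (hbt : b < t₀) :
    phi m (m u) ≤ phi m (m b) := by
  obtain ⟨D, T, r1, C⟩ := exists_chart W (hu.trans_le hub) hbt
  obtain ⟨τ, h1, h2, rfl⟩ := C.exists_tau hu hub
  have := W.phi_mono_chart C hbt h1 h2 le_rfl
  rwa [C.Tr1] at this

lemma quad_bound (W : Warp m t₀) : ∃ A, 0 < A ∧ ∀ t ∈ Icc 0 t₀, m t - m t₀ ≤ A * (t₀ - t) ^ 2 := by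
  obtain ⟨A, hA⟩ := isCompact_Icc.exists_bound_of_continuousOn (s := Icc 0 t₀) (m_d2c W.smooth).continuousOn
  refine ⟨|A| + 1, by positivity, ?_⟩
  have hd : ∀ t ∈ Icc 0 t₀, |deriv m t| ≤ (|A| + 1) * (t₀ - t) := by
    intro t ht
    have h := Convex.norm_image_sub_le_of_norm_hasDerivWithin_le (f := deriv m) (f' := deriv (deriv m))
      (C := |A| + 1) (s := Icc 0 t₀)
      (fun x _ => (m_d2 W.smooth x).hasDerivWithinAt)
      (fun x hx => (hA x hx).trans (by linarith [le_abs_self A])) (convex_Icc _ _) 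
      (⟨W.t0pos.le, le_rfl⟩ : t₀ ∈ Icc 0 t₀) ht
    rw [W.d0, sub_zero, Real.norm_eq_abs, Real.norm_eq_abs, abs_sub_comm, abs_of_nonneg (by linarith [ht.2] : 0 ≤ t₀ - t)] at h
    exact h
  intro t ht
  have h := Convex.norm_image_sub_le_of_norm_hasDerivWithin_le (f := m) (f' := deriv m)
      (C := (|A| + 1) * (t₀ - t)) (s := Icc t t₀)
      (fun x _ => (m_d1 W.smooth x).hasDerivWithinAt)
      (fun x hx => (hd x ⟨ht.1.trans hx.1, hx.2⟩).trans (by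
        have : 0 < |A| + 1 := by positivity
        have := hx.1
        gcongr)) (convex_Icc _ _) 
      (⟨ht.2, le_rfl⟩ : t₀ ∈ Icc t t₀) (⟨le_rfl, ht.2⟩ : t ∈ Icc t t₀)
  rw [Real.norm_eq_abs, Real.norm_eq_abs, abs_sub_comm t, abs_of_nonneg (by linarith [ht.2] : 0 ≤ t₀ - t)] at h
  have := le_abs_self (m t - m t₀)
  nlinarith

lemma phi_large (W : Warp m t₀) (u θ : ℝ) (hut : u < t₀) (hu : 0 < u) :
    ∃ b, u ≤ b ∧ b < t₀ ∧ θ ≤ phi m (m b) := by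
  obtain ⟨A, hA, hq⟩ := W.quad_bound
  have hM := W.pos 0
  have hn := W.pos t₀
  set k := m t₀ / (m 0 * √(2 * m 0 * A)) with hk
  have hkp : 0 < k := by positivity
  -- lower bound
  have key : ∀ b, 0 < b → b < t₀ → 2 * (k * (log t₀ - log (t₀ - b))) ≤ phi m (m b) := by
    intro b hb hbt
    obtain ⟨D, T, r1, C⟩ := exists_chart W hb hbt
    have hi := (C.phi_int W C.r1pos le_rfl).1
    rw [C.Tr1] at hi
    unfold phi
    rw [W.xi_eq hb hbt]
    apply mul_le_mul_of_nonneg_left _ (by norm_num)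
    have hder : ∀ t ∈ uIcc 0 b, HasDerivAt (fun t => - (k * log (t₀ - t))) (k / (t₀ - t)) t := by
      intro t ht
      rw [uIcc_of_le hb.le] at ht
      have h0 : t₀ - t ≠ 0 := by linarith [ht.2]
      have := ((((hasDerivAt_id t).const_sub t₀).log h0).const_mul k).neg
      refine HasDerivAt.congr_deriv this ?_
      simp; field_simp
    have hci : IntervalIntegrable (fun t => k / (t₀ - t)) MeasureTheory.volume 0 b := by
      apply ContinuousOn.intervalIntegrable
      apply ContinuousOn.div (by fun_prop) (by fun_prop)
      intro t ht
      rw [uIcc_of_le hb.le] at ht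
      linarith [ht.2]
    have e := intervalIntegral.integral_eq_sub_of_hasDerivAt hder hci
    have : k * (log t₀ - log (t₀ - b)) = ∫ t in (0:ℝ)..b, k / (t₀ - t) := by
      rw [e, sub_zero]; ring
    rw [this]
    apply intervalIntegral.integral_mono_on_of_le_Ioo hb.le hci hi
    intro t ht
    have htt : t < t₀ := ht.2.trans hbt
    have h1 : m t - m t₀ ≤ A * (t₀ - t) ^ 2 := hq t ⟨ht.1.le, htt.le⟩
    have h2 : m t ≤ m 0 := W.m_le_of_abs (by simp) (by rw [abs_of_pos ht.1]; exact htt.le)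
    have h3 := W.isMin b
    have h4 : m b < m t := W.strictAnti (show t ∈ Icc 0 t₀ from ⟨ht.1.le, htt.le⟩)
      (show b ∈ Icc 0 t₀ from ⟨hb.le, hbt.le⟩) ht.2
    have hpb := W.pos b
    have h5 : m t ^ 2 - m b ^ 2 ≤ 2 * m 0 * A * (t₀ - t) ^ 2 := by
      have : m t ^ 2 - m b ^ 2 = (m t - m b) * (m t + m b) := by ring
      rw [this]
      have a1 : m t - m b ≤ A * (t₀ - t) ^ 2 := by linarith
      have a2 : m t + m b ≤ 2 * m 0 := by linarith
      have := mul_le_mul a1 a2 (by linarith) (by positivity)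
      linarith
    have h6 : √(m t ^ 2 - m b ^ 2) ≤ √(2 * m 0 * A) * (t₀ - t) := by
      have := Real.sqrt_le_sqrt h5
      rwa [Real.sqrt_mul (by positivity), Real.sqrt_sq (by linarith)] at this
    have h7 : 0 < √(m t ^ 2 - m b ^ 2) := Real.sqrt_pos.2 (by nlinarith)
    have hpt := W.pos t
    rw [hk, div_div]
    apply div_le_div₀ hpb.le h3 (by positivity)
    calc m t * √(m t ^ 2 - m b ^ 2) ≤ m 0 * (√(2 * m 0 * A) * (t₀ - t)) :=
          mul_le_mul h2 h6 h7.le hM.le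
      _ = _ := by ring
  -- choose b
  set e := min (t₀ - u) (exp (log t₀ - |θ| / (2 * k))) with he
  have hep : 0 < e := lt_min (by linarith) (exp_pos _)
  have he1 : e ≤ t₀ - u := min_le_left _ _
  refine ⟨t₀ - e, by linarith, by linarith, ?_⟩
  have := key (t₀ - e) (by linarith) (by linarith)
  refine le_trans ?_ this
  rw [sub_sub_cancel]
  have hle : log e ≤ log t₀ - |θ| / (2 * k) := by
    rw [← Real.log_exp (log t₀ - |θ| / (2 * k))]
    exact Real.log_le_log hep (min_le_right _ _)
  have h1 : |θ| / (2 * k) ≤ log t₀ - log e := by linarith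
  rw [div_le_iff₀ (by positivity)] at h1
  linarith [le_abs_self θ]

lemma phi_surj (W : Warp m t₀) {u θ : ℝ} (hu : 0 < u) (hut : u < t₀) (hθ : phi m (m u) ≤ θ) :
    ∃ b, u ≤ b ∧ b < t₀ ∧ phi m (m b) = θ := by
  obtain ⟨b1, hub, hb1, hθ1⟩ := W.phi_large u θ hut hu
  obtain ⟨D, T, r1, C⟩ := exists_chart W (hu.trans_le hub) hb1
  obtain ⟨τ, h1, h2, rfl⟩ := C.exists_tau hu hub
  have hc := C.kap_cont
  have hcont : Continuous (fun x => 2 / m 0 * ∫ ψ in (0:ℝ)..(π / 2), kap D (x * sin ψ)) := by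
    apply Continuous.mul continuous_const
    apply intervalIntegral.continuous_parametric_intervalIntegral_of_continuous'
    fun_prop
  have := intermediate_value_Icc h2 hcont.continuousOn
  rw [← C.Tr1, C.phi_eq W hb1 C.r1pos le_rfl] at hθ1
  rw [C.phi_eq W hb1 h1 h2] at hθ
  obtain ⟨x, hx, hxe⟩ := this ⟨hθ, hθ1⟩
  refine ⟨T x, C.Tmono.monotone hx.1, (C.Tlt hx.2).trans_lt hb1, ?_⟩
  rw [C.phi_eq W hb1 (h1.trans_le hx.1) hx.2]
  exact hxe

end Warp


namespace Warp
variable {m : ℝ → ℝ} {t₀ : ℝ}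

lemma wn_cont (W : Warp m t₀) (ν : ℝ) : Continuous fun t => √(m t ^ 2 - ν ^ 2) / m t := by
  have := W.cont
  exact Continuous.div (by fun_prop) this (fun t => (W.pos t).ne')

lemma Wn_der (W : Warp m t₀) (ν b : ℝ) : HasDerivAt (Wn m ν) (√(m b ^ 2 - ν ^ 2) / m b) b :=
  intervalIntegral.integral_hasDerivAt_right ((W.wn_cont ν).intervalIntegrable _ _)
      ((W.wn_cont ν).stronglyMeasurableAtFilter _ _) (W.wn_cont ν).continuousAt

lemma Wn_odd (W : Warp m t₀) (ν b : ℝ) : Wn m ν (-b) = - Wn m ν b := by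
  have := intervalIntegral.integral_comp_neg (a := 0) (b := b) fun t => √(m t ^ 2 - ν ^ 2) / m t
  simp only [W.even, neg_zero] at this
  unfold Wn
  rw [this, intervalIntegral.integral_symm]

lemma calib (W : Warp m t₀) {c : ℝ → ℝ × ℝ} (hc : ContDiff ℝ 1 c) {a b ν ε : ℝ} (hab : a ≤ b)
    (hε : ε ^ 2 = 1) (hν : ∀ s ∈ Icc a b, |ν| ≤ m (c s).1) :
    ν * ((c b).2 - (c a).2) + ε * (Wn m ν (c b).1 - Wn m ν (c a).1) ≤ ∫ s in a..b, spd m c s := by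
  have h1 := fst_hasDeriv hc
  have h2 := snd_hasDeriv hc
  have hd : ∀ s, HasDerivAt (fun s => ν * (c s).2 + ε * Wn m ν (c s).1)
      (ν * deriv (fun u => (c u).2) s + ε * (√(m (c s).1 ^ 2 - ν ^ 2) / m (c s).1 *
        deriv (fun u => (c u).1) s)) s := by
    intro s
    have h3 : HasDerivAt (fun s => Wn m ν (c s).1) (√(m (c s).1 ^ 2 - ν ^ 2) / m (c s).1 *
        deriv (fun u => (c u).1) s) s :=
      HasDerivAt.comp (h₂ := Wn m ν) (h := fun u => (c u).1) s (W.Wn_der ν (c s).1) (h1 s)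
    exact ((h2 s).const_mul ν).add (h3.const_mul ε)
  have hcd : Continuous fun s => (ν * deriv (fun u => (c u).2) s + ε * (√(m (c s).1 ^ 2 - ν ^ 2) / m (c s).1 *
        deriv (fun u => (c u).1) s)) := by
    have c1 := fst_deriv_cont hc
    have c2 := snd_deriv_cont hc
    have c3 : Continuous fun s => √(m (c s).1 ^ 2 - ν ^ 2) / m (c s).1 :=
      (W.wn_cont ν).comp (continuous_fst.comp hc.continuous)
    fun_prop
  have e := intervalIntegral.integral_eq_sub_of_hasDerivAt (a := a) (b := b) (fun s _ => hd s)
    (hcd.intervalIntegrable _ _)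
  have e2 : ν * ((c b).2 - (c a).2) + ε * (Wn m ν (c b).1 - Wn m ν (c a).1) =
      ν * (c b).2 + ε * Wn m ν (c b).1 - (ν * (c a).2 + ε * Wn m ν (c a).1) := by ring
  rw [e2, ← e]
  apply intervalIntegral.integral_mono_on hab (hcd.intervalIntegrable _ _)
    ((spd_cont W.cont hc).intervalIntegrable _ _)
  intro s hs
  unfold spd
  apply Real.le_sqrt_of_sq_le
  have hp := W.pos (c s).1
  have hn := hν s hs
  have hsq : 0 ≤ m (c s).1 ^ 2 - ν ^ 2 := by
    have := sq_le_sq' (by linarith [abs_nonneg ν]) hn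
    rw [sq_abs] at this; linarith
  have hw : (√(m (c s).1 ^ 2 - ν ^ 2)) ^ 2 = m (c s).1 ^ 2 - ν ^ 2 := Real.sq_sqrt hsq
  set q := √(m (c s).1 ^ 2 - ν ^ 2)
  set M := m (c s).1
  set x := deriv (fun u => (c u).1) s
  set y := deriv (fun u => (c u).2) s
  have hfin : x ^ 2 + M ^ 2 * y ^ 2 - (ν * y + ε * (q / M * x)) ^ 2 = (q * y - ε * (ν * x / M)) ^ 2 := by
    have : q ^ 2 = M ^ 2 - ν ^ 2 := hw
    field_simp
    linear_combination (x ^ 2 * M ^ 2 * 0 - ε ^ 2 * x ^ 2 - M ^ 2 * y ^ 2) * this - (x ^ 2 * M ^ 2) * hε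
  nlinarith [sq_nonneg (q * y - ε * (ν * x / M))]

lemma lower1 (W : Warp m t₀) {c : ℝ → ℝ × ℝ} (hc : ContDiff ℝ 1 c) {B ν β u θ s1 : ℝ}
    (h0 : c 0 = (-u, 0)) (h1 : c B = (u, θ)) (hs1 : s1 ∈ Icc 0 B) (hβ : |(c s1).1| = |β|)
    (hν0 : 0 ≤ ν) (hν : ∀ s ∈ Icc 0 B, ν ≤ m (c s).1) :
    ν * |θ| + 2 * Wn m ν β ≤ wLength m c 0 B := by
  -- reduce to a sign for θ
  obtain ⟨σ, hσ, hσθ⟩ : ∃ σ : ℝ, |σ| = 1 ∧ σ * θ = |θ| := by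
    rcases abs_choice θ with h | h
    · exact ⟨1, by simp, by rw [h]; ring⟩
    · exact ⟨-1, by simp, by rw [h]; ring⟩
  have hsub : |σ * ν| = ν := by rw [abs_mul, hσ, one_mul, abs_of_nonneg hν0]
  have hWσ : ∀ x, Wn m (σ * ν) x = Wn m ν x := by
    intro x; unfold Wn
    have : σ ^ 2 = 1 := by rw [← sq_abs, hσ]; norm_num
    simp [mul_pow, this]
  have hA : ∀ ε : ℝ, ε ^ 2 = 1 → _ := fun ε hε => W.calib hc (a := 0) (b := s1) (ν := σ * ν) (ε := ε) hs1.1 hε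
    (fun s hs => by rw [hsub]; exact hν s ⟨hs.1, hs.2.trans hs1.2⟩)
  have hB : ∀ ε : ℝ, ε ^ 2 = 1 → _ := fun ε hε => W.calib hc (a := s1) (b := B) (ν := σ * ν) (ε := ε) hs1.2 hε
    (fun s hs => by rw [hsub]; exact hν s ⟨hs1.1.trans hs.1, hs.2⟩)
  have hadd : wLength m c 0 B = (∫ s in (0:ℝ)..s1, spd m c s) + ∫ s in s1..B, spd m c s := by
    rw [wLength_eq, intervalIntegral.integral_add_adjacent_intervals
      ((spd_cont W.cont hc).intervalIntegrable _ _) ((spd_cont W.cont hc).intervalIntegrable _ _)]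
  rw [hadd]
  simp only [hWσ, h0, h1, W.Wn_odd] at hA hB
  have hθ : ν * |θ| = σ * ν * θ := by rw [← hσθ]; ring
  rw [hθ]
  rcases abs_eq_abs.1 hβ with h | h
  · have a := hA 1 (by norm_num)
    have b := hB (-1) (by norm_num)
    rw [h] at a b
    linarith
  · have a := hA (-1) (by norm_num)
    have b := hB 1 (by norm_num)
    rw [h, W.Wn_odd] at a b
    linarith

lemma Wn_mono (W : Warp m t₀) {β : ℝ} (hβ : 0 ≤ β) (hβt : β ≤ t₀) :
    Wn m (m β) β ≤ Wn m (m t₀) t₀ := by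
  have i : ∀ ν a b, IntervalIntegrable (fun t => √(m t ^ 2 - ν ^ 2) / m t) MeasureTheory.volume a b :=
    fun ν a b => (W.wn_cont ν).intervalIntegrable _ _
  unfold Wn
  calc (∫ t in (0:ℝ)..β, √(m t ^ 2 - m β ^ 2) / m t) ≤ ∫ t in (0:ℝ)..β, √(m t ^ 2 - m t₀ ^ 2) / m t := by
        apply intervalIntegral.integral_mono_on hβ (i _ _ _) (i _ _ _)
        intro t _
        have := W.pos t
        have h2 := W.isMin β
        have := W.pos t₀
        gcongr
    _ ≤ _ := by
        rw [← intervalIntegral.integral_add_adjacent_intervals (i (m t₀) 0 β) (i _ β t₀)]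
        have : 0 ≤ ∫ t in β..t₀, √(m t ^ 2 - m t₀ ^ 2) / m t := by
          apply intervalIntegral.integral_nonneg hβt
          intro t _
          have := W.pos t
          positivity
        linarith

lemma lower (W : Warp m t₀) {u b θ : ℝ} (hu : 0 < u) (hb : 0 < b) (hbt : b < t₀)
    (hθ : |θ| = phi m (m b)) :
    m b * phi m (m b) + 2 * Wn m (m b) b ≤ wDist m (-u, 0) (u, θ) := by
  apply le_wDist
  intro c B hB hc h0 h1
  have hct : Continuous fun s => |(c s).1| := (continuous_fst.comp hc.continuous).abs
  by_cases hcase : ∃ s ∈ Icc 0 B, t₀ ≤ |(c s).1|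
  · obtain ⟨s, hs, hst⟩ := hcase
    obtain ⟨s1, hs1, hs1β⟩ : ∃ s1 ∈ Icc 0 B, |(c s1).1| = |t₀| := by
      rw [abs_of_pos W.t0pos]
      by_cases hut : t₀ ≤ u
      · have h := intermediate_value_Icc' hB (continuous_fst.comp hc.continuous).continuousOn
        have h' := intermediate_value_Icc hB (continuous_fst.comp hc.continuous).continuousOn
        simp only [Function.comp, h0, h1] at h'
        obtain ⟨x, hx, hxe⟩ := h' (show t₀ ∈ Icc (-u) u from ⟨by linarith [W.t0pos], hut⟩)
        exact ⟨x, hx, by rw [show (c x).1 = t₀ from hxe, abs_of_pos W.t0pos]⟩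
      · push Not at hut
        have h' := intermediate_value_Icc hs.1 hct.continuousOn
        simp only [h0, abs_neg, abs_of_pos hu] at h'
        obtain ⟨x, hx, hxe⟩ := h' ⟨hut.le, hst⟩
        exact ⟨x, ⟨hx.1, hx.2.trans hs.2⟩, hxe⟩
    have hl := W.lower1 hc h0 h1 hs1 hs1β (W.pos t₀).le (fun s _ => W.isMin _)
    refine le_trans ?_ hl
    rw [hθ]
    have hlim : Filter.Tendsto (fun β => m β * phi m (m b) + 2 * Wn m (m t₀) t₀) (nhdsWithin t₀ (Iio t₀))
        (nhds (m t₀ * phi m (m b) + 2 * Wn m (m t₀) t₀)) := by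
      have : Continuous (fun β => m β * phi m (m b) + 2 * Wn m (m t₀) t₀) := by
        have := W.cont
        fun_prop
      exact this.continuousAt.tendsto.mono_left nhdsWithin_le_nhds
    apply ge_of_tendsto hlim
    filter_upwards [Ioo_mem_nhdsLT W.t0pos] with β hβ
    have h3 := W.f_ineq hb hbt hβ.1 hβ.2
    have h4 := W.Wn_mono hβ.1.le hβ.2.le
    linarith
  · push Not at hcase
    obtain ⟨s1, hs1, hmax⟩ := isCompact_Icc.exists_isMaxOn (nonempty_Icc.2 hB) hct.continuousOn
    have hβu : u ≤ |(c s1).1| := by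
      have := hmax (show (0:ℝ) ∈ Icc 0 B from ⟨le_rfl, hB⟩)
      simpa [h0, abs_of_pos hu] using this
    have hl := W.lower1 (β := |(c s1).1|) (ν := m |(c s1).1|) hc h0 h1 hs1 (by simp) (W.pos _).le (fun s hs => by
      apply W.m_le_of_abs
      · rw [abs_abs]; exact hmax hs
      · rw [abs_abs]; exact (hcase s1 hs1).le)
    refine le_trans ?_ hl
    rw [hθ]
    exact W.f_ineq hb hbt (hu.trans_le hβu) (hcase s1 hs1)

end Warp


lemma int_sin_half {h : ℝ → ℝ} (hc : Continuous h) :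
    ∫ ψ in (0:ℝ)..π, h (sin ψ) = 2 * ∫ ψ in (0:ℝ)..(π / 2), h (sin ψ) := by
  have i : ∀ a b, IntervalIntegrable (fun ψ => h (sin ψ)) MeasureTheory.volume a b := fun a b =>
    (by fun_prop : Continuous fun ψ => h (sin ψ)).intervalIntegrable _ _
  rw [← intervalIntegral.integral_add_adjacent_intervals (i 0 (π / 2)) (i (π / 2) π)]
  have := intervalIntegral.integral_comp_sub_left (a := 0) (b := π / 2) (fun ψ => h (sin ψ)) π
  simp only [Real.sin_pi_sub, sub_zero] at this
  rw [show π - π / 2 = π / 2 by ring] at this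
  rw [← this]; ring

lemma primitive_shift {g : ℝ → ℝ} (hc : Continuous g) (hp : ∀ ψ, g (ψ + π) = g ψ) (ψ : ℝ) :
    ∫ y in (0:ℝ)..(ψ + π), g y = (∫ y in (0:ℝ)..ψ, g y) + ∫ y in (0:ℝ)..π, g y := by
  have hper : Function.Periodic g π := hp
  have h1 := hper.intervalIntegral_add_eq ψ 0
  rw [zero_add] at h1
  rw [← h1, intervalIntegral.integral_add_adjacent_intervals (hc.intervalIntegrable _ _)
    (hc.intervalIntegrable _ _)]

lemma primitive_der {g : ℝ → ℝ} (hc : Continuous g) (ψ : ℝ) :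
    HasDerivAt (fun ψ => ∫ y in (0:ℝ)..ψ, g y) (g ψ) ψ :=
  intervalIntegral.integral_hasDerivAt_right (hc.intervalIntegrable _ _)
      (hc.stronglyMeasurableAtFilter _ _) hc.continuousAt

/-- data of a model geodesic -/
structure Model (m : ℝ → ℝ) (u b : ℝ) (x x' h : ℝ → ℝ) (S : ℝ) : Prop where
  Spos : 0 < S
  dx : ∀ s, HasDerivAt x (x' s) s
  dx' : ∀ s, HasDerivAt x' (m b ^ 2 * (deriv m (x s) / m (x s) ^ 3)) s
  dh : ∀ s, HasDerivAt h (m b / m (x s) ^ 2) s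
  unit : ∀ s, x' s ^ 2 + m b ^ 2 / m (x s) ^ 2 = 1
  x0 : x 0 = -u
  h0 : h 0 = 0
  xS : ∀ s, x (s + S) = - x s
  hS : ∀ s, h (s + S) = h s + phi m (m b)
  Seq : S = m b * phi m (m b) + 2 * Wn m (m b) b

namespace Warp
variable {m : ℝ → ℝ} {t₀ : ℝ}

lemma exists_model (W : Warp m t₀) {u b : ℝ} (hu : 0 < u) (hub : u ≤ b) (hbt : b < t₀)
    (e : ℝ) (he : e = 1 ∨ e = -1) :
    ∃ x x' h S, Model m u b x x' h S ∧ 0 ≤ e * x' 0 := by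
  have hb : 0 < b := hu.trans_le hub
  obtain ⟨b1, hbb1, hb1t⟩ := exists_between hbt
  obtain ⟨D, T, r1, C⟩ := exists_chart W (hb.trans hbb1) hb1t
  obtain ⟨τ, hτ0, hτr, hτb⟩ := C.exists_tau hb hbb1.le
  have hτlt : τ < r1 := by rw [← C.Tmono.lt_iff_lt, hτb, C.Tr1]; exact hbb1
  obtain ⟨τu, hu0, hur, hτu⟩ := C.exists_tau hu (hub.trans hbb1.le)
  have huτ : τu ≤ τ := by rw [← C.Tmono.le_iff_le, hτb, hτu]; exact hub
  set s0 := √(1 + τ ^ 2) with hs0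
  have hs0p : 0 < s0 := Real.sqrt_pos.2 (by positivity)
  have hs02 : s0 ^ 2 = 1 + τ ^ 2 := Real.sq_sqrt (by positivity)
  have hM := W.pos 0
  have hμ : m b = m 0 / s0 := by
    rw [← hτb]; exact C.mTe W (by rw [abs_of_pos hτ0]; exact hτr)
  set g : ℝ → ℝ := fun ψ => s0 * D (τ * sin ψ) with hg
  have hDc := C.Dcont
  have hgc : Continuous g := by fun_prop
  have hgp : ∀ ψ, g (ψ + π) = g ψ := by
    intro ψ; simp only [hg, Real.sin_add_pi, mul_neg, C.Deven]
  have hgpos : ∀ ψ, 0 < g ψ := fun ψ => mul_pos hs0p (C.Dpos _)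
  -- lower bound of g
  obtain ⟨r0, hr0, hmin⟩ := isCompact_Icc.exists_isMinOn (nonempty_Icc.2 (by linarith : -τ ≤ τ)) hDc.continuousOn
  have hrange : ∀ ψ, |τ * sin ψ| ≤ τ := by
    intro ψ
    rw [abs_mul, abs_of_pos hτ0]
    have := Real.abs_sin_le_one ψ
    nlinarith
  obtain ⟨P, hP1, hP2, hP3⟩ := exists_inv g hgc (s0 * D r0) (mul_pos hs0p (C.Dpos _)) (fun ψ => by
    apply mul_le_mul_of_nonneg_left _ hs0p.le
    exact hmin (abs_le.1 (hrange ψ)))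
  -- initial angle
  obtain ⟨ψ0, hψ0, hψ0c⟩ : ∃ ψ0, τ * sin ψ0 = -τu ∧ 0 ≤ e * cos ψ0 := by
    have hq : τu / τ ≤ 1 := (div_le_one hτ0).2 huτ
    have hq0 : 0 < τu / τ := by positivity
    rcases he with rfl | rfl
    · refine ⟨-arcsin (τu / τ), ?_, ?_⟩
      · rw [Real.sin_neg, Real.sin_arcsin (by linarith) hq]; field_simp
      · rw [one_mul, Real.cos_neg]; exact Real.cos_arcsin_nonneg _
    · refine ⟨arcsin (τu / τ) + π, ?_, ?_⟩
      · rw [Real.sin_add_pi, Real.sin_arcsin (by linarith) hq]; field_simp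
      · rw [Real.cos_add_pi]
        have := Real.cos_arcsin_nonneg (τu / τ)
        linarith
  set S := ∫ y in (0:ℝ)..π, g y with hS
  set σ0 := ∫ y in (0:ℝ)..ψ0, g y with hσ0
  set ψ : ℝ → ℝ := fun s => P (s + σ0) with hψ
  have hψd : ∀ s, HasDerivAt ψ (g (ψ s))⁻¹ s := fun s =>
    HasDerivAt.comp_add_const s σ0 (hP3 (s + σ0))
  have hψ00 : ψ 0 = ψ0 := by simp only [hψ, zero_add]; exact hP1 ψ0
  have hψS : ∀ s, ψ (s + S) = ψ s + π := by
    intro s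
    have h1 := primitive_shift hgc hgp (ψ s)
    have h2 : ∫ y in (0:ℝ)..(ψ s), g y = s + σ0 := hP2 _
    rw [h2, ← hS] at h1
    have h3 := hP1 (ψ s + π)
    rw [h1] at h3
    simp only [hψ]
    rw [← h3]; congr 1; ring
  have hkc := C.kap_cont
  have hKc : Continuous fun ψ => kap D (τ * sin ψ) := by fun_prop
  have hKp : ∀ ψ, kap D (τ * sin (ψ + π)) = kap D (τ * sin ψ) := by
    intro ψ; simp only [kap, Real.sin_add_pi, mul_neg, C.Deven, neg_sq]
  set Θ : ℝ → ℝ := fun ψ => 1 / m 0 * ∫ y in (0:ℝ)..ψ, kap D (τ * sin y) with hΘ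
  have hΘd : ∀ y, HasDerivAt Θ (1 / m 0 * kap D (τ * sin y)) y := fun y =>
    (primitive_der hKc y).const_mul _
  have hphi : phi m (m b) = 2 / m 0 * ∫ ψ in (0:ℝ)..(π / 2), kap D (τ * sin ψ) := by
    rw [← hτb]; exact C.phi_eq W hb1t hτ0 hτr
  have hΘS : ∀ y, Θ (y + π) = Θ y + phi m (m b) := by
    intro y
    simp only [hΘ]
    rw [primitive_shift hKc hKp, hphi, int_sin_half (h := fun z => kap D (τ * z)) (by fun_prop)]
    ring
  have hmr : ∀ y, m (T (τ * sin y)) ^ 2 * (1 + (τ * sin y) ^ 2) = m 0 ^ 2 := fun y =>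
    C.mT _ ((hrange y).trans hτr)
  have hsd : ∀ s, HasDerivAt (fun s => τ * sin (ψ s)) (τ * (cos (ψ s) * (g (ψ s))⁻¹)) s := fun s =>
    ((hψd s).sin).const_mul τ
  -- derivative of m in the chart
  have hmd : ∀ r, |r| ≤ τ → deriv m (T r) * D r * (1 + r ^ 2) = - m (T r) * r := by
    intro r hr
    have h1 : HasDerivAt (fun r => m (T r)) (deriv m (T r) * D r) r :=
      HasDerivAt.comp (h₂ := m) (h := T) r (m_d1 W.smooth (T r)) (C.Tder r)
    have h2 : HasDerivAt (fun r => 1 + r ^ 2) (2 * r * 1) r :=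
      (sq_hasDeriv (hasDerivAt_id r)).const_add 1
    have h3 := (sq_hasDeriv h1).mul h2
    have h4 : (fun r => m (T r) ^ 2 * (1 + r ^ 2)) =ᶠ[nhds r] fun _ => m 0 ^ 2 := by
      have : ∀ᶠ y in nhds r, |y| < r1 := by
        apply (continuous_abs.isOpen_preimage _ isOpen_Iio).mem_nhds
        exact hr.trans_lt hτlt
      filter_upwards [this] with y hy
      exact C.mT y hy.le
    have h5 : HasDerivAt (fun r => m (T r) ^ 2 * (1 + r ^ 2)) 0 r :=
      (hasDerivAt_const r (m 0 ^ 2)).congr_of_eventuallyEq h4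
    have h6 := h3.unique h5
    have hp := W.pos (T r)
    have h7 : 2 * m (T r) * (deriv m (T r) * D r * (1 + r ^ 2) + m (T r) * r) = 0 := by
      linear_combination h6
    rcases mul_eq_zero.1 h7 with h8 | h8
    · linarith
    · linarith
  refine ⟨fun s => T (τ * sin (ψ s)), fun s => τ / s0 * cos (ψ s), fun s => Θ (ψ s) - Θ ψ0, S, ?_, ?_⟩
  · constructor
    · exact intervalIntegral.intervalIntegral_pos_of_pos (hgc.intervalIntegrable _ _) hgpos Real.pi_pos
    · intro s
      have h1 := HasDerivAt.comp (h₂ := T) (h := fun s => τ * sin (ψ s)) s (C.Tder _) (hsd s)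
      refine HasDerivAt.congr_deriv h1 ?_
      have := C.Dpos (τ * sin (ψ s))
      simp only [hg]
      field_simp
    · intro s
      have h1 := ((hψd s).cos).const_mul (τ / s0)
      refine HasDerivAt.congr_deriv h1 ?_
      have hD := C.Dpos (τ * sin (ψ s))
      have hd := hmd _ (hrange (ψ s))
      have hm := hmr (ψ s)
      have hp := W.pos (T (τ * sin (ψ s)))
      simp only [hg]
      rw [hμ]
      set r := τ * sin (ψ s) with hr
      set mm := m (T r)
      have hx : 0 < 1 + r ^ 2 := by positivity
      have hdd : deriv m (T r) = - mm * r / (D r * (1 + r ^ 2)) := by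
        rw [eq_div_iff (by positivity)]; linarith
      rw [hdd]
      have hr' : -sin (ψ s) * (s0 * D r)⁻¹ * (τ / s0) = - r / (s0 ^ 2 * D r) := by
        rw [hr]; field_simp
      rw [mul_comm, hr', div_pow, ← hm]
      field_simp
    · intro s
      have h1 := (HasDerivAt.comp (h₂ := Θ) (h := ψ) s (hΘd (ψ s)) (hψd s)).sub_const (Θ ψ0)
      refine HasDerivAt.congr_deriv h1 ?_
      have hD := C.Dpos (τ * sin (ψ s))
      have hm := hmr (ψ s)
      have hp := W.pos (T (τ * sin (ψ s)))
      simp only [hg, kap]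
      rw [hμ]
      set r := τ * sin (ψ s) with hr
      set mm := m (T r)
      field_simp
      linear_combination hm
    · intro s
      have hm := hmr (ψ s)
      have hp := W.pos (T (τ * sin (ψ s)))
      have h1 : m b ^ 2 / m (T (τ * sin (ψ s))) ^ 2 = (1 + (τ * sin (ψ s)) ^ 2) / s0 ^ 2 := by
        rw [hμ, div_pow, ← hm]; field_simp
      rw [h1, hs02]
      rw [mul_pow, div_pow, hs02]
      have := Real.sin_sq_add_cos_sq (ψ s)
      field_simp
      linear_combination τ ^ 2 * this
    · simp only [hψ00, hψ0, C.Todd, hτu]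
    · simp only [hψ00, sub_self]
    · intro s
      simp only [hψS, Real.sin_add_pi, mul_neg, C.Todd]
    · intro s
      simp only [hψS, hΘS]; ring
    · have hWn : Wn m (m b) b = ∫ r in (0:ℝ)..τ, pker τ r * kap D r := by
        rw [← hτb]; exact C.Wn_eq W hτ0 hτr
      rw [hWn, pker_sin hτ0 hkc, hphi, hS, hμ]
      simp only [hg]
      rw [int_sin_half (h := fun z => s0 * D (τ * z)) (by fun_prop)]
      have e1 : m 0 / s0 * (2 / m 0 * ∫ ψ in (0:ℝ)..(π / 2), kap D (τ * sin ψ)) =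
        2 * ∫ ψ in (0:ℝ)..(π / 2), 1 / s0 * kap D (τ * sin ψ) := by
        rw [intervalIntegral.integral_const_mul]; field_simp
      rw [e1, ← mul_add, ← intervalIntegral.integral_add]
      · congr 1
        apply intervalIntegral.integral_congr
        intro y _
        simp only [kap]
        rw [← hs0]
        have := Real.sin_sq_add_cos_sq y
        have hx : 0 < 1 + (τ * sin y) ^ 2 := by positivity
        field_simp
        rw [hs02]
        linear_combination (-τ ^ 2 * D (τ * sin y)) * this
      · exact (by fun_prop : Continuous fun ψ => 1 / s0 * kap D (τ * sin ψ)).intervalIntegrable _ _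
      · apply Continuous.intervalIntegrable
        apply Continuous.mul _ (by fun_prop)
        apply Continuous.div (by fun_prop) (by fun_prop)
        intro y; rw [← hs0]; positivity
  · simp only [hψ00]
    have : e * (τ / s0 * cos ψ0) = τ / s0 * (e * cos ψ0) := by ring
    rw [this]; positivity

end Warp


lemma contDiff_one_of {x x' : ℝ → ℝ} (dx : ∀ s, HasDerivAt x (x' s) s) (hc : Continuous x') :
    ContDiff ℝ 1 x := by
  rw [contDiff_one_iff_deriv]
  refine ⟨fun s => (dx s).differentiableAt, ?_⟩
  rwa [show deriv x = x' from funext fun s => (dx s).deriv]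

lemma contDiff_two_of {x x' : ℝ → ℝ} (dx : ∀ s, HasDerivAt x (x' s) s) (hc : ContDiff ℝ 1 x') :
    ContDiff ℝ 2 x := by
  rw [show (2 : WithTop ℕ∞) = 1 + 1 from one_add_one_eq_two.symm, contDiff_succ_iff_deriv]
  refine ⟨fun s => (dx s).differentiableAt, by simp, ?_⟩
  rwa [show deriv x = x' from funext fun s => (dx s).deriv]

lemma wDist_unit {m : ℝ → ℝ} {c : ℝ → ℝ × ℝ} (hc : ContDiff ℝ 1 c) {a b : ℝ} (hab : a ≤ b)
    (h1 : ∀ s, (deriv (fun u => (c u).1) s) ^ 2 +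
      m (c s).1 ^ 2 * (deriv (fun u => (c u).2) s) ^ 2 = 1) : wDist m (c a) (c b) ≤ b - a := by
  refine (wDist_le_ab hc hab).trans_eq ?_
  have : spd m c = fun _ => 1 := by
    funext s
    unfold spd
    rw [h1 s, Real.sqrt_one]
  rw [this]; simp

lemma pos_slope {f : ℝ → ℝ} {f' : ℝ} (hf : HasDerivAt f f' 0) (h0 : f 0 = 0) (hp : 0 < f')
    {a : ℝ} (ha : 0 < a) : ∃ s, 0 < s ∧ s < a ∧ 0 < f s := by
  have h := hasDerivAt_iff_tendsto_slope.1 hf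
  have h2 := h.mono_left (nhdsWithin_mono 0 (show Ioi (0:ℝ) ⊆ {0}ᶜ from fun x hx => (ne_of_gt hx)))
  have h3 := h2.eventually (lt_mem_nhds hp)
  obtain ⟨s, hs, hs2⟩ := (h3.and (Ioo_mem_nhdsGT ha)).exists
  refine ⟨s, hs2.1, hs2.2, ?_⟩
  rw [slope_def_field, h0, sub_zero, sub_zero] at hs
  exact (div_pos_iff_of_pos_right hs2.1).1 hs

namespace Warp
variable {m : ℝ → ℝ} {t₀ : ℝ}

lemma F_C1 (W : Warp m t₀) (c : ℝ) : ContDiff ℝ 1 (fun y => c * (deriv m y / m y ^ 3)) := by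
  have h1 := m_dC W.smooth
  have h2 : ContDiff ℝ 1 m := W.smooth.of_le (by exact_mod_cast le_top)
  exact contDiff_const.mul (h1.div (h2.pow 3) fun y => (pow_pos (W.pos y) 3).ne')

lemma model_geod (W : Warp m t₀) {u b : ℝ} {x x' h : ℝ → ℝ} {S : ℝ} (M : Model m u b x x' h S)
    {σ : ℝ} (hσ : σ ^ 2 = 1) : IsUnitGeodesic m (fun s => (x s, σ * h s)) := by
  have h2 : ContDiff ℝ 1 m := W.smooth.of_le (by exact_mod_cast le_top)
  have cx' : Continuous x' := continuous_iff_continuousAt.2 fun s => (M.dx' s).continuousAt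
  have cx : ContDiff ℝ 1 x := contDiff_one_of M.dx cx'
  have Cx' : ContDiff ℝ 1 x' := contDiff_one_of M.dx' (((W.F_C1 _).comp cx).continuous)
  have Cx : ContDiff ℝ 2 x := contDiff_two_of M.dx Cx'
  have Ch : ContDiff ℝ 2 h := contDiff_two_of M.dh
    (contDiff_const.div ((h2.comp cx).pow 2) fun y => (pow_pos (W.pos _) 2).ne')
  have e1 : deriv (fun s => x s) = x' := funext fun s => (M.dx s).deriv
  have e2 : ∀ s, deriv (fun s => σ * h s) s = σ * (m b / m (x s) ^ 2) := fun s =>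
    ((M.dh s).const_mul σ).deriv
  refine ⟨Cx.prodMk (contDiff_const.mul Ch), ?_, ⟨σ * m b, ?_⟩, ?_⟩
  · intro s
    simp only
    rw [e1, e2, (M.dx' s).deriv, mul_pow, hσ]
    have := (W.pos (x s)).ne'
    field_simp
  · intro s
    simp only
    rw [e2]
    have := (W.pos (x s)).ne'
    field_simp
  · intro s
    simp only
    rw [e1, e2, ← M.unit s, mul_pow, hσ]
    have := (W.pos (x s)).ne'
    field_simp

lemma model_nonmin (W : Warp m t₀) {u b : ℝ} {x x' h : ℝ → ℝ} {S : ℝ} (M : Model m u b x x' h S)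
    (hu : 0 < u) (hut : u < t₀)
    {σ : ℝ} (hσ : σ ^ 2 = 1) {ε : ℝ} (hε : 0 < ε) :
    wDist m (x 0, σ * h 0) (x (S + ε), σ * h (S + ε)) < S + ε := by
  have G := W.model_geod M hσ
  have cx' : Continuous x' := continuous_iff_continuousAt.2 fun s => (M.dx' s).continuousAt
  have cx : ContDiff ℝ 1 x := contDiff_one_of M.dx cx'
  have hmb := W.pos b
  obtain ⟨δ, hδ0, hδε, hδ⟩ : ∃ δ, 0 < δ ∧ δ < ε ∧ x' δ ≠ 0 := by
    by_contra! hcon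
    have hp : 0 < m b ^ 2 * (deriv m (x 0) / m (x 0) ^ 3) := by
      rw [M.x0, m_d1odd W.even]
      have := W.dneg u hu hut
      have := W.pos (-u)
      have h4 : 0 < - deriv m u := by linarith
      positivity
    have hc : Continuous fun s => m b ^ 2 * (deriv m (x s) / m (x s) ^ 3) :=
      ((W.F_C1 (m b ^ 2)).comp cx).continuous
    have h3 := (hc.continuousAt (x := 0)).eventually (lt_mem_nhds hp)
    obtain ⟨s, hs, hs2⟩ := ((h3.filter_mono nhdsWithin_le_nhds).and (Ioo_mem_nhdsGT hε)).exists
    have he : x' =ᶠ[nhds s] fun _ => 0 := by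
      filter_upwards [Ioo_mem_nhds hs2.1 hs2.2] with y hy using hcon y hy.1 hy.2
    have h5 := (M.dx' s).deriv
    rw [he.deriv_eq] at h5
    simp only [deriv_const] at h5
    linarith
  have hp := W.pos (x δ)
  have hlt : m b / m (x δ) < 1 := by
    have h1 := M.unit δ
    have h2 : 0 < x' δ ^ 2 := by positivity
    have h3 : 0 < m b / m (x δ) := by positivity
    have h4 : (m b / m (x δ)) ^ 2 < 1 := by rw [div_pow]; linarith
    nlinarith
  -- shortcut at δ
  have hd : HasDerivAt (fun η => η - m (x (δ - η)) * (h δ - h (δ - η))) (1 - m b / m (x δ)) 0 := by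
    have hs : HasDerivAt (fun η : ℝ => δ - η) (-1) 0 := by
      simpa using (hasDerivAt_id (0:ℝ)).const_sub δ
    have a1 : HasDerivAt (fun η => h (δ - η)) (m b / m (x δ) ^ 2 * (-1)) 0 :=
      HasDerivAt.comp (h₂ := h) (h := fun η : ℝ => δ - η) 0 (by simpa using M.dh δ) hs
    have a2 : HasDerivAt (fun η => x (δ - η)) (x' δ * (-1)) 0 :=
      HasDerivAt.comp (h₂ := x) (h := fun η : ℝ => δ - η) 0 (by simpa using M.dx δ) hs
    have a3 : HasDerivAt (fun η => m (x (δ - η))) (deriv m (x δ) * (x' δ * (-1))) 0 :=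
      HasDerivAt.comp (h₂ := m) (h := fun η : ℝ => x (δ - η)) 0
        (by simpa using m_d1 W.smooth (x δ)) a2
    refine ((hasDerivAt_id (0:ℝ)).sub (a3.mul (a1.const_sub (h δ)))).congr_deriv ?_
    simp only [sub_zero]
    field_simp
    ring
  obtain ⟨η, hη0, hη1, hη⟩ := pos_slope hd (by simp) (by linarith) (lt_min hδ0 M.Spos)
  have hηδ : η < δ := hη1.trans_le (min_le_left _ _)
  have hηS : η < S := hη1.trans_le (min_le_right _ _)
  set g : ℝ → ℝ × ℝ := fun s => (x s, σ * h s) with hg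
  set c : ℝ → ℝ × ℝ := fun s => (x (2 * δ - s), σ * (2 * h δ - h (2 * δ - s))) with hc
  have gC : ContDiff ℝ 1 g := G.1.of_le (by norm_num)
  have cC : ContDiff ℝ 1 c := by
    have h1 : ContDiff ℝ 1 (fun s => (g (2 * δ - s)).1) := by fun_prop
    have h2 : ContDiff ℝ 1 (fun s => σ * (2 * h δ) - (g (2 * δ - s)).2) := by fun_prop
    have : c = fun s => ((g (2 * δ - s)).1, σ * (2 * h δ) - (g (2 * δ - s)).2) := by
      funext s; simp only [hc, hg, Prod.mk.injEq, true_and]; ring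
    rw [this]; exact h1.prodMk h2
  have cU : ∀ s, (deriv (fun u => (c u).1) s) ^ 2 +
      m (c s).1 ^ 2 * (deriv (fun u => (c u).2) s) ^ 2 = 1 := by
    intro s
    have hs : HasDerivAt (fun s : ℝ => 2 * δ - s) (-1) s := by
      simpa using (hasDerivAt_id s).const_sub (2 * δ)
    have a1 : HasDerivAt (fun s => h (2 * δ - s)) (m b / m (x (2 * δ - s)) ^ 2 * (-1)) s :=
      HasDerivAt.comp (h₂ := h) (h := fun s : ℝ => 2 * δ - s) s (M.dh _) hs
    have a2 : HasDerivAt (fun s => x (2 * δ - s)) (x' (2 * δ - s) * (-1)) s :=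
      HasDerivAt.comp (h₂ := x) (h := fun s : ℝ => 2 * δ - s) s (M.dx _) hs
    have a3 := (a1.const_sub (2 * h δ)).const_mul σ
    simp only [hc]
    rw [a2.deriv, a3.deriv]
    rw [mul_pow σ, hσ]
    refine Eq.trans ?_ (M.unit (2 * δ - s))
    have := (W.pos (x (2 * δ - s))).ne'
    field_simp
  have k1 : wDist m (g 0) (g (δ - η)) ≤ δ - η := by
    simpa using wDist_unit gC (by linarith : (0:ℝ) ≤ δ - η) G.2.2.2
  have k2 : wDist m (g (δ - η)) (c (δ + η)) < 2 * η := by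
    have hx1 : x (2 * δ - (δ + η)) = x (δ - η) := by congr 1; ring
    have hh1 : h (2 * δ - (δ + η)) = h (δ - η) := by congr 1; ring
    have h1 := wDist_chord W.pos (g (δ - η)) (c (δ + η)) (m (x (δ - η))) (by
      simp only [hg, hc, hx1, uIcc_self]
      intro t ht
      rw [ht])
    refine h1.trans_lt ?_
    simp only [hg, hc, hx1, hh1, sub_self, abs_zero, zero_add]
    rw [show σ * (2 * h δ - h (δ - η)) - σ * h (δ - η) = σ * (2 * (h δ - h (δ - η))) by ring]
    have hmono : h (δ - η) ≤ h δ := by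
      have : Monotone h := monotone_of_hasDerivAt_nonneg M.dh (fun s => by
        have := W.pos (x s)
        positivity)
      exact this (by linarith)
    have hσ1 : |σ| = 1 := by
      rw [← sq_eq_sq₀ (abs_nonneg _) zero_le_one, sq_abs, hσ]; norm_num
    rw [abs_mul, hσ1, one_mul, abs_of_nonneg (by linarith)]
    linarith
  have k3 : wDist m (c (δ + η)) (c (δ + S)) ≤ S - η := by
    have := wDist_unit cC (by linarith : δ + η ≤ δ + S) cU
    linarith
  have k4 : wDist m (g (δ + S)) (g (S + ε)) ≤ ε - δ := by
    have := wDist_unit gC (by linarith : δ + S ≤ S + ε) G.2.2.2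
    linarith
  have hcg : c (δ + S) = g (δ + S) := by
    simp only [hc, hg]
    rw [show 2 * δ - (δ + S) = δ - S by ring]
    have h1 := M.xS (δ - S)
    have h2 := M.hS (δ - S)
    rw [sub_add_cancel] at h1 h2
    rw [M.xS, M.hS, h1, h2]
    ext <;> simp
    left; ring
  rw [hcg] at k3
  have t1 := wDist_triangle W.cont (g 0) (g (δ - η)) (g (S + ε))
  have t2 := wDist_triangle W.cont (g (δ - η)) (c (δ + η)) (g (S + ε))
  have t3 := wDist_triangle W.cont (c (δ + η)) (g (δ + S)) (g (S + ε))
  show wDist m (g 0) (g (S + ε)) < S + ε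
  linarith

lemma model_min (W : Warp m t₀) {u b : ℝ} {x x' h : ℝ → ℝ} {S : ℝ} (M : Model m u b x x' h S)
    (hu : 0 < u) (hub : u ≤ b) (hbt : b < t₀) (hphi : 0 ≤ phi m (m b))
    {σ : ℝ} (hσ : σ ^ 2 = 1) :
    x S = u ∧ h S = phi m (m b) ∧ wDist m (x 0, σ * h 0) (x S, σ * h S) = S := by
  have G := W.model_geod M hσ
  have hx : x S = u := by have := M.xS 0; rw [zero_add, M.x0, neg_neg] at this; exact this
  have hh : h S = phi m (m b) := by have := M.hS 0; rw [zero_add, M.h0, zero_add] at this; exact this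
  refine ⟨hx, hh, le_antisymm ?_ ?_⟩
  · simpa using wDist_unit (G.1.of_le (by norm_num)) M.Spos.le G.2.2.2
  · have hσ1 : |σ| = 1 := by
      rw [← sq_eq_sq₀ (abs_nonneg _) zero_le_one, sq_abs, hσ]; norm_num
    have := W.lower (θ := σ * phi m (m b)) hu (hu.trans_le hub) hbt (by
      rw [abs_mul, hσ1, one_mul, abs_of_nonneg hphi])
    rw [← M.Seq] at this
    rw [M.x0, M.h0, mul_zero, hx, hh]
    exact this

end Warp


namespace Warp
variable {m : ℝ → ℝ} {t₀ : ℝ}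

lemma phi_nn (W : Warp m t₀) {b : ℝ} (hb : 0 < b) (hbt : b < t₀) : 0 ≤ phi m (m b) := by
  unfold phi
  rw [W.xi_eq hb hbt]
  refine mul_nonneg zero_le_two (intervalIntegral.integral_nonneg hb.le fun t _ => ?_)
  have := W.pos t
  have := W.pos b
  positivity

/-- second order equation satisfied by a geodesic -/
lemma geod_eqs (W : Warp m t₀) {γ : ℝ → ℝ × ℝ} (hγ : IsUnitGeodesic m γ) :
    ∃ (ν : ℝ) (x' : ℝ → ℝ), (∀ s, HasDerivAt (fun s => (γ s).1) (x' s) s) ∧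
      (∀ s, HasDerivAt x' (ν ^ 2 * (deriv m (γ s).1 / m (γ s).1 ^ 3)) s) ∧
      (∀ s, HasDerivAt (fun s => (γ s).2) (ν / m (γ s).1 ^ 2) s) ∧
      (∀ s, x' s ^ 2 + ν ^ 2 / m (γ s).1 ^ 2 = 1) := by
  obtain ⟨hC, h1, ⟨ν, h2⟩, h3⟩ := hγ
  have hC1 : ContDiff ℝ 1 γ := hC.of_le (by norm_num)
  have h2' : ∀ s, deriv (fun u => (γ u).2) s = ν / m (γ s).1 ^ 2 := fun s => by
    have := (W.pos (γ s).1).ne'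
    rw [← h2 s]; field_simp
  refine ⟨ν, deriv fun u => (γ u).1, fst_hasDeriv hC1, fun s => ?_, fun s => ?_, fun s => ?_⟩
  · have hd : ContDiff ℝ (1 + 1) (fun u => (γ u).1) := by
      rw [one_add_one_eq_two]; exact contDiff_fst.comp hC
    have hd2 := (contDiff_succ_iff_deriv.1 hd).2.2
    refine ((hd2.differentiable one_ne_zero s).hasDerivAt).congr_deriv ?_
    rw [h1, h2']
    have := (W.pos (γ s).1).ne'
    field_simp
  · exact (snd_hasDeriv hC1 s).congr_deriv (h2' s)
  · rw [← h3 s, h2']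
    have := (W.pos (γ s).1).ne'
    field_simp

lemma small_min (W : Warp m t₀) {u : ℝ} (hu : 0 < u) (hut : u < t₀) {γ : ℝ → ℝ × ℝ}
    (hγ : IsUnitGeodesic m γ) (h0 : γ 0 = (-u, 0)) {ν : ℝ} {x' : ℝ → ℝ}
    (dx : ∀ s, HasDerivAt (fun s => (γ s).1) (x' s) s)
    (dx' : ∀ s, HasDerivAt x' (ν ^ 2 * (deriv m (γ s).1 / m (γ s).1 ^ 3)) s)
    (dh : ∀ s, HasDerivAt (fun s => (γ s).2) (ν / m (γ s).1 ^ 2) s)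
    (un : ∀ s, x' s ^ 2 + ν ^ 2 / m (γ s).1 ^ 2 = 1) (hν : |ν| ≤ m t₀) {a : ℝ} (ha : 0 ≤ a) :
    IsMinimalSeg m γ a := by
  have hC1 : ContDiff ℝ 1 γ := hγ.1.of_le (by norm_num)
  have cx' : Continuous x' := continuous_iff_continuousAt.2 fun s => (dx' s).continuousAt
  have hne : ∀ s, 0 ≤ s → x' s ≠ 0 := by
    intro s1 hs1 hz
    have h1 := un s1
    have hp := W.pos (γ s1).1
    have hmin := W.isMin (γ s1).1
    have h2 : ν ^ 2 = m (γ s1).1 ^ 2 := by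
      rw [hz] at h1; field_simp at h1; linarith
    have h3 : m (γ s1).1 = m t₀ := by
      have : |ν| = m (γ s1).1 := by
        rw [← sq_eq_sq₀ (abs_nonneg _) hp.le, sq_abs, h2]
      linarith
    have h4 : deriv m (γ s1).1 = 0 := by
      apply IsLocalMin.deriv_eq_zero
      exact Filter.Eventually.of_forall fun y => by rw [h3]; exact W.isMin y
    have hs : ∀ s, HasDerivAt (fun s : ℝ => s1 - s) (-1) s := fun s => by
      simpa using (hasDerivAt_id s).const_sub s1
    have key := ode2_unique _ (W.F_C1 (ν ^ 2)) (fun s => (γ (s1 - s)).1) (fun s => -x' (s1 - s))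
      (fun _ => (γ s1).1) (fun _ => 0)
      (fun s => (HasDerivAt.comp (h₂ := fun s => (γ s).1) (h := fun s : ℝ => s1 - s) s
        (dx (s1 - s)) (hs s)).congr_deriv (by ring))
      (fun s => ((HasDerivAt.comp (h₂ := x') (h := fun s : ℝ => s1 - s) s
        (dx' (s1 - s)) (hs s)).neg).congr_deriv (by ring))
      (fun s => hasDerivAt_const _ _)
      (fun s => (hasDerivAt_const _ _).congr_deriv (by simp [h4]))
      (by simp) (by simp [hz]) s1 hs1
    have h5 := key.1
    simp only [sub_self, h0] at h5
    rw [← h5, W.even] at h3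
    have := W.strictAnti (show u ∈ Icc 0 t₀ from ⟨hu.le, hut.le⟩) ⟨W.t0pos.le, le_rfl⟩ hut
    linarith
  obtain ⟨e, he, hsg⟩ : ∃ e : ℝ, e ^ 2 = 1 ∧ ∀ s, 0 ≤ s → |x' s| = e * x' s := by
    have hcase : (∀ s ∈ Ici (0:ℝ), 0 < x' s) ∨ (∀ s ∈ Ici (0:ℝ), x' s < 0) := by
      by_contra! hcon
      obtain ⟨⟨p, hp, hp'⟩, q, hq, hq'⟩ := hcon
      have := (isPreconnected_Ici (a := (0:ℝ))).intermediate_value hp hq cx'.continuousOn ⟨hp', hq'⟩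
      obtain ⟨s, hs, hs'⟩ := this
      exact hne s hs hs'
    rcases hcase with h | h
    · exact ⟨1, by norm_num, fun s hs => by rw [abs_of_pos (h s hs), one_mul]⟩
    · exact ⟨-1, by norm_num, fun s hs => by rw [abs_of_neg (h s hs), neg_one_mul]⟩
  have hd : ∀ s, 0 ≤ s → HasDerivAt (fun s => ν * (γ s).2 + e * Wn m ν (γ s).1 - s) 0 s := by
    intro s hs
    have h3 : HasDerivAt (fun s => Wn m ν (γ s).1) (√(m (γ s).1 ^ 2 - ν ^ 2) / m (γ s).1 * x' s) s :=
      HasDerivAt.comp (h₂ := Wn m ν) (h := fun u => (γ u).1) s (W.Wn_der ν (γ s).1) (dx s)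
    refine ((((dh s).const_mul ν).add (h3.const_mul e)).sub (hasDerivAt_id s)).congr_deriv ?_
    have hp := W.pos (γ s).1
    have h4 : √(m (γ s).1 ^ 2 - ν ^ 2) / m (γ s).1 = |x' s| := by
      have : m (γ s).1 ^ 2 - ν ^ 2 = (m (γ s).1 * |x' s|) ^ 2 := by
        have := un s
        rw [mul_pow, sq_abs]
        field_simp at this
        linarith
      rw [this, Real.sqrt_sq (by positivity)]
      field_simp
    rw [h4, hsg s hs]
    have := un s
    have h5 : ν * (ν / m (γ s).1 ^ 2) = ν ^ 2 / m (γ s).1 ^ 2 := by ring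
    rw [h5]
    linear_combination this + x' s ^ 2 * he
  have hconst : ν * (γ a).2 + e * Wn m ν (γ a).1 - a = ν * (γ 0).2 + e * Wn m ν (γ 0).1 - 0 :=
    constant_of_has_deriv_right_zero (f := fun s => ν * (γ s).2 + e * Wn m ν (γ s).1 - s)
      (fun s hs => (hd s hs.1).continuousAt.continuousWithinAt)
      (fun s hs => (hd s hs.1).hasDerivWithinAt) a ⟨ha, le_rfl⟩
  apply le_antisymm
  · simpa using wDist_unit hC1 ha hγ.2.2.2
  · apply le_wDist
    intro c b hb hc c0 c1
    have := W.calib hc hb he (ν := ν) (fun s _ => hν.trans (W.isMin _))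
    rw [wLength_eq]
    refine le_trans ?_ this
    rw [c0, c1]
    linarith

lemma big_model (W : Warp m t₀) {u : ℝ} (hu : 0 < u) (hut : u < t₀) {γ : ℝ → ℝ × ℝ}
    (h0 : γ 0 = (-u, 0)) {ν : ℝ} {x' : ℝ → ℝ}
    (dx : ∀ s, HasDerivAt (fun s => (γ s).1) (x' s) s)
    (dx' : ∀ s, HasDerivAt x' (ν ^ 2 * (deriv m (γ s).1 / m (γ s).1 ^ 3)) s)
    (dh : ∀ s, HasDerivAt (fun s => (γ s).2) (ν / m (γ s).1 ^ 2) s)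
    (un : ∀ s, x' s ^ 2 + ν ^ 2 / m (γ s).1 ^ 2 = 1) (hν : m t₀ < |ν|) :
    ∃ (b : ℝ) (x y h : ℝ → ℝ) (S σ : ℝ), u ≤ b ∧ b < t₀ ∧ σ ^ 2 = 1 ∧ Model m u b x y h S ∧
      ∀ s, 0 ≤ s → γ s = (x s, σ * h s) := by
  have un0 := un 0
  rw [h0] at un0
  simp only [W.even] at un0
  have hpu := W.pos u
  have hνu : |ν| ≤ m u := by
    refine abs_le_of_sq_le_sq ?_ hpu.le
    have h1 : ν ^ 2 / m u ^ 2 ≤ 1 := by nlinarith [sq_nonneg (x' 0)]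
    rwa [div_le_one (by positivity)] at h1
  obtain ⟨b, ⟨hub, hbt⟩, hb⟩ : ∃ b ∈ Icc u t₀, m b = |ν| :=
    intermediate_value_Icc' hut.le W.cont.continuousOn ⟨hν.le, hνu⟩
  have hbt' : b < t₀ := lt_of_le_of_ne hbt fun h => by rw [h] at hb; linarith
  have hb2 : m b ^ 2 = ν ^ 2 := by rw [hb, sq_abs]
  obtain ⟨e, he, hex⟩ : ∃ e : ℝ, (e = 1 ∨ e = -1) ∧ 0 ≤ e * x' 0 := by
    rcases le_total 0 (x' 0) with h | h
    · exact ⟨1, .inl rfl, by linarith⟩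
    · exact ⟨-1, .inr rfl, by linarith⟩
  obtain ⟨σ, hσ, hσν⟩ : ∃ σ : ℝ, σ ^ 2 = 1 ∧ ν = σ * m b := by
    rcases le_total 0 ν with h | h
    · exact ⟨1, by norm_num, by rw [hb, abs_of_nonneg h]; ring⟩
    · exact ⟨-1, by norm_num, by rw [hb, abs_of_nonpos h]; ring⟩
  obtain ⟨x, y, h, S, M, hM⟩ := W.exists_model hu hub hbt' e he
  have hy0 : x' 0 = y 0 := by
    have h1 := M.unit 0
    rw [M.x0, W.even, hb2] at h1
    have h2 : (e * x' 0) ^ 2 = (e * y 0) ^ 2 := by rw [mul_pow, mul_pow]; congr 1; linarith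
    rw [sq_eq_sq₀ hex hM] at h2
    rcases he with rfl | rfl <;> linarith
  have key := ode2_unique _ (W.F_C1 (ν ^ 2)) (fun s => (γ s).1) x' x y dx dx' M.dx
    (fun s => by rw [← hb2]; exact M.dx' s) (by simp [h0, M.x0]) hy0
  refine ⟨b, x, y, h, S, σ, hub, hbt', hσ, M, fun s hs => ?_⟩
  have hd : ∀ s, 0 ≤ s → HasDerivAt (fun s => (γ s).2 - σ * h s) 0 s := fun s hs => by
    refine ((dh s).sub ((M.dh s).const_mul σ)).congr_deriv ?_
    have := (key s hs).1
    rw [this, hσν]; ring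
  have hconst : (γ s).2 - σ * h s = (γ 0).2 - σ * h 0 :=
    constant_of_has_deriv_right_zero (f := fun s => (γ s).2 - σ * h s)
      (fun s hs => (hd s hs.1).continuousAt.continuousWithinAt)
      (fun s hs => (hd s hs.1).hasDerivWithinAt) s ⟨hs, le_rfl⟩
  rw [M.h0, h0] at hconst
  simp only [mul_zero, sub_zero] at hconst
  exact Prod.ext (key s hs).1 (by simp only; linarith)

end Warp

theorem stmt16 (m : ℝ → ℝ) (hm : ContDiff ℝ (⊤:ℕ∞) m) (hmpos : ∀ t, 0 < m t)
    (hmeven : ∀ t, m (-t) = m t)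
    (hK0 : 0 < gaussK m 0) (hKdec : AntitoneOn (gaussK m) (Ici 0))
    (u : ℝ) (hu : 0 < u) (hut : u < tZero m) :
    cutLocus m (-u, 0) = {z : ℝ × ℝ | z.1 = u ∧ phi m (m u) ≤ |z.2|} := by
  have W := warp_of hm hmpos hmeven hK0 hKdec (hu.trans hut)
  ext z
  constructor
  · rintro ⟨γ, a, hγ, h0, ha, hz, hmin, hnot⟩
    obtain ⟨ν, x', dx, dx', dh, un⟩ := W.geod_eqs hγ
    rcases le_or_gt |ν| (m (tZero m)) with hν | hν
    · exact absurd (W.small_min hu hut hγ h0 dx dx' dh un hν (by linarith)) (hnot 1 one_pos)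
    · obtain ⟨b, x, y, h, S, σ, hub, hbt, hσ, M, hE⟩ := W.big_model hu hut h0 dx dx' dh un hν
      have hphi := W.phi_nn (hu.trans_le hub) hbt
      obtain ⟨hx, hh, hS⟩ := W.model_min M hu hub hbt hphi hσ
      have haS : a = S := by
        rcases lt_trichotomy a S with hlt | heq | hgt
        · refine absurd ?_ (hnot (S - a) (by linarith))
          rw [show a + (S - a) = S by ring]
          unfold IsMinimalSeg
          rw [hE 0 le_rfl, hE S M.Spos.le]
          exact hS
        · exact heq
        · have := W.model_nonmin M hu hut hσ (sub_pos.2 hgt)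
          rw [show S + (a - S) = a by ring, ← hE 0 le_rfl, ← hE a ha.le] at this
          exact absurd hmin this.ne
      have hσ1 : |σ| = 1 := by
        rw [← sq_eq_sq₀ (abs_nonneg _) zero_le_one, sq_abs, hσ]; norm_num
      rw [← hz, haS, hE S M.Spos.le, hx, hh]
      refine ⟨rfl, ?_⟩
      simp only
      rw [abs_mul, hσ1, one_mul, abs_of_nonneg hphi]
      exact W.phi_mono hu hub hbt
  · rintro ⟨h1, h2⟩
    obtain ⟨b, hub, hbt, hb⟩ := W.phi_surj hu hut h2
    obtain ⟨σ, hσ, hσz⟩ : ∃ σ : ℝ, σ ^ 2 = 1 ∧ z.2 = σ * |z.2| := by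
      rcases le_total 0 z.2 with h | h
      · exact ⟨1, by norm_num, by rw [abs_of_nonneg h]; ring⟩
      · exact ⟨-1, by norm_num, by rw [abs_of_nonpos h]; ring⟩
    obtain ⟨x, y, h, S, M, hM⟩ := W.exists_model hu hub hbt 1 (.inl rfl)
    have hphi := W.phi_nn (hu.trans_le hub) hbt
    obtain ⟨hx, hh, hS⟩ := W.model_min M hu hub hbt hphi hσ
    refine ⟨fun s => (x s, σ * h s), S, W.model_geod M hσ, ?_, M.Spos, ?_, hS, fun ε hε => ?_⟩
    · simp [M.x0, M.h0]
    · simp only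
      rw [hx, hh, hb, ← hσz, ← h1]
    · exact (W.model_nonmin M hu hut hσ hε).ne
end
end

section
/- Let q ∈ M̃ with |t(q)| ≥ t₀ (where t₀ := sup{t > 0 : m'(t) < 0} is assumed finite). Then the cut locus of q in M̃ is empty; equivalently, every geodesic segment emanating from q is minimal. -/
open Real Set

noncomputable section

/-! ### The flat model functions -/

/-- `√(1 - (ν/x)²)`, truncated at `0`. -/
def wW (ν x : ℝ) : ℝ := √(1 - (ν / x) ^ 2)

/-- The flat model of the calibration, `∫_ν^x √(1 - ν²/u²) du`. -/
def wH (ν x : ℝ) : ℝ := x * wW ν x - ν * arccos (ν / x)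

/-- The convexity defect. -/
def wE (ν ν' x : ℝ) : ℝ := wH ν' x - x * wW ν x + ν' * arccos (ν / x)

lemma wW_nonneg (ν x : ℝ) : 0 ≤ wW ν x := Real.sqrt_nonneg _

lemma wW_eq_zero {ν x : ℝ} (hx : 0 < x) (h : x ≤ ν) : wW ν x = 0 := by
  unfold wW
  apply Real.sqrt_eq_zero_of_nonpos
  have : 1 ≤ ν / x := by rw [le_div_iff₀ hx]; linarith
  nlinarith

lemma wW_sq {ν x : ℝ} (hν : 0 ≤ ν) (hx : 0 < x) (h : ν ≤ x) :
    wW ν x ^ 2 = 1 - (ν / x) ^ 2 := by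
  unfold wW
  apply Real.sq_sqrt
  have h1 : ν / x ≤ 1 := by rw [div_le_one hx]; exact h
  have h0 : 0 ≤ ν / x := by positivity
  nlinarith

lemma wW_pos {ν x : ℝ} (hν : 0 ≤ ν) (h : ν < x) : 0 < wW ν x := by
  unfold wW
  apply Real.sqrt_pos.2
  have hx : 0 < x := by linarith
  have h1 : ν / x < 1 := by rw [div_lt_one hx]; exact h
  have h0 : 0 ≤ ν / x := by positivity
  nlinarith

lemma wH_eq_zero {ν x : ℝ} (hx : 0 < x) (h : x ≤ ν) : wH ν x = 0 := by
  have : 1 ≤ ν / x := by rw [le_div_iff₀ hx]; linarith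
  unfold wH
  rw [wW_eq_zero hx h, Real.arccos_of_one_le this]; ring

lemma hasDerivAt_arccosdiv {ν x : ℝ} (hν : 0 < ν) (h : ν < x) :
    HasDerivAt (fun x => arccos (ν / x)) (ν / (x ^ 2 * wW ν x)) x := by
  have hx : 0 < x := by linarith
  have h1 : ν / x < 1 := by rw [div_lt_one hx]; exact h
  have h0 : 0 < ν / x := by positivity
  have hd : HasDerivAt (fun x => ν / x) (-ν / x ^ 2) x := by
    have := (hasDerivAt_inv hx.ne').const_mul ν
    refine this.congr_deriv ?_
    field_simp
  have := (Real.hasDerivAt_arccos (x := ν / x) (by linarith) h1.ne).comp x hd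
  have hw := wW_pos hν.le h
  refine this.congr_deriv ?_
  unfold wW at *
  field_simp

lemma hasDerivAt_mulW {ν x : ℝ} (hν : 0 < ν) (h : ν < x) :
    HasDerivAt (fun x => x * wW ν x) (1 / wW ν x) x := by
  have hx : 0 < x := by linarith
  have hd : HasDerivAt (fun x => 1 - (ν / x) ^ 2) (2 * ν ^ 2 / x ^ 3) x := by
    have := (((hasDerivAt_inv hx.ne').const_mul ν).pow 2).const_sub 1
    refine this.congr_deriv ?_
    field_simp
    norm_num
    field_simp
  have hw := wW_pos hν.le h
  have hsq := wW_sq hν.le hx h.le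
  have hne : 1 - (ν / x) ^ 2 ≠ 0 := by rw [← hsq]; positivity
  have := (hasDerivAt_id x).mul (hd.sqrt hne)
  refine this.congr_deriv ?_
  change 1 * wW ν x + x * (2 * ν ^ 2 / x ^ 3 / (2 * wW ν x)) = _
  field_simp
  rw [hsq]
  field_simp
  ring

lemma hasDerivAt_wH_of_lt {ν x : ℝ} (hν : 0 < ν) (h : ν < x) :
    HasDerivAt (wH ν) (wW ν x) x := by
  have hx : 0 < x := by linarith
  have hw := wW_pos hν.le h
  have hsq := wW_sq hν.le hx h.le
  have := (hasDerivAt_mulW hν h).sub ((hasDerivAt_arccosdiv hν h).const_mul ν)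
  refine this.congr_deriv ?_
  field_simp
  rw [hsq]
  field_simp

lemma continuousAt_wW {ν x : ℝ} (hx : 0 < x) : ContinuousAt (wW ν) x := by
  unfold wW
  have : ContinuousAt (fun x => ν / x) x := continuousAt_const.div continuousAt_id hx.ne'
  fun_prop

lemma continuousAt_arccosdiv {ν x : ℝ} (hx : 0 < x) :
    ContinuousAt (fun x => arccos (ν / x)) x := by
  have : ContinuousAt (fun x => ν / x) x := continuousAt_const.div continuousAt_id hx.ne'
  exact Real.continuous_arccos.continuousAt.comp this

lemma continuousAt_wH {ν x : ℝ} (hx : 0 < x) : ContinuousAt (wH ν) x := by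
  unfold wH
  have h1 := continuousAt_wW (ν := ν) hx
  have h2 := continuousAt_arccosdiv (ν := ν) hx
  exact (continuousAt_id.mul h1).sub (continuousAt_const.mul h2)

lemma hasDerivAt_wH {ν x : ℝ} (hν : 0 < ν) (hx : 0 < x) :
    HasDerivAt (wH ν) (wW ν x) x := by
  rcases lt_trichotomy ν x with h | h | h
  · exact hasDerivAt_wH_of_lt hν h
  · subst h
    have key : HasDerivAt (fun x => wH ν (max x ν)) (wW ν (max ν ν)) ν := by
      apply hasDerivAt_of_hasDerivAt_of_ne (g := fun x => wW ν (max x ν))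
      · intro y hy
        rcases lt_or_gt_of_ne hy with h | h
        · simp only [max_eq_right h.le]
          rw [wW_eq_zero hν le_rfl]
          refine (hasDerivAt_const y (0:ℝ)).congr_of_eventuallyEq ?_
          filter_upwards [Iio_mem_nhds h] with z hz
          rw [max_eq_right (le_of_lt hz), wH_eq_zero hν le_rfl]
        · simp only [max_eq_left h.le]
          refine (hasDerivAt_wH_of_lt hν h).congr_of_eventuallyEq ?_
          filter_upwards [Ioi_mem_nhds h] with z hz
          rw [max_eq_left (le_of_lt hz)]
      · have : ContinuousAt (wH ν) (max ν ν) := continuousAt_wH (by simpa using hν)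
        exact ContinuousAt.comp (f := fun x => max x ν) this (by fun_prop)
      · have : ContinuousAt (wW ν) (max ν ν) := continuousAt_wW (by simpa using hν)
        exact ContinuousAt.comp (f := fun x => max x ν) this (by fun_prop)
    rw [max_self] at key
    refine key.congr_of_eventuallyEq ?_
    filter_upwards [Ioi_mem_nhds hν] with z hz
    rcases le_total z ν with h | h
    · rw [max_eq_right h, wH_eq_zero hz h, wH_eq_zero hν le_rfl]
    · rw [max_eq_left h]
  · rw [wW_eq_zero hx h.le]
    refine (hasDerivAt_const x (0:ℝ)).congr_of_eventuallyEq ?_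
    filter_upwards [Iio_mem_nhds h, Ioi_mem_nhds hx] with z hz hz0
    exact wH_eq_zero hz0 (le_of_lt hz)

lemma sin_tangent {a b : ℝ} (ha : a ∈ Icc 0 π) (hb : b ∈ Icc 0 π) :
    sin b ≤ sin a + cos a * (b - a) := by
  have hc : ConcaveOn ℝ (Icc 0 π) sin := strictConcaveOn_sin_Icc.concaveOn
  rcases lt_trichotomy a b with h | h | h
  · have := hc.slope_le_of_hasDerivAt ha hb h (Real.hasDerivAt_sin a)
    rw [slope_def_field, div_le_iff₀ (by linarith)] at this
    linarith
  · subst h; simp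
  · have := hc.le_slope_of_hasDerivAt hb ha h (Real.hasDerivAt_sin a)
    rw [slope_def_field, le_div_iff₀ (by linarith)] at this
    linarith

lemma wE_nonneg {ν ν' x : ℝ} (hν : 0 < ν) (hν' : 0 < ν') (hx : 0 < x) :
    0 ≤ wE ν ν' x := by
  have e1 : ∀ μ, wW μ x = sin (arccos (μ / x)) := fun μ => (Real.sin_arccos _).symm
  unfold wE
  rcases le_total ν' x with h | h
  · unfold wH
    have h1 : ν' / x ≤ 1 := by rw [div_le_one hx]; exact h
    have h0 : 0 < ν' / x := by positivity
    have hcos := Real.cos_arccos (x := ν' / x) (by linarith) h1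
    rw [e1, e1]
    have := sin_tangent (a := arccos (ν' / x)) (b := arccos (ν / x))
      ⟨arccos_nonneg _, arccos_le_pi _⟩ ⟨arccos_nonneg _, arccos_le_pi _⟩
    rw [hcos] at this
    have h2 := mul_le_mul_of_nonneg_left this hx.le
    have h3 : x * (ν' / x * (arccos (ν / x) - arccos (ν' / x))) =
      ν' * (arccos (ν / x) - arccos (ν' / x)) := by field_simp
    rw [mul_add, h3] at h2
    linarith
  · rw [wH_eq_zero hx h, e1]
    have h1 := Real.sin_le (arccos_nonneg (ν / x))
    have h2 := mul_le_mul_of_nonneg_left h1 hx.le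
    have h3 := mul_le_mul_of_nonneg_right h (arccos_nonneg (ν / x))
    linarith

lemma hasDerivAt_wE {ν ν' x : ℝ} (hν : 0 < ν) (hν' : 0 < ν') (h : ν < x) :
    HasDerivAt (wE ν ν') (wW ν' x - 1 / wW ν x + ν' * (ν / (x ^ 2 * wW ν x))) x :=
  ((hasDerivAt_wH hν' (hν.trans h)).sub (hasDerivAt_mulW hν h)).add
    ((hasDerivAt_arccosdiv hν h).const_mul ν')

lemma continuousAt_wE {ν ν' x : ℝ} (hx : 0 < x) : ContinuousAt (wE ν ν') x :=
  ((continuousAt_wH hx).sub (continuousAt_id.mul (continuousAt_wW hx))).add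
    (continuousAt_const.mul (continuousAt_arccosdiv hx))

/-! ### Geodesics, profiles and calibrations -/

/-- A unit speed geodesic written in components. -/
structure wGeo (m : ℝ → ℝ) (ν : ℝ) (T v Θ : ℝ → ℝ) : Prop where
  dT : ∀ s, HasDerivAt T (v s) s
  dv : ∀ s, HasDerivAt v (ν ^ 2 * deriv m (T s) / m (T s) ^ 3) s
  dΘ : ∀ s, HasDerivAt Θ (ν / m (T s) ^ 2) s
  en : ∀ s, v s ^ 2 + (ν / m (T s)) ^ 2 = 1

/-- The properties of the warping function used below. -/
structure wProf (m : ℝ → ℝ) (t₀ : ℝ) : Prop where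
  cd : ContDiff ℝ 2 m
  pos : ∀ t, 0 < m t
  min : ∀ t, m t₀ ≤ m t
  d1 : ∀ t, t₀ < t → 0 < deriv m t
  d2 : ∀ t, t₀ < t → 0 ≤ deriv (deriv m) t

lemma wProf.hm {m : ℝ → ℝ} {t₀ : ℝ} (P : wProf m t₀) (t : ℝ) :
    HasDerivAt m (deriv m t) t :=
  (P.cd.differentiable (by norm_num) t).hasDerivAt

lemma wProf.cd1 {m : ℝ → ℝ} {t₀ : ℝ} (P : wProf m t₀) : ContDiff ℝ 1 (deriv m) := by
  have h := P.cd
  rw [show (2 : WithTop ℕ∞) = 1 + 1 by norm_num, contDiff_succ_iff_deriv] at h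
  exact h.2.2

lemma wProf.hm1 {m : ℝ → ℝ} {t₀ : ℝ} (P : wProf m t₀) (t : ℝ) :
    HasDerivAt (deriv m) (deriv (deriv m) t) t :=
  (P.cd1.differentiable (by norm_num) t).hasDerivAt

lemma wProf.cont {m : ℝ → ℝ} {t₀ : ℝ} (P : wProf m t₀) : Continuous m := P.cd.continuous

lemma wProf.strictMono {m : ℝ → ℝ} {t₀ : ℝ} (P : wProf m t₀) : StrictMonoOn m (Ici t₀) := by
  apply strictMonoOn_of_deriv_pos (convex_Ici _) P.cont.continuousOn
  intro x hx
  rw [interior_Ici] at hx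
  exact P.d1 x hx

/-- The calibration potential. -/
def wG (m : ℝ → ℝ) (t₀ ν t : ℝ) : ℝ := ∫ u in t₀..t, wW ν (m u)

lemma wProf.contW {m : ℝ → ℝ} {t₀ : ℝ} (P : wProf m t₀) (ν : ℝ) :
    Continuous fun u => wW ν (m u) := by
  rw [continuous_iff_continuousAt]
  intro u
  exact ContinuousAt.comp (f := m) (continuousAt_wW (P.pos u)) P.cont.continuousAt

lemma wProf.hasDerivAt_wG {m : ℝ → ℝ} {t₀ : ℝ} (P : wProf m t₀) (ν t : ℝ) :
    HasDerivAt (wG m t₀ ν) (wW ν (m t)) t :=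
  intervalIntegral.integral_hasDerivAt_right ((P.contW ν).intervalIntegrable _ _)
    ((P.contW ν).stronglyMeasurableAtFilter _ _) (P.contW ν).continuousAt

lemma wG_self (m : ℝ → ℝ) (t₀ ν : ℝ) : wG m t₀ ν t₀ = 0 := by simp [wG]

lemma wG_nonneg (m : ℝ → ℝ) {t₀ t : ℝ} (ν : ℝ) (h : t₀ ≤ t) : 0 ≤ wG m t₀ ν t :=
  intervalIntegral.integral_nonneg h fun _ _ => wW_nonneg _ _

lemma wProf.wG_zero {m : ℝ → ℝ} {t₀ : ℝ} (P : wProf m t₀) {ν y : ℝ} (hy : t₀ ≤ y)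
    (h : m y ≤ ν) : wG m t₀ ν y = 0 := by
  unfold wG
  rw [intervalIntegral.integral_congr (g := fun _ => (0:ℝ))]
  · simp
  · intro u hu
    rw [uIcc_of_le hy] at hu
    exact wW_eq_zero (P.pos u)
      (le_trans (P.strictMono.monotoneOn hu.1 hy hu.2) h)

lemma wProf.wG_cont {m : ℝ → ℝ} {t₀ : ℝ} (P : wProf m t₀) (t : ℝ) :
    Continuous fun ν => wG m t₀ ν t := by
  unfold wG
  apply intervalIntegral.continuous_parametric_intervalIntegral_of_continuous'
  have h := P.cont
  unfold wW
  have : Continuous fun p : ℝ × ℝ => p.1 / m p.2 :=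
    continuous_fst.div (h.comp continuous_snd) fun p => (P.pos _).ne'
  exact (continuous_const.sub (this.pow 2)).sqrt

lemma wCalib_pt {ν M p w σ : ℝ} (hν : 0 ≤ ν) (hM : 0 < M) (h : ν ≤ M) (hσ : σ ^ 2 = 1) :
    ν * w + σ * (wW ν M * p) ≤ √(p ^ 2 + M ^ 2 * w ^ 2) := by
  apply Real.le_sqrt_of_sq_le
  have hs := wW_sq hν hM h
  obtain ⟨a, ha⟩ : ∃ a, a = ν / M := ⟨_, rfl⟩
  have hν' : ν = a * M := by rw [ha]; field_simp
  rw [← ha] at hs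
  rw [hν']
  have e1 : (a * M * w + σ * (wW ν M * p)) ^ 2 + (σ * wW ν M * (M * w) - a * p) ^ 2
      = (a ^ 2 + σ ^ 2 * wW ν M ^ 2) * (p ^ 2 + M ^ 2 * w ^ 2) := by ring
  rw [hσ, hs] at e1
  rw [← hν']
  rw [← hν'] at e1
  nlinarith [sq_nonneg (σ * wW ν M * (M * w) - a * p)]

/-- The length of the curve with components `x`, `y`. -/
def wLen (m x y : ℝ → ℝ) (a b : ℝ) : ℝ :=
  ∫ s in a..b, √((deriv x s) ^ 2 + (m (x s)) ^ 2 * (deriv y s) ^ 2)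

lemma wProf.wLen_cont {m : ℝ → ℝ} {t₀ : ℝ} (P : wProf m t₀) {x y : ℝ → ℝ}
    (hx : ContDiff ℝ 1 x) (hy : ContDiff ℝ 1 y) :
    Continuous fun s => √((deriv x s) ^ 2 + (m (x s)) ^ 2 * (deriv y s) ^ 2) := by
  have h1 := hx.continuous_deriv le_rfl
  have h2 := hy.continuous_deriv le_rfl
  have h3 := P.cont
  have h4 := hx.continuous
  fun_prop

lemma wProf.calib {m : ℝ → ℝ} {t₀ : ℝ} (P : wProf m t₀) {ν σ : ℝ} (hν : 0 ≤ ν)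
    (hσ : σ ^ 2 = 1) {x y : ℝ → ℝ}
    (hx : ContDiff ℝ 1 x) (hy : ContDiff ℝ 1 y) {a b : ℝ} (hab : a ≤ b)
    (h : ∀ s ∈ Icc a b, ν ≤ m (x s)) :
    ν * (y b - y a) + σ * (wG m t₀ ν (x b) - wG m t₀ ν (x a)) ≤ wLen m x y a b := by
  have h1 := hx.continuous_deriv le_rfl
  have h2 := hy.continuous_deriv le_rfl
  have hW : Continuous fun s => wW ν (m (x s)) := (P.contW ν).comp hx.continuous
  have hc : Continuous fun s => ν * deriv y s + σ * (wW ν (m (x s)) * deriv x s) := by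
    fun_prop
  have e : ∫ s in a..b, (ν * deriv y s + σ * (wW ν (m (x s)) * deriv x s)) =
      (ν * y b + σ * wG m t₀ ν (x b)) - (ν * y a + σ * wG m t₀ ν (x a)) := by
    apply intervalIntegral.integral_eq_sub_of_hasDerivAt
      (f := fun s => ν * y s + σ * wG m t₀ ν (x s))
    · intro s _
      have dx := (hx.differentiable (by norm_num) s).hasDerivAt
      have dy := (hy.differentiable (by norm_num) s).hasDerivAt
      exact (dy.const_mul ν).add (((P.hasDerivAt_wG ν (x s)).comp s dx).const_mul σ)
    · exact hc.intervalIntegrable _ _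
  have := intervalIntegral.integral_mono_on (μ := MeasureTheory.volume) hab (hc.intervalIntegrable a b)
    ((P.wLen_cont hx hy).intervalIntegrable a b)
    (fun s hs => wCalib_pt hν (P.pos _) (h s hs) hσ)
  rw [e] at this
  unfold wLen
  linarith

lemma wGeo.W_eq {m T v Θ : ℝ → ℝ} {ν : ℝ} (g : wGeo m ν T v Θ) (s : ℝ) :
    wW ν (m (T s)) = |v s| := by
  unfold wW
  rw [← Real.sqrt_sq_eq_abs]
  congr 1
  linarith [g.en s]

lemma wGeo.contT {m T v Θ : ℝ → ℝ} {ν : ℝ} (g : wGeo m ν T v Θ) : Continuous T :=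
  continuous_iff_continuousAt.2 fun s => (g.dT s).continuousAt

lemma wGeo.contv {m T v Θ : ℝ → ℝ} {ν : ℝ} (g : wGeo m ν T v Θ) : Continuous v :=
  continuous_iff_continuousAt.2 fun s => (g.dv s).continuousAt

lemma wGeo.contΘ {m T v Θ : ℝ → ℝ} {ν : ℝ} (g : wGeo m ν T v Θ) : Continuous Θ :=
  continuous_iff_continuousAt.2 fun s => (g.dΘ s).continuousAt

lemma wGeo.le_m {m T v Θ : ℝ → ℝ} {ν t₀ : ℝ} (P : wProf m t₀) (g : wGeo m ν T v Θ)
    (s : ℝ) : ν ≤ m (T s) := by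
  have h := g.en s
  have h1 : (ν / m (T s)) ^ 2 ≤ 1 := by nlinarith [sq_nonneg (v s)]
  have h2 : ν / m (T s) ≤ 1 := by nlinarith
  rwa [div_le_one (P.pos _)] at h2

lemma wGeo.reverse {m T v Θ : ℝ → ℝ} {ν : ℝ} (g : wGeo m ν T v Θ) :
    wGeo m ν (fun s => T (-s)) (fun s => -v (-s)) (fun s => -Θ (-s)) where
  dT s := by
    have := (g.dT (-s)).comp s (hasDerivAt_neg s)
    exact this.congr_deriv (by ring)
  dv s := by
    have := ((g.dv (-s)).comp s (hasDerivAt_neg s)).neg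
    exact this.congr_deriv (by ring)
  dΘ s := by
    have := ((g.dΘ (-s)).comp s (hasDerivAt_neg s)).neg
    exact this.congr_deriv (by ring)
  en s := by
    have := g.en (-s)
    simpa using this

lemma wGeo.shift {m T v Θ : ℝ → ℝ} {ν : ℝ} (g : wGeo m ν T v Θ) (r : ℝ) :
    wGeo m ν (fun s => T (s + r)) (fun s => v (s + r)) (fun s => Θ (s + r)) where
  dT s := (g.dT (s + r)).comp_add_const s r
  dv s := (g.dv (s + r)).comp_add_const s r
  dΘ s := (g.dΘ (s + r)).comp_add_const s r
  en s := g.en (s + r)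

lemma wGeo.length {m T v Θ : ℝ → ℝ} {ν t₀ : ℝ} (P : wProf m t₀) (g : wGeo m ν T v Θ)
    {a b σ : ℝ} (hab : a ≤ b) (hσ : σ ^ 2 = 1) (h : ∀ s ∈ Icc a b, 0 ≤ σ * v s) :
    ν * (Θ b - Θ a) + σ * (wG m t₀ ν (T b) - wG m t₀ ν (T a)) = b - a := by
  have hW : Continuous fun s => wW ν (m (T s)) := (P.contW ν).comp g.contT
  have hv := g.contv
  have hT := g.contT
  have hm : Continuous fun s => ν / m (T s) ^ 2 :=
    continuous_const.div ((P.cont.comp hT).pow 2) fun s => (pow_pos (P.pos _) 2).ne'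
  have hc : Continuous fun s => ν * (ν / m (T s) ^ 2) + σ * (wW ν (m (T s)) * v s) := by
    fun_prop
  have e : ∫ s in a..b, (ν * (ν / m (T s) ^ 2) + σ * (wW ν (m (T s)) * v s)) =
      (ν * Θ b + σ * wG m t₀ ν (T b)) - (ν * Θ a + σ * wG m t₀ ν (T a)) := by
    apply intervalIntegral.integral_eq_sub_of_hasDerivAt
      (f := fun s => ν * Θ s + σ * wG m t₀ ν (T s))
    · intro s _
      exact ((g.dΘ s).const_mul ν).add
        (((P.hasDerivAt_wG ν (T s)).comp s (g.dT s)).const_mul σ)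
    · exact hc.intervalIntegrable _ _
  have e2 : ∫ s in a..b, (ν * (ν / m (T s) ^ 2) + σ * (wW ν (m (T s)) * v s)) =
      ∫ s in a..b, (1:ℝ) := by
    apply intervalIntegral.integral_congr
    intro s hs
    rw [uIcc_of_le hab] at hs
    have h1 := h s hs
    have h2 := g.en s
    have h3 : |v s| = σ * v s := by
      rw [← abs_of_nonneg h1, abs_mul]
      have : |σ| = 1 := by
        rw [← sq_eq_sq₀ (abs_nonneg _) zero_le_one, sq_abs, hσ, one_pow]
      rw [this, one_mul]
    have hp := P.pos (T s)
    simp only [g.W_eq, h3]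
    rw [← h2]
    have : σ * (σ * v s * v s) = v s ^ 2 := by
      calc _ = σ ^ 2 * v s ^ 2 := by ring
        _ = _ := by rw [hσ, one_mul]
    rw [this]
    field_simp
    ring
  rw [e] at e2
  simp at e2
  linarith

/-! ### The key inequality -/

lemma wProf.base {m : ℝ → ℝ} {t₀ : ℝ} (P : wProf m t₀) {ξ ν' : ℝ} (hξ : t₀ < ξ)
    (hν' : m t₀ < ν') : wH ν' (m ξ) / deriv m ξ ≤ wG m t₀ ν' ξ := by
  have hpos : 0 < ν' := (P.pos _).trans hν'
  rcases le_or_gt (m ξ) ν' with h | h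
  · rw [wH_eq_zero (P.pos _) h, zero_div]
    exact wG_nonneg m ν' hξ.le
  · obtain ⟨y, hy, hyν⟩ : ν' ∈ m '' Ioo t₀ ξ :=
      intermediate_value_Ioo hξ.le P.cont.continuousOn ⟨hν', h⟩
    have hd : ∀ t, t₀ < t →
        HasDerivAt (fun t => wG m t₀ ν' t - wH ν' (m t) / deriv m t)
          (wH ν' (m t) * deriv (deriv m) t / deriv m t ^ 2) t := by
      intro t ht
      have h1 := P.d1 t ht
      have := (P.hasDerivAt_wG ν' t).sub
        (((hasDerivAt_wH hpos (P.pos t)).comp t (P.hm t)).div (P.hm1 t) h1.ne')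
      refine this.congr_deriv ?_
      simp only [Function.comp]
      field_simp
      ring
    have hH : ∀ x, 0 < x → 0 ≤ wH ν' x := by
      intro x hx
      have := wE_nonneg (ν := x) (ν' := ν') hx hpos hx
      unfold wE at this
      rw [wW_eq_zero hx le_rfl, div_self hx.ne', arccos_one] at this
      linarith
    have hmono : MonotoneOn (fun t => wG m t₀ ν' t - wH ν' (m t) / deriv m t) (Icc y ξ) := by
      apply monotoneOn_of_deriv_nonneg (convex_Icc _ _)
      · intro t ht
        exact (hd t (hy.1.trans_le ht.1)).continuousAt.continuousWithinAt
      · intro t ht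
        rw [interior_Icc] at ht
        exact (hd t (hy.1.trans ht.1)).differentiableAt.differentiableWithinAt
      · intro t ht
        rw [interior_Icc] at ht
        rw [(hd t (hy.1.trans ht.1)).deriv]
        have h1 := P.d2 t (hy.1.trans ht.1)
        have h2 := hH (m t) (P.pos t)
        positivity
    have := hmono ⟨le_rfl, hy.2.le⟩ ⟨hy.2.le, le_rfl⟩ hy.2.le
    simp only [hyν, wH_eq_zero hpos le_rfl, zero_div] at this
    have h0 := wG_nonneg m ν' hy.1.le
    linarith

lemma wGeo.m_eq {m T v Θ : ℝ → ℝ} {ν t₀ : ℝ} (P : wProf m t₀) (g : wGeo m ν T v Θ)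
    (hν : 0 ≤ ν) {s : ℝ} (h : v s = 0) : m (T s) = ν := by
  have h1 := g.en s
  have hp := P.pos (T s)
  have h2 : 0 ≤ ν / m (T s) := by positivity
  have h3 : ν / m (T s) = 1 := by rw [h] at h1; nlinarith
  rw [div_eq_one_iff_eq hp.ne'] at h3
  exact h3.symm

lemma wGeo.key {m T v Θ : ℝ → ℝ} {ν t₀ : ℝ} (P : wProf m t₀) (g : wGeo m ν T v Θ)
    (hν : m t₀ < ν) (hT : ∀ s, t₀ < T s) (v0 : v 0 = 0) (vpos : ∀ s, 0 < s → 0 < v s)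
    {ν' : ℝ} (hν' : m t₀ < ν') {s : ℝ} (hs : 0 ≤ s) :
    s ≤ wG m t₀ ν' (T s) + ν' * (Θ s - Θ 0) := by
  have hp : 0 < ν := (P.pos _).trans hν
  have hp' : 0 < ν' := (P.pos _).trans hν'
  have hd : ∀ s, 0 < s → HasDerivAt
      (fun s => wG m t₀ ν' (T s) + ν' * (Θ s - Θ 0) - s - wE ν ν' (m (T s)) / deriv m (T s))
      (wE ν ν' (m (T s)) * deriv (deriv m) (T s) * v s / deriv m (T s) ^ 2) s := by
    intro s hs
    have hv := vpos s hs
    have hW : wW ν (m (T s)) = v s := by rw [g.W_eq, abs_of_pos hv]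
    have hlt : ν < m (T s) := by
      refine lt_of_le_of_ne (g.le_m P s) fun h => ?_
      have := wW_eq_zero (P.pos (T s)) h.ge
      linarith
    have hm := P.pos (T s)
    have h1 := P.d1 _ (hT s)
    have a1 := (P.hasDerivAt_wG ν' (T s)).comp s (g.dT s)
    have a2 := ((g.dΘ s).sub_const (Θ 0)).const_mul ν'
    have a3 := ((hasDerivAt_wE hp hp' hlt).comp (T s) (P.hm (T s))).comp s (g.dT s)
    have a4 := (P.hm1 (T s)).comp s (g.dT s)
    have := ((a1.add a2).sub (hasDerivAt_id s)).sub (a3.div a4 h1.ne')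
    refine this.congr_deriv ?_
    simp only [Function.comp, hW]
    field_simp
    ring
  have hmono : MonotoneOn
      (fun s => wG m t₀ ν' (T s) + ν' * (Θ s - Θ 0) - s - wE ν ν' (m (T s)) / deriv m (T s))
      (Ici 0) := by
    apply monotoneOn_of_deriv_nonneg (convex_Ici _)
    · intro s _
      apply ContinuousAt.continuousWithinAt
      have c1 : ContinuousAt (fun s => wG m t₀ ν' (T s)) s :=
        ((P.hasDerivAt_wG ν' (T s)).comp s (g.dT s)).continuousAt
      have c2 : ContinuousAt Θ s := (g.dΘ s).continuousAt
      have c3 : ContinuousAt (fun s => m (T s)) s := ((P.hm _).comp s (g.dT s)).continuousAt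
      have c4 : ContinuousAt (fun s => wE ν ν' (m (T s))) s :=
        ContinuousAt.comp (f := fun s => m (T s)) (continuousAt_wE (P.pos (T s))) c3
      have c5 : ContinuousAt (fun s => deriv m (T s)) s :=
        ((P.hm1 _).comp s (g.dT s)).continuousAt
      exact ((c1.add (continuousAt_const.mul (c2.sub continuousAt_const))).sub
        continuousAt_id).sub (c4.div c5 (P.d1 _ (hT s)).ne')
    · intro s hs
      rw [interior_Ici] at hs
      exact (hd s hs).differentiableAt.differentiableWithinAt
    · intro s hs
      rw [interior_Ici] at hs
      rw [(hd s hs).deriv]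
      have h1 := P.d2 _ (hT s)
      have h2 := wE_nonneg hp hp' (P.pos (T s))
      have h3 := vpos s hs
      positivity
  have h1 := hmono (mem_Ici.2 le_rfl) (mem_Ici.2 hs) hs
  have hm0 := g.m_eq P hp.le v0
  have hE0 : wE ν ν' (m (T 0)) = wH ν' (m (T 0)) := by
    unfold wE
    rw [hm0, wW_eq_zero hp le_rfl, div_self hp.ne', arccos_one]; ring
  have h2 := P.base (hT 0) hν'
  have h3 : 0 ≤ wE ν ν' (m (T s)) / deriv m (T s) :=
    div_nonneg (wE_nonneg hp hp' (P.pos _)) (P.d1 _ (hT s)).le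
  simp only [hE0] at h1
  linarith

lemma wGeo.key' {m T v Θ : ℝ → ℝ} {ν t₀ : ℝ} (P : wProf m t₀) (g : wGeo m ν T v Θ)
    (hν : m t₀ < ν) (hT : ∀ s, t₀ < T s) (v0 : v 0 = 0) (vpos : ∀ s, 0 < s → 0 < v s)
    {ν' : ℝ} (hν' : m t₀ ≤ ν') {s : ℝ} (hs : 0 ≤ s) :
    s ≤ wG m t₀ ν' (T s) + ν' * (Θ s - Θ 0) := by
  have hc : Continuous fun ν' => wG m t₀ ν' (T s) + ν' * (Θ s - Θ 0) :=
    (P.wG_cont (T s)).add (continuous_id.mul continuous_const)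
  have hcl : IsClosed {ν' | s ≤ wG m t₀ ν' (T s) + ν' * (Θ s - Θ 0)} :=
    isClosed_le continuous_const hc
  have hsub : Ioi (m t₀) ⊆ {ν' | s ≤ wG m t₀ ν' (T s) + ν' * (Θ s - Θ 0)} :=
    fun ν' h => g.key P hν hT v0 vpos h hs
  have := hcl.closure_subset_iff.2 hsub
  rw [closure_Ioi] at this
  exact this hν'

lemma wGeo.exists_nonpos {m T v Θ : ℝ → ℝ} {ν t₀ : ℝ} (P : wProf m t₀)
    (g : wGeo m ν T v Θ) (hν : m t₀ < ν) (hT : ∀ s, t₀ < T s) : ∃ s, v s ≤ 0 := by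
  by_contra hcon
  push Not at hcon
  have hp : 0 < ν := (P.pos _).trans hν
  obtain ⟨ξ, hξ, hξν⟩ : ν ∈ m '' Ioc t₀ (T 0) :=
    intermediate_value_Ioc (hT 0).le P.cont.continuousOn ⟨hν, g.le_m P 0⟩
  have hTξ : ∀ s, ξ ≤ T s := by
    intro s
    by_contra h
    push Not at h
    have := P.strictMono (hT s).le hξ.1.le h
    have := g.le_m P s
    linarith
  have hTm : StrictMono T := strictMono_of_deriv_pos fun s => by
    rw [(g.dT s).deriv]; exact hcon s
  have hm1 : MonotoneOn (deriv m) (Ioi t₀) := by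
    apply monotoneOn_of_deriv_nonneg (convex_Ioi _) P.cd1.continuous.continuousOn
      (P.cd1.differentiable (by norm_num)).differentiableOn
    intro t ht
    rw [interior_Ioi] at ht
    exact P.d2 t ht
  obtain ⟨δ, hδ⟩ : ∃ δ, δ = ν ^ 2 * deriv m ξ / m (T 0) ^ 3 := ⟨_, rfl⟩
  have hm0 := P.pos (T 0)
  have hd1 := P.d1 ξ hξ.1
  have hδp : 0 < δ := by rw [hδ]; positivity
  have hmono : MonotoneOn (fun s => v s - δ * s) (Iic 0) := by
    have hd : ∀ s, HasDerivAt (fun s => v s - δ * s)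
        (ν ^ 2 * deriv m (T s) / m (T s) ^ 3 - δ * 1) s :=
      fun s => (g.dv s).sub ((hasDerivAt_id s).const_mul δ)
    apply monotoneOn_of_deriv_nonneg (convex_Iic _)
    · exact fun s _ => (hd s).continuousAt.continuousWithinAt
    · exact fun s _ => (hd s).differentiableAt.differentiableWithinAt
    · intro s hs
      rw [interior_Iic] at hs
      rw [(hd s).deriv]
      have h1 : deriv m ξ ≤ deriv m (T s) := hm1 hξ.1 (hT s) (hTξ s)
      have h2 : m (T s) ≤ m (T 0) :=
        P.strictMono.monotoneOn (hT s).le (hT 0).le (hTm.monotone (le_of_lt hs))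
      have h3 := P.pos (T s)
      have h4 := P.d1 _ (hT s)
      have : δ ≤ ν ^ 2 * deriv m (T s) / m (T s) ^ 3 := by
        rw [hδ]; gcongr
      linarith
  have hv0 := hcon 0
  have hs0 : -((v 0 + 1) / δ) ≤ 0 := by
    have : 0 ≤ (v 0 + 1) / δ := by positivity
    linarith
  have := hmono (mem_Iic.2 hs0) (mem_Iic.2 le_rfl) hs0
  have h2 := hcon (-((v 0 + 1) / δ))
  have h3 : δ * -((v 0 + 1) / δ) = -(v 0 + 1) := by field_simp
  simp only [h3] at this
  linarith

lemma wProf.split {m : ℝ → ℝ} {t₀ : ℝ} (P : wProf m t₀) {x y : ℝ → ℝ}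
    (hx : ContDiff ℝ 1 x) (hy : ContDiff ℝ 1 y) {b : ℝ} (hb : 0 ≤ b)
    (hx0 : t₀ ≤ x 0) :
    ∃ ν', m t₀ ≤ ν' ∧ (∀ s ∈ Icc 0 b, ν' ≤ m (x s)) ∧
      ν' * (y b - y 0) + wG m t₀ ν' (x 0) + wG m t₀ ν' (x b) ≤ wLen m x y 0 b := by
  obtain ⟨s₁, hs₁, hmin⟩ := isCompact_Icc.exists_isMinOn (nonempty_Icc.2 hb)
    hx.continuous.continuousOn
  have hmin' : ∀ s ∈ Icc 0 b, x s₁ ≤ x s := fun s hs => hmin hs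
  obtain ⟨Y, s₂, hs₂, hY, hYt, hle⟩ : ∃ Y, ∃ s₂ ∈ Icc 0 b, x s₂ = Y ∧ t₀ ≤ Y ∧
      ∀ s ∈ Icc 0 b, m Y ≤ m (x s) := by
    rcases le_or_gt t₀ (x s₁) with h | h
    · exact ⟨_, s₁, hs₁, rfl, h, fun s hs =>
        P.strictMono.monotoneOn h (h.trans (hmin' s hs)) (hmin' s hs)⟩
    · obtain ⟨s₂, hs₂, h2⟩ : t₀ ∈ x '' Icc 0 s₁ :=
        intermediate_value_Icc' hs₁.1 hx.continuous.continuousOn ⟨h.le, hx0⟩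
      exact ⟨t₀, s₂, ⟨hs₂.1, hs₂.2.trans hs₁.2⟩, h2, le_rfl, fun s _ => P.min _⟩
  refine ⟨m Y, P.min Y, hle, ?_⟩
  have h1 := P.calib (σ := -1) (P.pos Y).le (by norm_num) hx hy hs₂.1
    (fun s hs => hle s ⟨hs.1, hs.2.trans hs₂.2⟩)
  have h2 := P.calib (σ := 1) (P.pos Y).le (by norm_num) hx hy hs₂.2
    (fun s hs => hle s ⟨hs₂.1.trans hs.1, hs.2⟩)
  have h3 : wLen m x y 0 s₂ + wLen m x y s₂ b = wLen m x y 0 b :=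
    intervalIntegral.integral_add_adjacent_intervals
      ((P.wLen_cont hx hy).intervalIntegrable _ _) ((P.wLen_cont hx hy).intervalIntegrable _ _)
  have h4 : wG m t₀ (m Y) (x s₂) = 0 := by rw [hY]; exact P.wG_zero hYt le_rfl
  rw [h4] at h1 h2
  linarith

lemma wGeo.case2_apex {m T v Θ : ℝ → ℝ} {ν t₀ : ℝ} (P : wProf m t₀) (g : wGeo m ν T v Θ)
    (hν : m t₀ < ν) (hT : ∀ s, t₀ < T s) (v0 : v 0 = 0) {α β : ℝ} (hαβ : α ≤ β)
    {x y : ℝ → ℝ} (hx : ContDiff ℝ 1 x) (hy : ContDiff ℝ 1 y) {b : ℝ} (hb : 0 ≤ b)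
    (hx0 : x 0 = T α) (hy0 : y 0 = Θ α) (hxb : x b = T β) (hyb : y b = Θ β) :
    β - α ≤ wLen m x y 0 b := by
  have hp : 0 < ν := (P.pos _).trans hν
  have vmono : StrictMono v := strictMono_of_deriv_pos fun s => by
    rw [(g.dv s).deriv]
    have h1 := P.d1 _ (hT s)
    have h2 := P.pos (T s)
    positivity
  have vpos : ∀ s, 0 < s → 0 < v s := fun s hs => by rw [← v0]; exact vmono hs
  have vneg : ∀ s, s < 0 → v s < 0 := fun s hs => by rw [← v0]; exact vmono hs
  have Θmono : Monotone Θ := (strictMono_of_deriv_pos fun s => by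
    rw [(g.dΘ s).deriv]
    have h2 := P.pos (T s)
    positivity).monotone
  have hG0 : wG m t₀ ν (T 0) = 0 := P.wG_zero (hT 0).le (g.m_eq P hp.le v0).le
  have lenR : ∀ s, 0 ≤ s → ν * (Θ s - Θ 0) + wG m t₀ ν (T s) = s := by
    intro s hs
    have := g.length P (σ := 1) hs (by norm_num) (fun r hr => by
      rw [one_mul, ← v0]; exact vmono.monotone hr.1)
    rw [hG0] at this
    linarith
  have lenL : ∀ s, s ≤ 0 → ν * (Θ 0 - Θ s) + wG m t₀ ν (T s) = -s := by
    intro s hs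
    have := g.length P (σ := -1) hs (by norm_num) (fun r hr => by
      have : v r ≤ v 0 := vmono.monotone hr.2
      linarith)
    rw [hG0] at this
    linarith
  obtain ⟨ν', hν', hle, hL⟩ := P.split hx hy hb (by rw [hx0]; exact (hT α).le)
  rw [hx0, hxb, hy0, hyb] at hL
  have hp' : 0 < ν' := (P.pos _).trans_le hν'
  have keyR : ∀ s, 0 ≤ s → s ≤ wG m t₀ ν' (T s) + ν' * (Θ s - Θ 0) :=
    fun s hs => g.key' P hν hT v0 vpos hν' hs
  have keyL : ∀ s, s ≤ 0 → -s ≤ wG m t₀ ν' (T s) + ν' * (Θ 0 - Θ s) := by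
    intro s hs
    have := g.reverse.key' P hν (fun s => hT (-s)) (by simp [v0])
      (fun s hs => by have := vneg (-s) (by linarith); linarith) hν' (s := -s) (by linarith)
    simp only [neg_neg, neg_zero] at this
    linarith
  have hGn : ∀ μ s, 0 ≤ wG m t₀ μ (T s) := fun μ s => wG_nonneg m μ (hT s).le
  rcases le_total 0 α with hα | hα
  · have hβ : 0 ≤ β := hα.trans hαβ
    rcases le_or_gt ν ν' with h | h
    · have h1 := P.calib (σ := 1) hp.le (by norm_num) hx hy hb
        (fun s hs => h.trans (hle s hs))
      rw [hx0, hxb, hy0, hyb] at h1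
      have h2 := lenR α hα
      have h3 := lenR β hβ
      linarith
    · have h1 := keyR β hβ
      have h2 := lenR α hα
      have h3 : ν' * (Θ α - Θ 0) ≤ ν * (Θ α - Θ 0) :=
        mul_le_mul_of_nonneg_right h.le (sub_nonneg.2 (Θmono hα))
      have h4 := hGn ν α
      have h5 := hGn ν' α
      linarith
  · rcases le_total 0 β with hβ | hβ
    · have h1 := keyR β hβ
      have h2 := keyL α hα
      linarith
    · rcases le_or_gt ν ν' with h | h
      · have h1 := P.calib (σ := -1) hp.le (by norm_num) hx hy hb
          (fun s hs => h.trans (hle s hs))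
        rw [hx0, hxb, hy0, hyb] at h1
        have h2 := lenL α hα
        have h3 := lenL β hβ
        linarith
      · have h1 := keyL α hα
        have h2 := lenL β hβ
        have h3 : ν' * (Θ 0 - Θ β) ≤ ν * (Θ 0 - Θ β) :=
          mul_le_mul_of_nonneg_right h.le (sub_nonneg.2 (Θmono hβ))
        have h4 := hGn ν β
        have h5 := hGn ν' β
        linarith

lemma wGeo.case2 {m T v Θ : ℝ → ℝ} {ν t₀ : ℝ} (P : wProf m t₀) (g : wGeo m ν T v Θ)
    (hν : m t₀ < ν) (hT0 : t₀ ≤ T 0) {a : ℝ} (ha : 0 ≤ a)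
    {x y : ℝ → ℝ} (hx : ContDiff ℝ 1 x) (hy : ContDiff ℝ 1 y) {b : ℝ} (hb : 0 ≤ b)
    (hx0 : x 0 = T 0) (hy0 : y 0 = Θ 0) (hxb : x b = T a) (hyb : y b = Θ a) :
    a ≤ wLen m x y 0 b := by
  have hne : ∀ s, T s ≠ t₀ := by
    intro s h
    have := g.le_m P s
    rw [h] at this
    linarith
  have hT : ∀ s, t₀ < T s := by
    intro s
    by_contra h
    push Not at h
    obtain ⟨r, hr⟩ := mem_range_of_exists_le_of_exists_ge g.contT ⟨s, h⟩ ⟨0, hT0⟩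
    exact hne r hr
  obtain ⟨s₁, h₁⟩ := g.exists_nonpos P hν hT
  obtain ⟨s₂, h₂⟩ := g.reverse.exists_nonpos P hν (fun s => hT (-s))
  obtain ⟨r, hr⟩ := mem_range_of_exists_le_of_exists_ge (c := (0:ℝ)) g.contv ⟨s₁, h₁⟩
    ⟨-s₂, by linarith⟩
  have := (g.shift r).case2_apex P hν (fun s => hT (s + r)) (by simpa using hr)
    (α := -r) (β := a - r) (by linarith) hx hy hb (by simpa using hx0) (by simpa using hy0)
    (by simpa using hxb) (by simpa using hyb)
  linarith

/-! ### Small Clairaut constants -/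

lemma wGeo.rest_right {m T v Θ : ℝ → ℝ} {ν t₀ : ℝ} (P : wProf m t₀) (g : wGeo m ν T v Θ)
    {s₀ : ℝ} (h0 : v s₀ = 0) (h1 : deriv m (T s₀) = 0) {s : ℝ} (hs : s₀ ≤ s) : v s = 0 := by
  have hh : ContDiff ℝ 1 fun t => ν ^ 2 * deriv m t / m t ^ 3 :=
    (contDiff_const.mul P.cd1).div ((P.cd.of_le (by norm_num)).pow 3)
      fun t => (pow_pos (P.pos t) 3).ne'
  have hK : IsCompact (T '' Icc s₀ s) := isCompact_Icc.image g.contT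
  obtain ⟨C, hC⟩ := (hh.locallyLipschitz.locallyLipschitzOn
    (s := T '' Icc s₀ s)).exists_lipschitzOnWith_of_compact hK
  have hmem0 : T s₀ ∈ T '' Icc s₀ s := ⟨s₀, ⟨le_rfl, hs⟩, rfl⟩
  have hd : ∀ r, HasDerivAt (fun r => (T r - T s₀) ^ 2 + v r ^ 2)
      (2 * (T r - T s₀) * v r + 2 * v r * (ν ^ 2 * deriv m (T r) / m (T r) ^ 3)) r := by
    intro r
    have := (((g.dT r).sub_const (T s₀)).pow 2).add ((g.dv r).pow 2)
    refine this.congr_deriv ?_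
    norm_num
  have key := eq_zero_of_abs_deriv_le_mul_abs_self_of_eq_zero_right
    (f := fun r => (T r - T s₀) ^ 2 + v r ^ 2)
    (f' := fun r => 2 * (T r - T s₀) * v r + 2 * v r * (ν ^ 2 * deriv m (T r) / m (T r) ^ 3))
    (K := 1 + C) (a := s₀) (b := s)
    (fun r _ => (hd r).continuousAt.continuousWithinAt)
    (fun r _ => (hd r).hasDerivWithinAt) (by simp [h0]) (by
      intro r hr
      have hb := hC.dist_le_mul (T r) ⟨r, ⟨hr.1, hr.2.le⟩, rfl⟩ (T s₀) hmem0
      rw [Real.dist_eq, Real.dist_eq, h1] at hb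
      simp only [mul_zero, zero_div, sub_zero] at hb
      set A := T r - T s₀
      set B := ν ^ 2 * deriv m (T r) / m (T r) ^ 3
      have hC0 : (0:ℝ) ≤ C := C.2
      have e1 : ‖A ^ 2 + v r ^ 2‖ = |A| ^ 2 + |v r| ^ 2 := by
        rw [Real.norm_of_nonneg (by positivity), sq_abs, sq_abs]
      rw [e1, Real.norm_eq_abs]
      have e2 : |2 * A * v r + 2 * v r * B| ≤ 2 * |A| * |v r| + 2 * |v r| * |B| := by
        refine (abs_add_le _ _).trans ?_
        simp [abs_mul]
      have e3 : |v r| * |B| ≤ |v r| * (C * |A|) :=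
        mul_le_mul_of_nonneg_left hb (abs_nonneg _)
      have e4 : 0 ≤ (1 + (C:ℝ)) * (|A| - |v r|) ^ 2 := by positivity
      nlinarith) s ⟨hs, le_rfl⟩
  have key' : (T s - T s₀) ^ 2 + v s ^ 2 = 0 := key
  have : v s ^ 2 = 0 := by nlinarith [sq_nonneg (T s - T s₀), sq_nonneg (v s)]
  exact pow_eq_zero_iff (two_ne_zero) |>.1 this

lemma wGeo.case1 {m T v Θ : ℝ → ℝ} {ν t₀ : ℝ} (P : wProf m t₀) (g : wGeo m ν T v Θ)
    (hν0 : 0 ≤ ν) (hν : ν ≤ m t₀) {a : ℝ} (ha : 0 ≤ a)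
    {x y : ℝ → ℝ} (hx : ContDiff ℝ 1 x) (hy : ContDiff ℝ 1 y) {b : ℝ} (hb : 0 ≤ b)
    (hx0 : x 0 = T 0) (hy0 : y 0 = Θ 0) (hxb : x b = T a) (hyb : y b = Θ a) :
    a ≤ wLen m x y 0 b := by
  have main : ∀ σ : ℝ, σ ^ 2 = 1 → (∀ s, 0 ≤ σ * v s) → a ≤ wLen m x y 0 b := by
    intro σ hσ h
    have h1 := P.calib hν0 hσ hx hy hb (fun s _ => hν.trans (P.min _))
    have h2 := g.length P ha hσ (fun s _ => h s)
    rw [hx0, hxb, hy0, hyb] at h1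
    linarith
  by_cases hz : ∃ s₀, v s₀ = 0
  · obtain ⟨s₀, h0⟩ := hz
    have hm0 := g.m_eq P hν0 h0
    have h1 : deriv m (T s₀) = 0 := by
      apply IsLocalMin.deriv_eq_zero
      refine Filter.Eventually.of_forall fun t => ?_
      rw [hm0]
      exact hν.trans (P.min t)
    have hv : ∀ s, v s = 0 := by
      intro s
      rcases le_total s₀ s with h | h
      · exact g.rest_right P h0 h1 h
      · have := g.reverse.rest_right P (s₀ := -s₀) (by simp [h0]) (by simpa using h1)
          (s := -s) (by linarith)
        simpa using this
    exact main 1 (by norm_num) (fun s => by rw [hv]; simp)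
  · push Not at hz
    by_cases hpos : ∀ s, 0 ≤ v s
    · exact main 1 (by norm_num) (fun s => by simpa using hpos s)
    · push Not at hpos
      obtain ⟨s₁, h₁⟩ := hpos
      refine main (-1) (by norm_num) (fun s => ?_)
      by_contra hcon
      obtain ⟨r, hr⟩ := mem_range_of_exists_le_of_exists_ge (c := (0:ℝ)) g.contv ⟨s₁, h₁.le⟩
        ⟨s, by linarith⟩
      exact hz r hr

lemma wGeo.negΘ {m T v Θ : ℝ → ℝ} {ν : ℝ} (g : wGeo m ν T v Θ) :
    wGeo m (-ν) T v (fun s => -Θ s) where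
  dT := g.dT
  dv s := (g.dv s).congr_deriv (by ring)
  dΘ s := (g.dΘ s).neg.congr_deriv (by ring)
  en s := by
    have := g.en s
    rw [neg_div, neg_sq]
    exact this

lemma wDerivOdd {m : ℝ → ℝ} (he : ∀ t, m (-t) = m t) (t : ℝ) : deriv m (-t) = -deriv m t := by
  have h : (fun t => m (-t)) = m := funext he
  have := deriv_comp_neg m t
  rw [h] at this
  linarith

lemma wGeo.negT {m T v Θ : ℝ → ℝ} {ν : ℝ} (he : ∀ t, m (-t) = m t) (g : wGeo m ν T v Θ) :
    wGeo m ν (fun s => -T s) (fun s => -v s) Θ where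
  dT s := (g.dT s).neg
  dv s := (g.dv s).neg.congr_deriv (by rw [he, wDerivOdd he]; ring)
  dΘ s := by rw [he]; exact g.dΘ s
  en s := by rw [he, neg_sq]; exact g.en s

lemma wLen_negy (m x y : ℝ → ℝ) (a b : ℝ) : wLen m x (fun s => -y s) a b = wLen m x y a b := by
  unfold wLen
  simp [deriv.fun_neg]

lemma wLen_negx {m : ℝ → ℝ} (he : ∀ t, m (-t) = m t) (x y : ℝ → ℝ) (a b : ℝ) :
    wLen m (fun s => -x s) y a b = wLen m x y a b := by
  unfold wLen
  simp [deriv.fun_neg, he]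

lemma wGeo.core {m T v Θ : ℝ → ℝ} {ν t₀ : ℝ} (P : wProf m t₀) (g : wGeo m ν T v Θ)
    (hT0 : t₀ ≤ T 0) {a : ℝ} (ha : 0 ≤ a)
    {x y : ℝ → ℝ} (hx : ContDiff ℝ 1 x) (hy : ContDiff ℝ 1 y) {b : ℝ} (hb : 0 ≤ b)
    (hx0 : x 0 = T 0) (hy0 : y 0 = Θ 0) (hxb : x b = T a) (hyb : y b = Θ a) :
    a ≤ wLen m x y 0 b := by
  have nonneg : ∀ (ν : ℝ) (Θ y : ℝ → ℝ), 0 ≤ ν → wGeo m ν T v Θ → ContDiff ℝ 1 y →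
      y 0 = Θ 0 → y b = Θ a → a ≤ wLen m x y 0 b := by
    intro ν Θ y hν g hy hy0 hyb
    rcases le_or_gt ν (m t₀) with h | h
    · exact g.case1 P hν h ha hx hy hb hx0 hy0 hxb hyb
    · exact g.case2 P h hT0 ha hx hy hb hx0 hy0 hxb hyb
  rcases le_total 0 ν with h | h
  · exact nonneg ν Θ y h g hy hy0 hyb
  · rw [← wLen_negy]
    exact nonneg (-ν) _ _ (by linarith) g.negΘ hy.neg (by simp [hy0]) (by simp [hyb])

lemma wGeo.final {m T v Θ : ℝ → ℝ} {ν t₀ : ℝ} (P : wProf m t₀) (he : ∀ t, m (-t) = m t)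
    (g : wGeo m ν T v Θ) (hT0 : t₀ ≤ |T 0|) {a : ℝ} (ha : 0 ≤ a)
    {x y : ℝ → ℝ} (hx : ContDiff ℝ 1 x) (hy : ContDiff ℝ 1 y) {b : ℝ} (hb : 0 ≤ b)
    (hx0 : x 0 = T 0) (hy0 : y 0 = Θ 0) (hxb : x b = T a) (hyb : y b = Θ a) :
    a ≤ wLen m x y 0 b := by
  rcases le_abs.1 hT0 with h | h
  · exact g.core P h ha hx hy hb hx0 hy0 hxb hyb
  · rw [← wLen_negx he]
    exact (g.negT he).core P h ha hx.neg hy hb (by simp [hx0]) hy0 (by simp [hxb]) hyb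

/-! ### The profile and the theorem -/

lemma wProf_of (m : ℝ → ℝ) (hm : ContDiff ℝ (⊤:ℕ∞) m) (hmpos : ∀ t, 0 < m t)
    (hmeven : ∀ t, m (-t) = m t)
    (hK0 : 0 < gaussK m 0) (hKdec : AntitoneOn (gaussK m) (Ici 0))
    (hbdd : BddAbove {t : ℝ | 0 < t ∧ deriv m t < 0}) : wProf m (tZero m) := by
  have cd : ContDiff ℝ 2 m := contDiff_infty.1 hm 2
  have cd1 : ContDiff ℝ 1 (deriv m) := by
    have h := cd
    rw [show (2 : WithTop ℕ∞) = 1 + 1 by norm_num, contDiff_succ_iff_deriv] at h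
    exact h.2.2
  have c1 : Continuous (deriv m) := cd1.continuous
  have df1 : Differentiable ℝ (deriv m) := cd1.differentiable (by norm_num)
  have h00 : deriv m 0 = 0 := by
    have := wDerivOdd hmeven 0
    rw [neg_zero] at this
    linarith
  have Kpos : ∀ t, 0 ≤ gaussK m t → deriv (deriv m) t ≤ 0 := by
    intro t h
    by_contra hc
    push Not at hc
    have : gaussK m t < 0 := div_neg_of_neg_of_pos (by linarith) (hmpos t)
    linarith
  have Kneg : ∀ t, gaussK m t < 0 → 0 < deriv (deriv m) t := by
    intro t h
    by_contra hc
    push Not at hc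
    have : 0 ≤ gaussK m t := div_nonneg (by linarith) (hmpos t).le
    linarith
  have h20 : deriv (deriv m) 0 < 0 := by
    by_contra hc
    push Not at hc
    have : gaussK m 0 ≤ 0 := div_nonpos_of_nonpos_of_nonneg (by linarith) (hmpos 0).le
    linarith
  -- where `K ≥ 0` the derivative is antitone
  have anti : ∀ t, 0 ≤ t → 0 ≤ gaussK m t → AntitoneOn (deriv m) (Icc 0 t) := by
    intro t ht hK
    apply antitoneOn_of_deriv_nonpos (convex_Icc _ _) c1.continuousOn df1.differentiableOn
    intro r hr
    rw [interior_Icc] at hr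
    exact Kpos r (hK.trans (hKdec (mem_Ici.2 hr.1.le) (mem_Ici.2 ht) hr.2.le))
  have mono : ∀ t, 0 ≤ t → gaussK m t < 0 → StrictMonoOn (deriv m) (Ici t) := by
    intro t ht hK
    apply strictMonoOn_of_deriv_pos (convex_Ici _) c1.continuousOn
    intro r hr
    rw [interior_Ici] at hr
    have hr' : t < r := hr
    exact Kneg r ((hKdec (mem_Ici.2 ht) (mem_Ici.2 (ht.trans hr'.le)) hr'.le).trans_lt hK)
  have small : ∀ t, 0 < t → ∃ r, 0 < r ∧ r < t ∧ deriv m r < 0 := by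
    intro t ht
    have hd : HasDerivAt (deriv m) (deriv (deriv m) 0) 0 := (df1 0).hasDerivAt
    have hsl := (hasDerivAt_iff_tendsto_slope.1 hd).eventually (gt_mem_nhds h20)
    have hsl' : ∀ᶠ r in nhdsWithin (0:ℝ) (Ioi 0), slope (deriv m) 0 r < 0 :=
      hsl.filter_mono (nhdsWithin_mono _ fun r (hr : 0 < r) => hr.ne')
    obtain ⟨r, hr, hr2⟩ := (hsl'.and (Ioo_mem_nhdsGT ht)).exists
    refine ⟨r, hr2.1, hr2.2, ?_⟩
    rw [slope_def_field, h00, sub_zero, sub_zero] at hr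
    by_contra hc
    push Not at hc
    have := div_nonneg hc hr2.1.le
    linarith
  have hne : {t : ℝ | 0 < t ∧ deriv m t < 0}.Nonempty := by
    obtain ⟨r, h1, -, h2⟩ := small 1 one_pos
    exact ⟨r, h1, h2⟩
  have hpos0 : 0 < tZero m := by
    obtain ⟨r, hr⟩ := hne
    exact hr.1.trans_le (le_csSup hbdd hr)
  have hgt : ∀ t, tZero m < t → 0 ≤ deriv m t := by
    intro t ht
    by_contra hc
    push Not at hc
    have := le_csSup hbdd (show t ∈ {t : ℝ | 0 < t ∧ deriv m t < 0} from ⟨hpos0.trans ht, hc⟩)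
    exact absurd ht (not_lt.2 this)
  have hge0 : 0 ≤ deriv m (tZero m) := by
    have hcl : IsClosed {t | 0 ≤ deriv m t} := isClosed_le continuous_const c1
    have := hcl.closure_subset_iff.2 (show Ioi (tZero m) ⊆ _ from fun t ht => hgt t ht)
    rw [closure_Ioi] at this
    exact this (mem_Ici.2 le_rfl)
  have hle0 : deriv m (tZero m) ≤ 0 := by
    have hcl : IsClosed {t | deriv m t ≤ 0} := isClosed_le c1 continuous_const
    have := hcl.closure_subset_iff.2
      (show {t : ℝ | 0 < t ∧ deriv m t < 0} ⊆ _ from fun t ht => ht.2.le)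
    exact this (csSup_mem_closure hne hbdd)
  have hKt : gaussK m (tZero m) < 0 := by
    by_contra hc
    push Not at hc
    have ha := anti _ hpos0.le hc
    obtain ⟨r, h1, h2, h3⟩ := small _ hpos0
    have := ha ⟨h1.le, h2.le⟩ ⟨hpos0.le, le_rfl⟩ h2.le
    linarith
  have hsm := mono _ hpos0.le hKt
  have hd1 : ∀ t, tZero m < t → 0 < deriv m t := fun t ht =>
    hge0.trans_lt (hsm (mem_Ici.2 le_rfl) (mem_Ici.2 ht.le) ht)
  have hneg : ∀ t, 0 ≤ t → t ≤ tZero m → deriv m t ≤ 0 := by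
    intro t h0 h1
    rcases le_or_gt 0 (gaussK m t) with h | h
    · rw [← h00]
      exact anti t h0 h ⟨le_rfl, h0⟩ ⟨h0, le_rfl⟩ h0
    · exact ((mono t h0 h).monotoneOn (mem_Ici.2 le_rfl) (mem_Ici.2 h1) h1).trans hle0
  have hmin : ∀ t, 0 ≤ t → m (tZero m) ≤ m t := by
    intro t ht
    rcases le_total t (tZero m) with h | h
    · have : AntitoneOn m (Icc 0 (tZero m)) := by
        apply antitoneOn_of_deriv_nonpos (convex_Icc _ _) cd.continuous.continuousOn
          (cd.differentiable (by norm_num)).differentiableOn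
        intro r hr
        rw [interior_Icc] at hr
        exact hneg r hr.1.le hr.2.le
      exact this ⟨ht, h⟩ ⟨hpos0.le, le_rfl⟩ h
    · have : MonotoneOn m (Ici (tZero m)) := by
        apply monotoneOn_of_deriv_nonneg (convex_Ici _) cd.continuous.continuousOn
          (cd.differentiable (by norm_num)).differentiableOn
        intro r hr
        rw [interior_Ici] at hr
        exact (hd1 r hr).le
      exact this (mem_Ici.2 le_rfl) (mem_Ici.2 h) h
  refine ⟨cd, hmpos, ?_, hd1, ?_⟩
  · intro t
    rcases le_total 0 t with h | h
    · exact hmin t h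
    · rw [← hmeven t]; exact hmin (-t) (by linarith)
  · intro t ht
    exact (Kneg t ((hKdec (mem_Ici.2 hpos0.le) (mem_Ici.2 (hpos0.trans ht).le)
      ht.le).trans_lt hKt)).le

lemma wGeo_of {m : ℝ → ℝ} (hmpos : ∀ t, 0 < m t) {γ : ℝ → ℝ × ℝ} (h : IsUnitGeodesic m γ) :
    ∃ ν, wGeo m ν (fun s => (γ s).1) (deriv fun s => (γ s).1) (fun s => (γ s).2) := by
  obtain ⟨hc, h1, ⟨ν, h2⟩, h3⟩ := h
  have hΘ : ∀ s, deriv (fun u => (γ u).2) s = ν / m (γ s).1 ^ 2 := by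
    intro s
    have hp := hmpos (γ s).1
    rw [← h2 s]
    field_simp
  have hcT : ContDiff ℝ 2 fun s => (γ s).1 := contDiff_fst.comp hc
  have hcΘ : ContDiff ℝ 2 fun s => (γ s).2 := contDiff_snd.comp hc
  have hcv : ContDiff ℝ 1 (deriv fun s => (γ s).1) := by
    have h := hcT
    rw [show (2 : WithTop ℕ∞) = 1 + 1 by norm_num, contDiff_succ_iff_deriv] at h
    exact h.2.2
  refine ⟨ν, fun s => (hcT.differentiable (by norm_num) s).hasDerivAt, fun s => ?_,
    fun s => ?_, fun s => ?_⟩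
  · have hp := hmpos (γ s).1
    refine (hcv.differentiable (by norm_num) s).hasDerivAt.congr_deriv ?_
    rw [h1, hΘ]
    field_simp
  · rw [← hΘ s]
    exact (hcΘ.differentiable (by norm_num) s).hasDerivAt
  · have hp := hmpos (γ s).1
    have := h3 s
    rw [hΘ s] at this
    rw [← this]
    field_simp

/-- Lemma 5.5: let `q ∈ M̃` with `|t(q)| ≥ t₀`, where
`t₀ = sup {t > 0 | m'(t) < 0}` is assumed finite.  Then the cut locus of `q` is empty;
equivalently, every geodesic segment emanating from `q` is minimal. -/
theorem stmt17 (m : ℝ → ℝ) (hm : ContDiff ℝ (⊤:ℕ∞) m) (hmpos : ∀ t, 0 < m t)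
    (hmeven : ∀ t, m (-t) = m t)
    (hK0 : 0 < gaussK m 0) (hKdec : AntitoneOn (gaussK m) (Ici 0))
    (hbdd : BddAbove {t : ℝ | 0 < t ∧ deriv m t < 0})
    (q : ℝ × ℝ) (hq : tZero m ≤ |q.1|) :
    cutLocus m q = ∅ ∧
    ∀ γ : ℝ → ℝ × ℝ, IsUnitGeodesic m γ → γ 0 = q →
      ∀ a : ℝ, 0 ≤ a → IsMinimalSeg m γ a := by
  have P := wProf_of m hm hmpos hmeven hK0 hKdec hbdd
  have main : ∀ γ : ℝ → ℝ × ℝ, IsUnitGeodesic m γ → γ 0 = q →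
      ∀ a : ℝ, 0 ≤ a → IsMinimalSeg m γ a := by
    intro γ hγ hγ0 a ha
    obtain ⟨ν, g⟩ := wGeo_of hmpos hγ
    have hlen : wLength m γ 0 a = a := by
      unfold wLength
      have : ∀ s, √((deriv (fun u => (γ u).1) s) ^ 2 +
          (m (γ s).1) ^ 2 * (deriv (fun u => (γ u).2) s) ^ 2) = 1 := by
        intro s
        rw [hγ.2.2.2 s, Real.sqrt_one]
      simp [this]
    have hmem : a ∈ {L : ℝ | ∃ c : ℝ → ℝ × ℝ, ∃ b : ℝ, 0 ≤ b ∧ ContDiff ℝ 1 c ∧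
        c 0 = γ 0 ∧ c b = γ a ∧ L = wLength m c 0 b} :=
      ⟨γ, a, ha, hγ.1.of_le (by norm_num), rfl, rfl, hlen.symm⟩
    have hlb : ∀ L ∈ {L : ℝ | ∃ c : ℝ → ℝ × ℝ, ∃ b : ℝ, 0 ≤ b ∧ ContDiff ℝ 1 c ∧
        c 0 = γ 0 ∧ c b = γ a ∧ L = wLength m c 0 b}, a ≤ L := by
      rintro L ⟨c, b, hb, hc, hc0, hcb, rfl⟩
      exact g.final P hmeven (by simpa [hγ0] using hq) ha
        (x := fun s => (c s).1) (y := fun s => (c s).2)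
        (contDiff_fst.comp hc) (contDiff_snd.comp hc) hb
        (by simp [hc0]) (by simp [hc0]) (by simp [hcb]) (by simp [hcb])
    exact le_antisymm (csInf_le ⟨a, hlb⟩ hmem) (le_csInf ⟨a, hmem⟩ hlb)
  refine ⟨?_, main⟩
  rw [Set.eq_empty_iff_forall_notMem]
  rintro x ⟨γ, a, hγ, hγ0, ha, -, -, hcut⟩
  exact hcut 1 one_pos (main γ hγ hγ0 (a + 1) (by linarith))
end
end
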